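/- If p ∈ (0,1) and q = (q_n : n ∈ ℤ), q' = (q'_n : n ∈ ℤ) ∈ [0,1]^ℤ satisfy κ_△(p, q_n, q'_n) = 0 for every n ∈ ℤ, then both the highly inhomogeneous measure P^△_{p,q,q'} on the triangular lattice and its dual measure P^⬡_{1−p,1−q,1−q'} on the hexagonal lattice have the box-crossing property. -/

import Mathlib

open MeasureTheory Set

set_option linter.unusedVariables false

namespace Perc

/-- Points of the plane. -/
abbrev Pt := ℝ × ℝ

/-- A lattice embedded in the plane, with edges indexed by `E`;
each edge is embedded as the segment between the two endpoints given by `ends`. -/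
structure LatticeOn (E : Type) where
  ends : E → Pt × Pt

/-- Bond configurations. -/
abbrev Config (E : Type) := E → Bool

/-- `P` is the Bernoulli bond-percolation product measure in which edge `e`
is open with probability `p e`, independently over edges. -/
def IsBernoulliProduct {E : Type} (p : E → ℝ) (P : Measure (Config E)) : Prop :=
  IsProbabilityMeasure P ∧
    ∀ (s : Finset E) (f : E → Bool),
      P {ω | ∀ e ∈ s, ω e = f e} =
        ∏ e ∈ s, ENNReal.ofReal (if f e then p e else 1 - p e)

/-- The union of the closed segments of the open edges. -/
def openEdgeSet {E : Type} (L : LatticeOn E) (ω : Config E) : Set Pt :=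
  ⋃ e ∈ {e : E | ω e = true}, segment ℝ (L.ends e).1 (L.ends e).2

/-- There is an arc, contained in `S` and in the union of the open edges,
with one endpoint in `A` and the other in `B`. -/
def CrossingIn {E : Type} (L : LatticeOn E) (ω : Config E) (S A B : Set Pt) : Prop :=
  ∃ γ : ℝ → Pt, ContinuousOn γ (Icc 0 1) ∧ γ 0 ∈ A ∧ γ 1 ∈ B ∧
    ∀ t ∈ Icc (0:ℝ) 1, γ t ∈ S ∩ openEdgeSet L ω

/-- Rotation of the plane by angle `θ`. -/
noncomputable def rot (θ : ℝ) (z : Pt) : Pt :=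
  (Real.cos θ * z.1 - Real.sin θ * z.2, Real.sin θ * z.1 + Real.cos θ * z.2)

/-- `f` comprises a rotation and a translation. -/
def IsRotTrans (f : Pt → Pt) : Prop := ∃ θ : ℝ, ∃ t : Pt, f = fun z => rot θ z + t

def stdRect (h l : ℝ) : Set Pt := {z | 0 ≤ z.1 ∧ z.1 ≤ h ∧ 0 ≤ z.2 ∧ z.2 ≤ l}
def leftSide (h l : ℝ) : Set Pt := {z | z.1 = 0 ∧ 0 ≤ z.2 ∧ z.2 ≤ l}
def rightSide (h l : ℝ) : Set Pt := {z | z.1 = h ∧ 0 ≤ z.2 ∧ z.2 ≤ l}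
def bottomSide (h l : ℝ) : Set Pt := {z | z.2 = 0 ∧ 0 ≤ z.1 ∧ z.1 ≤ h}
def topSide (h l : ℝ) : Set Pt := {z | z.2 = l ∧ 0 ≤ z.1 ∧ z.1 ≤ h}

/-- The box `f(stdRect h l)` (where `f` is a rotation plus translation) possesses
open crossings in both directions. -/
def HasBoxCrossings {E : Type} (L : LatticeOn E) (ω : Config E) (h l : ℝ) (f : Pt → Pt) : Prop :=
  CrossingIn L ω (f '' stdRect h l) (f '' leftSide h l) (f '' rightSide h l) ∧
  CrossingIn L ω (f '' stdRect h l) (f '' bottomSide h l) (f '' topSide h l)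

/-- The box-crossing property: for every `α > 0` there is `δ > 0` such that every box
of size `αN × N` (any position and orientation) possesses open crossings with
probability at least `δ`, for all large `N`. -/
def BoxCrossingProperty {E : Type} (L : LatticeOn E) (P : Measure (Config E)) : Prop :=
  ∀ α : ℝ, 0 < α → ∃ δ : ℝ, 0 < δ ∧ ∃ N₀ : ℕ, ∀ N : ℕ, N₀ ≤ N →
    ∀ f : Pt → Pt, IsRotTrans f →
      ENNReal.ofReal δ ≤ P {ω | HasBoxCrossings L ω (α * N) N f}

/-- Horizontal-crossing event of the box `[-m,m] × [0,n]`. -/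
def Ch {E : Type} (L : LatticeOn E) (m n : ℝ) (ω : Config E) : Prop :=
  CrossingIn L ω {z | -m ≤ z.1 ∧ z.1 ≤ m ∧ 0 ≤ z.2 ∧ z.2 ≤ n}
    {z | z.1 = -m ∧ 0 ≤ z.2 ∧ z.2 ≤ n} {z | z.1 = m ∧ 0 ≤ z.2 ∧ z.2 ≤ n}

/-- Vertical-crossing event of the box `[-m,m] × [0,n]`. -/
def Cv {E : Type} (L : LatticeOn E) (m n : ℝ) (ω : Config E) : Prop :=
  CrossingIn L ω {z | -m ≤ z.1 ∧ z.1 ≤ m ∧ 0 ≤ z.2 ∧ z.2 ≤ n}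
    {z | z.2 = 0 ∧ -m ≤ z.1 ∧ z.1 ≤ m} {z | z.2 = n ∧ -m ≤ z.1 ∧ z.1 ≤ m}

/-- `u` and `v` are the endpoints of some open edge. -/
def openAdj {E : Type} (L : LatticeOn E) (ω : Config E) (u v : Pt) : Prop :=
  ∃ e, ω e = true ∧ (L.ends e = (u, v) ∨ L.ends e = (v, u))

/-- `u` and `v` are joined by a path of open edges. -/
def openConn {E : Type} (L : LatticeOn E) (ω : Config E) : Pt → Pt → Prop :=
  Relation.ReflTransGen (openAdj L ω)

/-- The open cluster at `v`. -/
def cluster {E : Type} (L : LatticeOn E) (ω : Config E) (v : Pt) : Set Pt :=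
  {u | openConn L ω v u}

/-- The vertex set of the lattice. -/
def vertexSet {E : Type} (L : LatticeOn E) : Set Pt :=
  ⋃ e : E, {(L.ends e).1, (L.ends e).2}

/-- `v` is the endpoint of an infinite open self-avoiding path. -/
def ConnToInfinity {E : Type} (L : LatticeOn E) (ω : Config E) (v : Pt) : Prop :=
  ∃ γ : ℕ → Pt, γ 0 = v ∧ Function.Injective γ ∧ ∀ n, openAdj L ω (γ n) (γ (n + 1))

/-- Euclidean distance on the plane. -/
noncomputable def edist2 (u v : Pt) : ℝ := Real.sqrt ((u.1 - v.1) ^ 2 + (u.2 - v.2) ^ 2)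

/-- `rad (C_v) ≥ r`, where `rad (C_v)` is the supremum of all `x` such that `C_v`
meets the complement of the open Euclidean ball `v + S_x`. -/
def RadiusGE {E : Type} (L : LatticeOn E) (ω : Config E) (v : Pt) (r : ℝ) : Prop :=
  ∀ x : ℝ, x < r → ∃ u ∈ cluster L ω v, x ≤ edist2 v u

/-- `κ_□`. -/
def kappaS (a b : ℝ) : ℝ := a + b - 1
/-- `κ_△`. -/
def kappaT (a b c : ℝ) : ℝ := a + b + c - a * b * c - 1
/-- `κ_⬡`. -/
def kappaH (a b c : ℝ) : ℝ := -kappaT (1 - a) (1 - b) (1 - c)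

/-- Edges of a square-type lattice: `(a, b, true)` is the `horizontal`-class edge
at `(a,b)` and `(a, b, false)` the `vertical`-class edge at `(a,b)`. -/
abbrev SqE := ℤ × ℤ × Bool
/-- Edges of the triangular lattice (also indexing the dual hexagonal edges):
`(a, b, i)` with `i = 0` horizontal, `i = 1` the right edge of an upwards pointing
triangle, `i = 2` the left edge of an upwards pointing triangle, in row `b`. -/
abbrev TriE := ℤ × ℤ × Fin 3

/-- The unit square lattice, with vertex set `ℤ²`. -/
noncomputable def sqLattice : LatticeOn SqE :=
  ⟨fun e =>
    if e.2.2 then (((e.1 : ℝ), (e.2.1 : ℝ)), ((e.1 : ℝ) + 1, (e.2.1 : ℝ)))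
    else (((e.1 : ℝ), (e.2.1 : ℝ)), ((e.1 : ℝ), (e.2.1 : ℝ) + 1))⟩

/-- The dual of the unit square lattice (shifted by `(1/2, 1/2)`), with each dual edge
indexed by the primal edge it crosses. -/
noncomputable def sqDualLattice : LatticeOn SqE :=
  ⟨fun e =>
    if e.2.2 then
      (((e.1 : ℝ) + 1 / 2, (e.2.1 : ℝ) - 1 / 2), ((e.1 : ℝ) + 1 / 2, (e.2.1 : ℝ) + 1 / 2))
    else
      (((e.1 : ℝ) - 1 / 2, (e.2.1 : ℝ) + 1 / 2), ((e.1 : ℝ) + 1 / 2, (e.2.1 : ℝ) + 1 / 2))⟩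

/-- Vertices of the triangular lattice (equilateral triangles of side `√3`,
one family of edges horizontal). -/
noncomputable def tv (a b : ℤ) : Pt :=
  (Real.sqrt 3 * ((a : ℝ) + (b : ℝ) / 2), 3 / 2 * (b : ℝ))

/-- The triangular lattice. -/
noncomputable def triLattice : LatticeOn TriE :=
  ⟨fun e =>
    if e.2.2 = 0 then (tv e.1 e.2.1, tv (e.1 + 1) e.2.1)
    else if e.2.2 = 1 then (tv (e.1 + 1) e.2.1, tv e.1 (e.2.1 + 1))
    else (tv e.1 e.2.1, tv e.1 (e.2.1 + 1))⟩

/-- Circumcentre of the upwards pointing triangle with base vertex `tv a b`. -/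
noncomputable def hup (a b : ℤ) : Pt :=
  (Real.sqrt 3 * ((a : ℝ) + ((b : ℝ) + 1) / 2), 3 / 2 * (b : ℝ) + 1 / 2)

/-- Circumcentre of the downwards pointing triangle below the edge `tv a b – tv (a+1) b`. -/
noncomputable def hdown (a b : ℤ) : Pt :=
  (Real.sqrt 3 * ((a : ℝ) + ((b : ℝ) + 1) / 2), 3 / 2 * (b : ℝ) - 1 / 2)

/-- The hexagonal lattice, the planar dual of `triLattice`, with vertices at the
circumcentres of the triangles; each hexagonal edge is indexed by the triangular
edge it crosses. -/
noncomputable def hexLattice : LatticeOn TriE :=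
  ⟨fun e =>
    if e.2.2 = 0 then (hdown e.1 e.2.1, hup e.1 e.2.1)
    else if e.2.2 = 1 then (hup e.1 e.2.1, hdown e.1 (e.2.1 + 1))
    else (hup e.1 e.2.1, hdown (e.1 - 1) (e.2.1 + 1))⟩

/-- The square lattice with horizontal edges of length `√3` and vertical edges of
length `1` (as in the mixed lattices). -/
noncomputable def sqStretch : LatticeOn SqE :=
  ⟨fun e =>
    if e.2.2 then
      ((Real.sqrt 3 * (e.1 : ℝ), (e.2.1 : ℝ)), (Real.sqrt 3 * ((e.1 : ℝ) + 1), (e.2.1 : ℝ)))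
    else ((Real.sqrt 3 * (e.1 : ℝ), (e.2.1 : ℝ)), (Real.sqrt 3 * (e.1 : ℝ), (e.2.1 : ℝ) + 1))⟩

/-- Vertices of the square lattice rotated by `π/4`. -/
noncomputable def rv (a b : ℤ) : Pt :=
  (((a : ℝ) - (b : ℝ)) / Real.sqrt 2, ((a : ℝ) + (b : ℝ)) / Real.sqrt 2)

/-- The square lattice rotated by `π/4`: edges `(a,b,true)` are inclined at angle `π/4`
and edges `(a,b,false)` at angle `3π/4`; the row (height) of such an edge is `a + b`. -/
noncomputable def rsqLattice : LatticeOn SqE :=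
  ⟨fun e =>
    if e.2.2 then (rv e.1 e.2.1, rv (e.1 + 1) e.2.1)
    else (rv e.1 e.2.1, rv e.1 (e.2.1 + 1))⟩

/-- Inhomogeneous intensities on the square lattice: `ph` on horizontal edges,
`pv` on vertical ones. -/
def sqInt (ph pv : ℝ) : SqE → ℝ := fun e => if e.2.2 then ph else pv

/-- Inhomogeneous intensities on the triangular (or hexagonal) lattice:
`p0` on class-0 edges, `p1` on class-1, `p2` on class-2. -/
def triInt (p0 p1 p2 : ℝ) : TriE → ℝ := fun e => ![p0, p1, p2] e.2.2

/-- Highly inhomogeneous intensities on the triangular (or hexagonal) lattice: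
`p` on horizontal-class edges, `q n` on right edges of upwards pointing triangles at
height `n`, `q' n` on left edges of upwards pointing triangles at height `n`. -/
def triHI (p : ℝ) (q q' : ℤ → ℝ) : TriE → ℝ := fun e =>
  if e.2.2 = 0 then p else if e.2.2 = 1 then q e.2.1 else q' e.2.1

/-- Highly inhomogeneous intensities on the rotated square lattice: `q n` on edges
inclined at `π/4` at height `n`, `q' n` on edges inclined at `3π/4` at height `n`. -/
def rsqHI (q q' : ℤ → ℝ) : SqE → ℝ := fun e =>
  if e.2.2 then q (e.1 + e.2.1) else q' (e.1 + e.2.1)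

/-- The Bernoulli law on `Bool` with the parameter clipped to `[0,1]`. -/
noncomputable def bmeas (r : ℝ) : Measure Bool :=
  ENNReal.ofReal (max 0 (min r 1)) • Measure.dirac true +
    ENNReal.ofReal (1 - max 0 (min r 1)) • Measure.dirac false

instance (r : ℝ) : IsProbabilityMeasure (bmeas r) := by
  constructor
  have h0 : (0:ℝ) ≤ max 0 (min r 1) := le_max_left _ _
  have h1 : max 0 (min r 1) ≤ (1:ℝ) := max_le zero_le_one (min_le_right _ _)
  simp only [bmeas, Measure.coe_add, Measure.coe_smul, Pi.add_apply, Pi.smul_apply,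
    measure_univ, smul_eq_mul, mul_one]
  rw [← ENNReal.ofReal_add h0 (by linarith)]
  simp

lemma bmeas_apply_singleton {r : ℝ} (h : r ∈ Icc (0:ℝ) 1) (b : Bool) :
    bmeas r {b} = ENNReal.ofReal (if b then r else 1 - r) := by
  have : max 0 (min r 1) = r := by
    rw [min_eq_left h.2, max_eq_right h.1]
  cases b <;> simp [bmeas, this]

/-- The product Bernoulli measure with intensities `f`. -/
noncomputable def bern {E : Type} (f : E → ℝ) : Measure (Config E) :=
  Measure.infinitePi fun e => bmeas (f e)

instance {E : Type} (f : E → ℝ) : IsProbabilityMeasure (bern f) := by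
  unfold bern; infer_instance

/-- The event `A` is determined by the states of finitely many edges. -/
def FD {E : Type} (A : Set (Config E)) : Prop :=
  ∃ S : Finset E, ∀ ω ω' : Config E, (∀ e ∈ S, ω e = ω' e) → ω ∈ A → ω' ∈ A

lemma dep_eq {E : Type} {A : Set (Config E)} {S : Finset E}
    (h : ∀ ω ω' : Config E, (∀ e ∈ S, ω e = ω' e) → ω ∈ A → ω' ∈ A) :
    A = S.restrict ⁻¹' (S.restrict '' A) := by
  apply Subset.antisymm (subset_preimage_image _ _)
  rintro ω ⟨ω', h', he⟩
  refine h ω' ω (fun e hs => ?_) h'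
  exact congrFun he ⟨e, hs⟩

lemma FD.inter {E : Type} {A B : Set (Config E)} (hA : FD A) (hB : FD B) : FD (A ∩ B) := by
  classical
  obtain ⟨S, hS⟩ := hA
  obtain ⟨T, hT⟩ := hB
  exact ⟨S ∪ T, fun ω ω' h ⟨h1, h2⟩ => ⟨hS ω ω' (fun e he => h e (Finset.mem_union_left _ he)) h1,
    hT ω ω' (fun e he => h e (Finset.mem_union_right _ he)) h2⟩⟩

lemma FD.univ {E : Type} : FD (univ : Set (Config E)) := ⟨∅, fun _ _ _ _ => trivial⟩

lemma FD.edge {E : Type} (e : E) (b : Bool) : FD {ω : Config E | ω e = b} :=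
  ⟨{e}, fun ω ω' h h1 => by
    have := h e (by simp)
    simp only [mem_ofPred_eq] at *
    rw [← this, h1]⟩

lemma measurable_restr {E : Type} (S : Finset E) :
    Measurable (S.restrict : Config E → (S → Bool)) := by
  apply measurable_pi_lambda
  intro i
  exact measurable_pi_apply _

lemma FD.measurableSet {E : Type} {A : Set (Config E)} (hA : FD A) : MeasurableSet A := by
  obtain ⟨S, hS⟩ := hA
  rw [dep_eq hS]
  exact measurable_restr S (Set.toFinite _).measurableSet

lemma FD.preimage {E F : Type} {A : Set (Config F)} (hA : FD A) (Φ : Config E → Config F)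
    (hΦ : ∀ e, FD {ω | Φ ω e = true}) : FD (Φ ⁻¹' A) := by
  classical
  obtain ⟨S, hS⟩ := hA
  choose T hT using hΦ
  refine ⟨S.biUnion T, fun ω ω' h h1 => hS _ _ (fun e he => ?_) h1⟩
  have hh : ∀ x ∈ T e, ω x = ω' x := fun x hx => h x (Finset.mem_biUnion.2 ⟨e, he, hx⟩)
  have h2 := hT e ω ω' hh
  have h3 := hT e ω' ω (fun x hx => (hh x hx).symm)
  simp only [mem_ofPred_eq] at h2 h3
  exact Bool.eq_iff_iff.2 ⟨h2, h3⟩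

open scoped Classical in
lemma bern_real_eq_sum {E : Type} (f : E → ℝ) {A : Set (Config E)} {S : Finset E}
    (h : ∀ ω ω' : Config E, (∀ e ∈ S, ω e = ω' e) → ω ∈ A → ω' ∈ A) :
    (bern f).real A = ∑ x : S → Bool, (∏ e : S, (bmeas (f e)).real {x e}) *
      (S.restrict '' A).indicator 1 x := by
  classical
  have hm : (bern f).real A = ((bern f).map S.restrict).real (S.restrict '' A) := by
    rw [map_measureReal_apply (measurable_restr S) (Set.toFinite _).measurableSet, ← dep_eq h]
  rw [hm, bern, Measure.infinitePi_map_restrict]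
  have : (S.restrict '' A) = ((Finset.univ.filter fun x => x ∈ S.restrict '' A : Finset (S → Bool)) : Set _) := by
    ext; simp
  conv_lhs => rw [this]
  rw [← MeasureTheory.sum_measureReal_singleton]
  rw [Finset.sum_filter]
  refine Finset.sum_congr rfl fun x _ => ?_
  simp only [measureReal_def, Measure.pi_singleton, Set.indicator]
  split_ifs with h1
  · simp [ENNReal.toReal_prod]
  · simp

/-- Harris–FKG inequality for increasing events depending on finitely many edges. -/
lemma bern_fkg {E : Type} (f : E → ℝ) {A B : Set (Config E)} (hA : IsUpperSet A)
    (hB : IsUpperSet B) (fA : FD A) (fB : FD B) :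
    (bern f).real A * (bern f).real B ≤ (bern f).real (A ∩ B) := by
  classical
  obtain ⟨S0, hS⟩ := fA
  obtain ⟨T0, hT⟩ := fB
  set S := S0 ∪ T0 with hSdef
  have h1 : ∀ ω ω' : Config E, (∀ e ∈ S, ω e = ω' e) → ω ∈ A → ω' ∈ A :=
    fun ω ω' h => hS ω ω' (fun e he => h e (Finset.mem_union_left _ he))
  have h2 : ∀ ω ω' : Config E, (∀ e ∈ S, ω e = ω' e) → ω ∈ B → ω' ∈ B :=
    fun ω ω' h => hT ω ω' (fun e he => h e (Finset.mem_union_right _ he))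
  have h3 : ∀ ω ω' : Config E, (∀ e ∈ S, ω e = ω' e) → ω ∈ A ∩ B → ω' ∈ A ∩ B :=
    fun ω ω' h hh => ⟨h1 ω ω' h hh.1, h2 ω ω' h hh.2⟩
  have huniv : (bern f).real Set.univ = _ :=
    bern_real_eq_sum f (A := Set.univ) (S := S) (fun _ _ _ _ => trivial)
  have hup : ∀ C : Set (Config E), IsUpperSet C →
      (∀ ω ω' : Config E, (∀ e ∈ S, ω e = ω' e) → ω ∈ C → ω' ∈ C) →
      Monotone ((S.restrict '' C).indicator (1 : (S → Bool) → ℝ)) := by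
    intro C hC hC' x y hxy
    by_cases hx : x ∈ S.restrict '' C
    · have hy : y ∈ S.restrict '' C := by
        obtain ⟨ω, hω, rfl⟩ := hx
        refine ⟨fun e => if h : e ∈ S then y ⟨e, h⟩ else ω e, hC ?_ hω, ?_⟩
        · intro e
          by_cases h : e ∈ S
          · simp only [h, dif_pos]; exact hxy ⟨e, h⟩
          · simp [h]
        · ext ⟨e, he⟩; simp [he]
      simp [Set.indicator_of_mem hx, Set.indicator_of_mem hy]
    · rw [Set.indicator_of_notMem hx]
      exact Set.indicator_nonneg (fun _ _ => by simp) _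
  have key := fkg ((S.restrict '' A).indicator (1 : (S → Bool) → ℝ))
    ((S.restrict '' B).indicator (1 : (S → Bool) → ℝ))
    (fun x : S → Bool => ∏ e : S, (bmeas (f e)).real {x e})
    (fun x => Finset.prod_nonneg fun _ _ => measureReal_nonneg)
    (fun x => Set.indicator_nonneg (fun _ _ => by simp) _)
    (fun x => Set.indicator_nonneg (fun _ _ => by simp) _)
    (hup A hA h1) (hup B hB h2) (by
      intro a b
      rw [← Finset.prod_mul_distrib, ← Finset.prod_mul_distrib]
      apply le_of_eq
      refine Finset.prod_congr rfl fun e _ => ?_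
      simp only [Pi.inf_apply, Pi.sup_apply]
      cases a e <;> cases b e <;> simp [mul_comm])
  rw [bern_real_eq_sum f h1, bern_real_eq_sum f h2, bern_real_eq_sum f h3]
  have hone : (∑ x : S → Bool, ∏ e : S, (bmeas (f e)).real {x e}) = 1 := by
    rw [probReal_univ] at huniv
    rw [huniv]
    refine Finset.sum_congr rfl fun x _ => ?_
    rw [Set.indicator_of_mem]
    · simp
    · exact ⟨fun e => if h : e ∈ S then x ⟨e, h⟩ else false, trivial, by ext ⟨e, he⟩; simp [he]⟩
  rw [hone, one_mul] at key
  refine key.trans (le_of_eq (Finset.sum_congr rfl fun x _ => ?_))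
  congr 1
  have : S.restrict '' (A ∩ B) = (S.restrict '' A) ∩ (S.restrict '' B) := by
    apply Subset.antisymm (image_inter_subset _ _ _)
    rintro _ ⟨⟨ω, h, rfl⟩, ⟨ω', h', he⟩⟩
    refine ⟨ω, ⟨h, h2 ω' ω (fun e hh => ?_) h'⟩, rfl⟩
    exact congrFun he ⟨e, hh⟩
  rw [this, Set.inter_indicator_one]
  rfl

/-- Independence of events determined by disjoint finite edge sets. -/
lemma bern_indep {E : Type} (f : E → ℝ) {A B : Set (Config E)} {S T : Finset E}
    (hST : Disjoint S T)
    (hA : ∀ ω ω' : Config E, (∀ e ∈ S, ω e = ω' e) → ω ∈ A → ω' ∈ A)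
    (hB : ∀ ω ω' : Config E, (∀ e ∈ T, ω e = ω' e) → ω ∈ B → ω' ∈ B) :
    (bern f).real (A ∩ B) = (bern f).real A * (bern f).real B := by
  have hi : ProbabilityTheory.iIndepFun (fun (e : E) (ω : Config E) => ω e) (bern f) :=
    ProbabilityTheory.iIndepFun_infinitePi (X := fun _ x => x) (fun _ => measurable_id)
  have := hi.indepFun_finset S T hST (fun _ => measurable_pi_apply _)
  have := this.measure_inter_preimage_eq_mul (S.restrict '' A) (T.restrict '' B)
    (Set.toFinite _).measurableSet (Set.toFinite _).measurableSet
  change (bern f) (S.restrict ⁻¹' _ ∩ T.restrict ⁻¹' _) =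
    (bern f) (S.restrict ⁻¹' _) * (bern f) (T.restrict ⁻¹' _) at this
  rw [← dep_eq hA, ← dep_eq hB] at this
  rw [measureReal_def, this, ENNReal.toReal_mul]
  rfl

/-- Relabelling of edges. -/
lemma bern_map_inj {E F : Type} (f : E → ℝ) (σ : F → E) (hσ : Function.Injective σ) :
    (bern f).map (fun ω x => ω (σ x)) = bern (fun x => f (σ x)) :=
  Measure.map_infinitePi_infinitePi_of_inj (P := fun e => bmeas (f e)) hσ

lemma bmeas_map_not {r : ℝ} (h : r ∈ Icc (0:ℝ) 1) : (bmeas r).map (fun b => !b) = bmeas (1 - r) := by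
  have h1 : max 0 (min r 1) = r := by
    rw [min_eq_left h.2, max_eq_right h.1]
  have h2 : max 0 (min (1 - r) 1) = 1 - r := by
    rw [min_eq_left (by linarith [h.1]), max_eq_right (by linarith [h.2])]
  rw [bmeas, bmeas, h1, h2, Measure.map_add _ _ (measurable_of_finite _), Measure.map_smul,
    Measure.map_smul, Measure.map_dirac' (measurable_of_finite _),
    Measure.map_dirac' (measurable_of_finite _)]
  simp [add_comm]

/-- Flipping all edges. -/
lemma bern_map_not {E : Type} (f : E → ℝ) (hf : ∀ e, f e ∈ Icc (0:ℝ) 1) :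
    (bern f).map (fun ω e => !(ω e)) = bern (fun e => 1 - f e) := by
  unfold bern
  rw [Measure.infinitePi_map_pi _ (f := fun _ b => !b) (fun _ => measurable_of_finite _)]
  simp only [bmeas_map_not (hf _)]

lemma isBernoulliProduct_eq {E : Type} {f : E → ℝ} {P : Measure (Config E)}
    (hf : ∀ e, f e ∈ Icc (0:ℝ) 1) (hP : IsBernoulliProduct f P) : P = bern f := by
  classical
  have := hP.1
  have h1 : ∀ S : Finset E, P.map S.restrict = Measure.pi (fun e : S => bmeas (f e)) := by
    intro S
    apply Measure.ext_of_singleton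
    intro x
    rw [Measure.pi_singleton, Measure.map_apply (measurable_restr S) (Set.toFinite _).measurableSet]
    have := hP.2 S (fun e => if h : e ∈ S then x ⟨e, h⟩ else false)
    rw [← Finset.prod_coe_sort] at this
    convert this using 1
    · congr 1
      ext ω
      simp only [mem_preimage, mem_singleton_iff, mem_ofPred_eq]
      constructor
      · rintro rfl e he; simp [he]
      · intro h; ext ⟨e, he⟩; have := h e he; simp [he] at this; exact this
    · refine Finset.prod_congr rfl fun e _ => ?_
      rw [bmeas_apply_singleton (hf _)]
      simp
  exact (Measure.isProjectiveLimit_infinitePi (fun e => bmeas (f e))).unique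
    (fun S => h1 S) |>.symm

section cells
variable {K E : Type}

/-- Applying a local map in each cell. -/
def cellMap (c : K × Fin 3 ≃ E) (γ : K → (Fin 3 → Bool) → (Fin 3 → Bool)) (ω : Config E) :
    Config E :=
  fun e => γ (c.symm e).1 (fun i => ω (c ((c.symm e).1, i))) (c.symm e).2

lemma cellMap_law (c : K × Fin 3 ≃ E) (γ : K → (Fin 3 → Bool) → (Fin 3 → Bool)) (f : E → ℝ) :
    (bern f).map (cellMap c γ) =
      (Measure.infinitePi fun k => (Measure.pi fun i => bmeas (f (c (k, i)))).map (γ k)).map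
        (fun x e => x (c.symm e).1 (c.symm e).2) := by
  have h1 := bern_map_inj f c c.injective
  have h2 := Measure.infinitePi_map_curry (fun k i => bmeas (f (c (k, i))))
  have mg : ∀ k, Measurable (γ k) := fun k => measurable_of_finite _
  have h3 := Measure.infinitePi_map_pi
    (fun k => Measure.infinitePi fun i => bmeas (f (c (k, i)))) (f := γ) mg
  simp only [Measure.infinitePi_eq_pi] at h3 h2
  rw [← h3, ← h2]
  have h1' : (Measure.infinitePi fun p : K × Fin 3 => bmeas (f (c (p.1, p.2)))) =
    (bern f).map (fun ω x => ω (c x)) := by rw [h1]; rfl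
  rw [h1']
  have m1 : Measurable fun (x : K → Fin 3 → Bool) (e : E) => x (c.symm e).1 (c.symm e).2 :=
    measurable_pi_lambda _ fun e => (measurable_pi_apply _).comp (measurable_pi_apply _)
  have m2 : Measurable fun (x : K → Fin 3 → Bool) (k : K) => γ k (x k) :=
    measurable_pi_lambda _ fun k => (mg k).comp (measurable_pi_apply _)
  have m3 : Measurable fun (ω : E → Bool) (x : K × Fin 3) => ω (c x) :=
    measurable_pi_lambda _ fun k => (measurable_pi_apply _)
  rw [Measure.map_map (MeasurableEquiv.measurable _) m3,
    Measure.map_map m2 ((MeasurableEquiv.measurable _).comp m3),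
    Measure.map_map m1 (m2.comp ((MeasurableEquiv.measurable _).comp m3))]
  rfl

/-- Completion of a triangle: two open sides make the third one open. -/
def triC (x : Fin 3 → Bool) : Fin 3 → Bool := fun i => x i || (x (i + 1) && x (i + 2))
/-- Side `i` of the triangle is open when both other legs of the star are open. -/
def starC (y : Fin 3 → Bool) : Fin 3 → Bool := fun i => y (i + 1) && y (i + 2)

lemma sum_fin3_bool (F : (Fin 3 → Bool) → ℝ) : ∑ x, F x =
    ∑ a : Bool, ∑ b : Bool, ∑ d : Bool, F ![a, b, d] := by
  rw [← (Fin.consEquiv (fun _ : Fin 3 => Bool)).sum_comp, Fintype.sum_prod_type]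
  refine Finset.sum_congr rfl fun a _ => ?_
  rw [← (Fin.consEquiv (fun _ : Fin 2 => Bool)).sum_comp, Fintype.sum_prod_type]
  refine Finset.sum_congr rfl fun b _ => ?_
  rw [← (Fin.consEquiv (fun _ : Fin 1 => Bool)).sum_comp, Fintype.sum_prod_type]
  refine Finset.sum_congr rfl fun d _ => ?_
  rw [Fintype.sum_unique]
  congr 1

lemma pi3_map_real (r : Fin 3 → ℝ) (hr : ∀ i, r i ∈ Icc (0:ℝ) 1)
    (g : (Fin 3 → Bool) → (Fin 3 → Bool)) (y : Fin 3 → Bool) :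
    ((Measure.pi fun i => bmeas (r i)).map g).real {y} =
      ∑ x, if g x = y then ∏ i, (if x i then r i else 1 - r i) else 0 := by
  classical
  rw [map_measureReal_apply (measurable_of_finite _) (Set.toFinite _).measurableSet]
  have : g ⁻¹' {y} = ((Finset.univ.filter fun x => g x = y : Finset (Fin 3 → Bool)) : Set _) := by
    ext; simp
  rw [this, ← MeasureTheory.sum_measureReal_singleton, Finset.sum_filter]
  refine Finset.sum_congr rfl fun x _ => ?_
  split_ifs
  · rw [measureReal_def, Measure.pi_singleton, ENNReal.toReal_prod]
    refine Finset.prod_congr rfl fun i _ => ?_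
    rw [bmeas_apply_singleton (hr i), ENNReal.toReal_ofReal]
    have := hr i
    split_ifs
    · exact this.1
    · linarith [this.2]
  · rfl

lemma star_tri_local (r : Fin 3 → ℝ) (hr : ∀ i, r i ∈ Icc (0:ℝ) 1)
    (hk : kappaT (r 0) (r 1) (r 2) = 0) :
    (Measure.pi fun i => bmeas (r i)).map triC = (Measure.pi fun i => bmeas (1 - r i)).map starC := by
  have : IsProbabilityMeasure ((Measure.pi fun i => bmeas (r i)).map triC) :=
    Measure.isProbabilityMeasure_map (measurable_of_finite _).aemeasurable
  have : IsProbabilityMeasure ((Measure.pi fun i => bmeas (1 - r i)).map starC) :=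
    Measure.isProbabilityMeasure_map (measurable_of_finite _).aemeasurable
  apply Measure.ext_of_singleton
  intro y
  rw [← measureReal_eq_measureReal_iff]
  rw [pi3_map_real r hr, pi3_map_real (fun i => 1 - r i)
    (fun i => ⟨by linarith [(hr i).2], by linarith [(hr i).1]⟩)]
  rw [sum_fin3_bool, sum_fin3_bool]
  have hy : y = ![y 0, y 1, y 2] := by ext i; fin_cases i <;> rfl
  rw [hy]
  have e1 : ∀ a b d, triC ![a, b, d] = ![a || (b && d), b || (d && a), d || (a && b)] := by
    decide
  have e2 : ∀ a b d, starC ![a, b, d] = ![(b && d), (d && a), (a && b)] := by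
    decide
  simp only [e1, e2, Fin.prod_univ_three, Fintype.sum_bool]
  unfold kappaT at hk
  generalize r 0 = a at *
  generalize r 1 = b at *
  generalize r 2 = d at *
  cases y 0 <;> cases y 1 <;> cases y 2 <;> simp <;>
    first | ring1 | linear_combination hk | linear_combination -hk

open scoped Classical in
/-- Completion of the cells in `F`. -/
noncomputable def triMap (c : K × Fin 3 ≃ E) (F : Set K) : Config E → Config E :=
  cellMap c (fun k => if k ∈ F then triC else id)

open scoped Classical in
/-- Star-to-triangle map in the cells in `F`. -/
noncomputable def starMap (c : K × Fin 3 ≃ E) (F : Set K) : Config E → Config E :=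
  cellMap c (fun k => if k ∈ F then starC else id)

lemma triMap_mem (c : K × Fin 3 ≃ E) (F : Set K) (ω : Config E) {k : K} (hk : k ∈ F) (i : Fin 3) :
    triMap c F ω (c (k, i)) = (ω (c (k, i)) || (ω (c (k, i + 1)) && ω (c (k, i + 2)))) := by
  simp [triMap, cellMap, hk, triC]

lemma triMap_notMem (c : K × Fin 3 ≃ E) (F : Set K) (ω : Config E) {k : K} (hk : k ∉ F)
    (i : Fin 3) : triMap c F ω (c (k, i)) = ω (c (k, i)) := by
  simp [triMap, cellMap, hk]

lemma starMap_mem (c : K × Fin 3 ≃ E) (F : Set K) (ω : Config E) {k : K} (hk : k ∈ F) (i : Fin 3) :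
    starMap c F ω (c (k, i)) = (ω (c (k, i + 1)) && ω (c (k, i + 2))) := by
  simp [starMap, cellMap, hk, starC]

lemma starMap_notMem (c : K × Fin 3 ≃ E) (F : Set K) (ω : Config E) {k : K} (hk : k ∉ F)
    (i : Fin 3) : starMap c F ω (c (k, i)) = ω (c (k, i)) := by
  simp [starMap, cellMap, hk]

lemma cellMap_FD (c : K × Fin 3 ≃ E) (γ : K → (Fin 3 → Bool) → (Fin 3 → Bool)) (e : E) :
    FD {ω : Config E | cellMap c γ ω e = true} := by
  classical
  refine ⟨Finset.univ.image fun i => c ((c.symm e).1, i), fun ω ω' h h1 => ?_⟩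
  have : (fun i => ω (c ((c.symm e).1, i))) = fun i => ω' (c ((c.symm e).1, i)) := by
    ext i
    rw [h _ (Finset.mem_image_of_mem _ (Finset.mem_univ i))]
  simp only [mem_ofPred_eq, cellMap] at *
  rw [← this, h1]

lemma measurable_config {Ω : Type} [MeasurableSpace Ω] (Φ : Ω → Config E)
    (h : ∀ e, MeasurableSet {ω | Φ ω e = true}) : Measurable Φ := by
  apply measurable_pi_lambda
  intro e
  exact measurable_to_bool (h e)

/-- The star–triangle identity for product measures. -/
lemma star_tri_law (c : K × Fin 3 ≃ E) (F : Set K) (f g : E → ℝ)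
    (hF : ∀ k ∈ F, (∀ i, f (c (k, i)) ∈ Icc (0:ℝ) 1) ∧
      kappaT (f (c (k, 0))) (f (c (k, 1))) (f (c (k, 2))) = 0)
    (hg : ∀ k ∈ F, ∀ i, g (c (k, i)) = 1 - f (c (k, i)))
    (hn : ∀ k ∉ F, ∀ i, g (c (k, i)) = f (c (k, i))) :
    (bern f).map (triMap c F) = (bern g).map (starMap c F) := by
  rw [triMap, starMap, cellMap_law, cellMap_law]
  congr 2
  ext1 k
  by_cases hk : k ∈ F
  · simp only [hk, if_true, hg k hk]
    exact star_tri_local _ (hF k hk).1 (hF k hk).2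
  · simp only [hk, if_false, hn k hk]

lemma star_tri_real (c : K × Fin 3 ≃ E) (F : Set K) (f g : E → ℝ)
    (hF : ∀ k ∈ F, (∀ i, f (c (k, i)) ∈ Icc (0:ℝ) 1) ∧
      kappaT (f (c (k, 0))) (f (c (k, 1))) (f (c (k, 2))) = 0)
    (hg : ∀ k ∈ F, ∀ i, g (c (k, i)) = 1 - f (c (k, i)))
    (hn : ∀ k ∉ F, ∀ i, g (c (k, i)) = f (c (k, i))) {A : Set (Config E)} (hA : FD A) :
    (bern f).real (triMap c F ⁻¹' A) = (bern g).real (starMap c F ⁻¹' A) := by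
  have m1 : Measurable (triMap c F) :=
    measurable_config _ fun e => (cellMap_FD c _ e).measurableSet
  have m2 : Measurable (starMap c F) :=
    measurable_config _ fun e => (cellMap_FD c _ e).measurableSet
  rw [← map_measureReal_apply m1 hA.measurableSet, ← map_measureReal_apply m2 hA.measurableSet,
    star_tri_law c F f g hF hg hn]

lemma bern_real_inj {F : Type} (f : E → ℝ) (σ : F → E) (hσ : Function.Injective σ)
    {A : Set (Config F)} (hA : FD A) :
    (bern f).real ((fun ω x => ω (σ x)) ⁻¹' A) = (bern fun x => f (σ x)).real A := by
  rw [← bern_map_inj f σ hσ, map_measureReal_apply _ hA.measurableSet]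
  exact measurable_pi_lambda _ fun e => measurable_pi_apply _

lemma bern_real_not (f : E → ℝ) (hf : ∀ e, f e ∈ Icc (0:ℝ) 1) {A : Set (Config E)} (hA : FD A) :
    (bern f).real ((fun ω e => !(ω e)) ⁻¹' A) = (bern fun e => 1 - f e).real A := by
  rw [← bern_map_not f hf, map_measureReal_apply _ hA.measurableSet]
  exact measurable_pi_lambda _ fun e =>
    (measurable_of_finite (fun b : Bool => !b)).comp (measurable_pi_apply e)

end cells

/-- Index vertices of the triangular lattice. -/
abbrev Vx := ℤ × ℤ

/-- First endpoint of an edge of the triangular lattice. -/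
def src (e : TriE) : Vx := if e.2.2 = 1 then (e.1 + 1, e.2.1) else (e.1, e.2.1)
/-- Second endpoint of an edge of the triangular lattice. -/
def tgt (e : TriE) : Vx := if e.2.2 = 0 then (e.1 + 1, e.2.1) else (e.1, e.2.1 + 1)

/-- Adjacency through an open edge. -/
def Adj (ω : Config TriE) (u v : Vx) : Prop :=
  ∃ e, ω e = true ∧ ((src e = u ∧ tgt e = v) ∨ (src e = v ∧ tgt e = u))

lemma Adj.symm {ω : Config TriE} {u v : Vx} (h : Adj ω u v) : Adj ω v u := by
  obtain ⟨e, h1, h2⟩ := h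
  exact ⟨e, h1, h2.symm⟩

lemma Adj.mono {ω ω' : Config TriE} (h : ω ≤ ω') {u v : Vx} (ha : Adj ω u v) : Adj ω' u v := by
  obtain ⟨e, h1, h2⟩ := ha
  exact ⟨e, by have := h e; rw [h1] at this; revert this; cases ω' e <;> simp, h2⟩

lemma adj_e0 {ω : Config TriE} {a b : ℤ} (h : ω (a, b, 0) = true) : Adj ω (a, b) (a + 1, b) :=
  ⟨_, h, Or.inl ⟨by simp [src], by simp [tgt]⟩⟩
lemma adj_e1 {ω : Config TriE} {a b : ℤ} (h : ω (a, b, 1) = true) : Adj ω (a + 1, b) (a, b + 1) :=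
  ⟨_, h, Or.inl ⟨by simp [src], by simp [tgt]⟩⟩
lemma adj_e2 {ω : Config TriE} {a b : ℤ} (h : ω (a, b, 2) = true) : Adj ω (a, b) (a, b + 1) :=
  ⟨_, h, Or.inl ⟨by simp [src], by simp [tgt]⟩⟩

lemma adj_iff {ω : Config TriE} {a b : ℤ} {v : Vx} : Adj ω (a, b) v ↔
    (ω (a, b, 0) = true ∧ v = (a + 1, b)) ∨ (ω (a - 1, b, 0) = true ∧ v = (a - 1, b)) ∨
    (ω (a - 1, b, 1) = true ∧ v = (a - 1, b + 1)) ∨ (ω (a, b - 1, 1) = true ∧ v = (a + 1, b - 1)) ∨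
    (ω (a, b, 2) = true ∧ v = (a, b + 1)) ∨ (ω (a, b - 1, 2) = true ∧ v = (a, b - 1)) := by
  constructor
  · rintro ⟨⟨x, y, i⟩, h, h2⟩
    obtain ⟨c, d⟩ := v
    fin_cases i <;> simp [src, tgt] at h h2 ⊢ <;>
      rcases h2 with ⟨⟨h3, h4⟩, h5, h6⟩ | ⟨⟨h3, h4⟩, h5, h6⟩ <;> subst_vars <;> simp [h]
  · rintro (⟨h, rfl⟩ | ⟨h, rfl⟩ | ⟨h, rfl⟩ | ⟨h, rfl⟩ | ⟨h, rfl⟩ | ⟨h, rfl⟩)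
    · exact adj_e0 h
    · have := (adj_e0 h).symm; simpa using this
    · have := (adj_e1 h); simpa using this
    · have := (adj_e1 h).symm; simpa using this
    · exact adj_e2 h
    · have := (adj_e2 h).symm; simpa using this

lemma Adj.abs_fst {ω : Config TriE} {u v : Vx} (h : Adj ω u v) : |v.1 - u.1| ≤ 1 := by
  obtain ⟨a, b⟩ := u
  rcases adj_iff.1 h with (⟨h, rfl⟩ | ⟨h, rfl⟩ | ⟨h, rfl⟩ | ⟨h, rfl⟩ | ⟨h, rfl⟩ | ⟨h, rfl⟩) <;> simp

lemma Adj.abs_snd {ω : Config TriE} {u v : Vx} (h : Adj ω u v) : |v.2 - u.2| ≤ 1 := by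
  obtain ⟨a, b⟩ := u
  rcases adj_iff.1 h with (⟨h, rfl⟩ | ⟨h, rfl⟩ | ⟨h, rfl⟩ | ⟨h, rfl⟩ | ⟨h, rfl⟩ | ⟨h, rfl⟩) <;> simp

/-- Connection by an open path inside `R`. -/
def Conn (ω : Config TriE) (R : Set Vx) : Vx → Vx → Prop :=
  Relation.ReflTransGen fun x y => Adj ω x y ∧ x ∈ R ∧ y ∈ R

lemma Conn.refl {ω : Config TriE} {R : Set Vx} (u : Vx) : Conn ω R u u := Relation.ReflTransGen.refl
lemma Conn.trans {ω : Config TriE} {R : Set Vx} {u v w : Vx} (h : Conn ω R u v)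
    (h' : Conn ω R v w) : Conn ω R u w := Relation.ReflTransGen.trans h h'
lemma Conn.step {ω : Config TriE} {R : Set Vx} {u v : Vx} (h : Adj ω u v) (hu : u ∈ R)
    (hv : v ∈ R) : Conn ω R u v := Relation.ReflTransGen.single ⟨h, hu, hv⟩
lemma Conn.symm {ω : Config TriE} {R : Set Vx} {u v : Vx} (h : Conn ω R u v) : Conn ω R v u := by
  induction h with
  | refl => exact Conn.refl _
  | tail _ hs ih => exact (Conn.step hs.1.symm hs.2.2 hs.2.1).trans ih

/-- Connections are transported by maps sending steps to connections. -/
lemma Conn.map {ω ω' : Config TriE} {R R' : Set Vx} {u v : Vx} (φ : Vx → Vx)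
    (h : Conn ω R u v)
    (hφ : ∀ x y, x ∈ R → y ∈ R → Adj ω x y → Conn ω' R' (φ x) (φ y)) :
    Conn ω' R' (φ u) (φ v) := by
  induction h with
  | refl => exact Conn.refl _
  | tail _ hs ih => exact ih.trans (hφ _ _ hs.2.1 hs.2.2 hs.1)

lemma Conn.mono {ω ω' : Config TriE} {R R' : Set Vx} {u v : Vx} (h : Conn ω R u v)
    (hω : ω ≤ ω') (hR : R ⊆ R') : Conn ω' R' u v :=
  h.map id fun _ _ hx hy ha => Conn.step (ha.mono hω) (hR hx) (hR hy)

lemma Conn.monoR {ω : Config TriE} {R R' : Set Vx} {u v : Vx} (h : Conn ω R u v)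
    (hR : R ⊆ R') : Conn ω R' u v := h.mono le_rfl hR

lemma Conn.mem {ω : Config TriE} {R : Set Vx} {u v : Vx} (h : Conn ω R u v) (hu : u ∈ R) :
    v ∈ R := by
  cases h with
  | refl => exact hu
  | tail _ h => exact h.2.2

lemma Conn.congr {ω ω' : Config TriE} {R : Set Vx} {u v : Vx} (h : Conn ω R u v)
    (hω : ∀ e, src e ∈ R → tgt e ∈ R → ω e = ω' e) : Conn ω' R u v := by
  refine h.map id fun x y hx hy ha => ?_
  obtain ⟨e, h1, h2⟩ := ha
  refine Conn.step ⟨e, ?_, h2⟩ hx hy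
  rcases h2 with ⟨rfl, rfl⟩ | ⟨rfl, rfl⟩
  · rw [← hω e hx hy, h1]
  · rw [← hω e hy hx, h1]

/-- A one-sided clipping of a connection at level `x0` of `h`. -/
lemma Conn.clip_low {ω : Config TriE} {R : Set Vx} {u v : Vx} (hc : Conn ω R u v) (hu : u ∈ R)
    (h : Vx → ℤ) (hh : ∀ x y, Adj ω x y → |h y - h x| ≤ 1) {x0 : ℤ} (h0 : h u ≤ x0)
    (h1 : x0 ≤ h v) : ∃ u' ∈ R, h u' = x0 ∧ Conn ω (R ∩ {x | x0 ≤ h x}) u' v := by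
  induction hc with
  | refl => exact ⟨u, hu, by omega, Conn.refl _⟩
  | @tail b c hb hs ih =>
    by_cases hb' : x0 ≤ h b
    · obtain ⟨u', h2, h3, h4⟩ := ih hb'
      exact ⟨u', h2, h3, h4.trans (Conn.step hs.1 ⟨hs.2.1, hb'⟩ ⟨hs.2.2, h1⟩)⟩
    · have := hh _ _ hs.1
      rw [abs_le] at this
      exact ⟨c, hs.2.2, by omega, Conn.refl _⟩

/-- Clipping of a connection between levels `x0` and `x1` of `h`. -/
lemma Conn.clip {ω : Config TriE} {R : Set Vx} {u v : Vx} (hc : Conn ω R u v) (hu : u ∈ R)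
    (h : Vx → ℤ) (hh : ∀ x y, Adj ω x y → |h y - h x| ≤ 1) {x0 x1 : ℤ} (h01 : x0 ≤ x1)
    (h0 : h u ≤ x0) (h1 : x1 ≤ h v) : ∃ u' ∈ R, ∃ v' ∈ R, h u' = x0 ∧ h v' = x1 ∧
      Conn ω (R ∩ {x | x0 ≤ h x ∧ h x ≤ x1}) u' v' := by
  obtain ⟨u', hu', h2, h3⟩ := hc.clip_low hu h hh h0 (h01.trans h1)
  have hv' : v ∈ R ∩ {x | x0 ≤ h x} := h3.mem ⟨hu', h2.ge⟩
  obtain ⟨v', hv1, h4, h5⟩ := h3.symm.clip_low hv' (fun x => - h x)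
    (fun x y ha => by have := hh _ _ ha; rw [abs_le] at *; omega) (x0 := -x1) (by omega)
    (by omega)
  refine ⟨u', hu', v', hv1.1, h2, by omega, h5.symm.monoR ?_⟩
  rintro x ⟨⟨hx1, hx2⟩, hx3⟩
  simp only [mem_ofPred_eq] at hx2 hx3
  exact ⟨hx1, hx2, by omega⟩

/-- A lattice path of length `L`. -/
def IsPath (ω : Config TriE) (R : Set Vx) (γ : ℕ → Vx) (L : ℕ) : Prop :=
  ∀ i < L, Adj ω (γ i) (γ (i + 1)) ∧ γ i ∈ R ∧ γ (i + 1) ∈ R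

lemma Conn.exists_path {ω : Config TriE} {R : Set Vx} {u v : Vx} (h : Conn ω R u v) :
    ∃ (γ : ℕ → Vx) (L : ℕ), γ 0 = u ∧ γ L = v ∧ IsPath ω R γ L := by
  induction h with
  | refl => exact ⟨fun _ => u, 0, rfl, rfl, fun i hi => by omega⟩
  | @tail b c _ hs ih =>
    obtain ⟨γ, L, h0, h1, h2⟩ := ih
    refine ⟨fun i => if i ≤ L then γ i else c, L + 1, by simp [h0], by simp, fun i hi => ?_⟩
    by_cases hi' : i < L
    · simp only [hi'.le, if_true, Nat.succ_le_iff.2 hi']; exact h2 i hi'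
    · have : i = L := by omega
      subst this
      simp only [le_refl, if_true, h1, Nat.not_succ_le_self, if_false]
      exact hs

/-- A rectangle of vertices. -/
def Box (x0 x1 y0 y1 : ℤ) : Set Vx := {v | x0 ≤ v.1 ∧ v.1 ≤ x1 ∧ y0 ≤ v.2 ∧ v.2 ≤ y1}

lemma Box_finite (x0 x1 y0 y1 : ℤ) : (Box x0 x1 y0 y1).Finite := by
  refine ((Set.finite_Icc x0 x1).prod (Set.finite_Icc y0 y1)).subset ?_
  rintro ⟨a, b⟩ ⟨h1, h2, h3, h4⟩
  exact ⟨⟨h1, h2⟩, h3, h4⟩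

/-- The event that some pair in the relation `P` is connected in `R`. -/
def CE (R : Set Vx) (P : Vx → Vx → Prop) : Set (Config TriE) :=
  {ω | ∃ u v, P u v ∧ Conn ω R u v}

lemma CE_upper (R : Set Vx) (P : Vx → Vx → Prop) : IsUpperSet (CE R P) := by
  rintro ω ω' h ⟨u, v, hp, hc⟩
  exact ⟨u, v, hp, hc.mono h subset_rfl⟩

/-- The edges with both endpoints in `R`. -/
def edgesIn (R : Set Vx) : Set TriE := {e | src e ∈ R ∧ tgt e ∈ R}

lemma edgesIn_finite {R : Set Vx} (hR : R.Finite) : (edgesIn R).Finite := by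
  have : edgesIn R ⊆ (fun p : Vx × Fin 3 => ((if p.2 = 1 then p.1.1 - 1 else p.1.1, p.1.2, p.2) : TriE)) ''
      (R ×ˢ (Set.univ : Set (Fin 3))) := by
    rintro ⟨a, b, i⟩ ⟨h1, h2⟩
    refine ⟨((src (a, b, i)), i), ⟨h1, trivial⟩, ?_⟩
    fin_cases i <;> simp [src]
  exact ((hR.prod Set.finite_univ).image _).subset this

lemma CE_dep {R : Set Vx} (hR : R.Finite) (P : Vx → Vx → Prop) (ω ω' : Config TriE)
    (h : ∀ e ∈ (edgesIn_finite hR).toFinset, ω e = ω' e) (hc : ω ∈ CE R P) : ω' ∈ CE R P := by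
  obtain ⟨u, v, hp, hc⟩ := hc
  exact ⟨u, v, hp, hc.congr fun e h1 h2 => h e (by simpa using ⟨h1, h2⟩)⟩

lemma CE_FD {R : Set Vx} (hR : R.Finite) (P : Vx → Vx → Prop) : FD (CE R P) :=
  ⟨_, CE_dep hR P⟩

/-- Horizontal crossing of a rectangle. -/
def HC (x0 x1 y0 y1 : ℤ) : Set (Config TriE) :=
  CE (Box x0 x1 y0 y1) fun u v =>
    u ∈ Box x0 x1 y0 y1 ∧ v ∈ Box x0 x1 y0 y1 ∧ u.1 = x0 ∧ v.1 = x1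

/-- Vertical crossing of a rectangle. -/
def VC (x0 x1 y0 y1 : ℤ) : Set (Config TriE) :=
  CE (Box x0 x1 y0 y1) fun u v =>
    u ∈ Box x0 x1 y0 y1 ∧ v ∈ Box x0 x1 y0 y1 ∧ u.2 = y0 ∧ v.2 = y1

lemma HC_upper (x0 x1 y0 y1 : ℤ) : IsUpperSet (HC x0 x1 y0 y1) := CE_upper _ _
lemma VC_upper (x0 x1 y0 y1 : ℤ) : IsUpperSet (VC x0 x1 y0 y1) := CE_upper _ _
lemma HC_FD (x0 x1 y0 y1 : ℤ) : FD (HC x0 x1 y0 y1) := CE_FD (Box_finite _ _ _ _) _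
lemma VC_FD (x0 x1 y0 y1 : ℤ) : FD (VC x0 x1 y0 y1) := CE_FD (Box_finite _ _ _ _) _

/-- A connection reaching from one side to the other within a horizontal strip gives a
horizontal crossing. -/
lemma HC_of_conn {ω : Config TriE} {R : Set Vx} {u v : Vx} (hc : Conn ω R u v) (hu : u ∈ R)
    {x0 x1 y0 y1 : ℤ} (h01 : x0 ≤ x1) (h0 : u.1 ≤ x0) (h1 : x1 ≤ v.1)
    (hR : ∀ x ∈ R, y0 ≤ x.2 ∧ x.2 ≤ y1) : ω ∈ HC x0 x1 y0 y1 := by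
  obtain ⟨u', hu', v', hv', h2, h3, h4⟩ := hc.clip hu (fun x => x.1) (fun x y h => h.abs_fst) h01 h0 h1
  refine ⟨u', v', ⟨⟨h2.ge, by omega, hR _ hu'⟩, ⟨by omega, h3.le, hR _ hv'⟩, h2, h3⟩, h4.monoR ?_⟩
  rintro x ⟨hx, hx1, hx2⟩
  exact ⟨hx1, hx2, hR _ hx⟩

lemma VC_of_conn {ω : Config TriE} {R : Set Vx} {u v : Vx} (hc : Conn ω R u v) (hu : u ∈ R)
    {x0 x1 y0 y1 : ℤ} (h01 : y0 ≤ y1) (h0 : u.2 ≤ y0) (h1 : y1 ≤ v.2)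
    (hR : ∀ x ∈ R, x0 ≤ x.1 ∧ x.1 ≤ x1) : ω ∈ VC x0 x1 y0 y1 := by
  obtain ⟨u', hu', v', hv', h2, h3, h4⟩ := hc.clip hu (fun x => x.2) (fun x y h => h.abs_snd) h01 h0 h1
  refine ⟨u', v', ⟨⟨(hR _ hu').1, (hR _ hu').2, h2.ge, by omega⟩,
    ⟨(hR _ hv').1, (hR _ hv').2, by omega, h3.le⟩, h2, h3⟩, h4.monoR ?_⟩
  rintro x ⟨hx, hx1, hx2⟩
  exact ⟨(hR _ hx).1, (hR _ hx).2, hx1, hx2⟩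

lemma HC_mono {x0 x1 y0 y1 x0' x1' y0' y1' : ℤ} (h : x0' ≤ x1') (h1 : x0 ≤ x0') (h2 : x1' ≤ x1)
    (h3 : y0' ≤ y0) (h4 : y1 ≤ y1') : HC x0 x1 y0 y1 ⊆ HC x0' x1' y0' y1' := by
  rintro ω ⟨u, v, ⟨hu, hv, h5, h6⟩, hc⟩
  exact HC_of_conn hc hu h (by omega) (by omega) fun x hx => ⟨h3.trans hx.2.2.1, hx.2.2.2.trans h4⟩

lemma VC_mono {x0 x1 y0 y1 x0' x1' y0' y1' : ℤ} (h : y0' ≤ y1') (h1 : y0 ≤ y0') (h2 : y1' ≤ y1)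
    (h3 : x0' ≤ x0) (h4 : x1 ≤ x1') : VC x0 x1 y0 y1 ⊆ VC x0' x1' y0' y1' := by
  rintro ω ⟨u, v, ⟨hu, hv, h5, h6⟩, hc⟩
  exact VC_of_conn hc hu h (by omega) (by omega) fun x hx => ⟨h3.trans hx.1, hx.2.1.trans h4⟩

/-- Pullback of a configuration along a translation. -/
def trC (x y : ℤ) (ω : Config TriE) : Config TriE := fun e => ω (e.1 + x, e.2.1 + y, e.2.2)

lemma trC_trC (x y : ℤ) (ω : Config TriE) : trC (-x) (-y) (trC x y ω) = ω := by
  ext ⟨a, b, i⟩; simp [trC]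

lemma Adj.trC {ω : Config TriE} {x y : ℤ} {u v : Vx} (h : Adj ω u v) :
    Adj (trC x y ω) (u.1 - x, u.2 - y) (v.1 - x, v.2 - y) := by
  obtain ⟨⟨a, b, i⟩, h, h2⟩ := h
  refine ⟨(a - x, b - y, i), by simp [Perc.trC, h], ?_⟩
  rcases h2 with ⟨rfl, rfl⟩ | ⟨rfl, rfl⟩ <;> fin_cases i <;>
    simp [src, tgt] <;> omega

lemma Conn.trC {ω : Config TriE} {x y : ℤ} {R R' : Set Vx} {u v : Vx} (h : Conn ω R u v)
    (hR : ∀ z ∈ R, (z.1 - x, z.2 - y) ∈ R') :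
    Conn (trC x y ω) R' (u.1 - x, u.2 - y) (v.1 - x, v.2 - y) :=
  h.map (fun z => (z.1 - x, z.2 - y)) fun _ _ h1 h2 ha => Conn.step ha.trC (hR _ h1) (hR _ h2)

lemma trC_HC_aux {ω : Config TriE} {x y x0 x1 y0 y1 : ℤ} (h : ω ∈ HC x0 x1 y0 y1) :
    trC x y ω ∈ HC (x0 - x) (x1 - x) (y0 - y) (y1 - y) := by
  have hb : ∀ z ∈ Box x0 x1 y0 y1, (z.1 - x, z.2 - y) ∈ Box (x0 - x) (x1 - x) (y0 - y) (y1 - y) := by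
    rintro z ⟨h1, h2, h3, h4⟩; refine ⟨?_, ?_, ?_, ?_⟩ <;> simp <;> omega
  obtain ⟨u, v, ⟨hu, hv, h5, h6⟩, hc⟩ := h
  exact ⟨_, _, ⟨hb _ hu, hb _ hv, by simp [h5], by simp [h6]⟩, hc.trC hb⟩

lemma trC_VC_aux {ω : Config TriE} {x y x0 x1 y0 y1 : ℤ} (h : ω ∈ VC x0 x1 y0 y1) :
    trC x y ω ∈ VC (x0 - x) (x1 - x) (y0 - y) (y1 - y) := by
  have hb : ∀ z ∈ Box x0 x1 y0 y1, (z.1 - x, z.2 - y) ∈ Box (x0 - x) (x1 - x) (y0 - y) (y1 - y) := by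
    rintro z ⟨h1, h2, h3, h4⟩; refine ⟨?_, ?_, ?_, ?_⟩ <;> simp <;> omega
  obtain ⟨u, v, ⟨hu, hv, h5, h6⟩, hc⟩ := h
  exact ⟨_, _, ⟨hb _ hu, hb _ hv, by simp [h5], by simp [h6]⟩, hc.trC hb⟩

lemma trC_mem_HC {ω : Config TriE} {x y x0 x1 y0 y1 : ℤ} :
    trC x y ω ∈ HC x0 x1 y0 y1 ↔ ω ∈ HC (x0 + x) (x1 + x) (y0 + y) (y1 + y) := by
  constructor
  · intro h
    have := trC_HC_aux (x := -x) (y := -y) h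
    rwa [trC_trC, sub_neg_eq_add, sub_neg_eq_add, sub_neg_eq_add, sub_neg_eq_add] at this
  · intro h
    have := trC_HC_aux (x := x) (y := y) h
    simpa using this

lemma trC_mem_VC {ω : Config TriE} {x y x0 x1 y0 y1 : ℤ} :
    trC x y ω ∈ VC x0 x1 y0 y1 ↔ ω ∈ VC (x0 + x) (x1 + x) (y0 + y) (y1 + y) := by
  constructor
  · intro h
    have := trC_VC_aux (x := -x) (y := -y) h
    rwa [trC_trC, sub_neg_eq_add, sub_neg_eq_add, sub_neg_eq_add, sub_neg_eq_add] at this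
  · intro h
    have := trC_VC_aux (x := x) (y := y) h
    simpa using this

lemma bern_trC (f : TriE → ℝ) (x y : ℤ) {A : Set (Config TriE)} (hA : FD A) :
    (bern f).real (trC x y ⁻¹' A) = (bern fun e => f (e.1 + x, e.2.1 + y, e.2.2)).real A :=
  bern_real_inj f (fun e : TriE => ((e.1 + x, e.2.1 + y, e.2.2) : TriE)) (by
    rintro ⟨a, b, i⟩ ⟨a', b', i'⟩ h
    simpa using h) hA

/-- Pullback of a configuration along the transposition of coordinates. -/
def tpC (ω : Config TriE) : Config TriE := fun e => ω (e.2.1, e.1, 2 - e.2.2)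

lemma tpC_tpC (ω : Config TriE) : tpC (tpC ω) = ω := by
  ext ⟨a, b, i⟩; simp [tpC]

lemma Adj.tpC {ω : Config TriE} {u v : Vx} (h : Adj ω u v) :
    Adj (tpC ω) (u.2, u.1) (v.2, v.1) := by
  obtain ⟨⟨a, b, i⟩, h, h2⟩ := h
  refine ⟨(b, a, 2 - i), by simp [Perc.tpC, h], ?_⟩
  rcases h2 with ⟨rfl, rfl⟩ | ⟨rfl, rfl⟩ <;> fin_cases i <;>
    simp [src, tgt]

lemma Conn.tpC {ω : Config TriE} {R R' : Set Vx} {u v : Vx} (h : Conn ω R u v)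
    (hR : ∀ z ∈ R, (z.2, z.1) ∈ R') :
    Conn (tpC ω) R' (u.2, u.1) (v.2, v.1) :=
  h.map (fun z => (z.2, z.1)) fun _ _ h1 h2 ha => Conn.step ha.tpC (hR _ h1) (hR _ h2)

lemma tpC_mem_HC {ω : Config TriE} {x0 x1 y0 y1 : ℤ} :
    tpC ω ∈ HC x0 x1 y0 y1 ↔ ω ∈ VC y0 y1 x0 x1 := by
  constructor
  · rintro ⟨u, v, ⟨hu, hv, h5, h6⟩, hc⟩
    have hb : ∀ z ∈ Box x0 x1 y0 y1, (z.2, z.1) ∈ Box y0 y1 x0 x1 :=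
      fun z ⟨h1, h2, h3, h4⟩ => ⟨h3, h4, h1, h2⟩
    have := hc.tpC hb
    rw [tpC_tpC] at this
    exact ⟨_, _, ⟨hb _ hu, hb _ hv, h5, h6⟩, this⟩
  · rintro ⟨u, v, ⟨hu, hv, h5, h6⟩, hc⟩
    have hb : ∀ z ∈ Box y0 y1 x0 x1, (z.2, z.1) ∈ Box x0 x1 y0 y1 :=
      fun z ⟨h1, h2, h3, h4⟩ => ⟨h3, h4, h1, h2⟩
    exact ⟨_, _, ⟨hb _ hu, hb _ hv, h5, h6⟩, hc.tpC hb⟩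

lemma tpC_mem_VC {ω : Config TriE} {x0 x1 y0 y1 : ℤ} :
    tpC ω ∈ VC x0 x1 y0 y1 ↔ ω ∈ HC y0 y1 x0 x1 := by
  rw [← tpC_mem_HC, tpC_tpC]

lemma bern_tpC (f : TriE → ℝ) {A : Set (Config TriE)} (hA : FD A) :
    (bern f).real (tpC ⁻¹' A) = (bern fun e => f (e.2.1, e.1, 2 - e.2.2)).real A :=
  bern_real_inj f (fun e : TriE => ((e.2.1, e.1, 2 - e.2.2) : TriE)) (by
    rintro ⟨a, b, i⟩ ⟨a', b', i'⟩ h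
    simp only [Prod.mk.injEq, sub_right_inj] at h
    simp [h]) hA

/-- The dual configuration on downwards pointing triangles: two of them sharing an upwards
pointing neighbour are joined when the two edges to be crossed are closed. -/
def dualC (ω : Config TriE) : Config TriE := fun e =>
  if e.2.2 = 0 then !ω (e.1 + 1, e.2.1 - 1, 1) && !ω (e.1 + 1, e.2.1 - 1, 2)
  else if e.2.2 = 1 then !ω (e.1 + 1, e.2.1, 0) && !ω (e.1 + 1, e.2.1, 2)
  else !ω (e.1, e.2.1, 0) && !ω (e.1, e.2.1, 1)

/-- Signed crossing, by a step, of the ray going left from a downwards pointing triangle. -/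
def cr (a b : ℤ) (x y : Vx) : ℤ :=
  (if x.2 = b - 1 ∧ y.2 = b ∧ y.1 ≤ a then 1 else 0) -
    (if y.2 = b - 1 ∧ x.2 = b ∧ x.1 ≤ a then 1 else 0)

/-- Indicator of the half row to the left of `(a, b)`. -/
def hrow (a b : ℤ) (x : Vx) : ℤ := if x.2 = b ∧ x.1 ≤ a then 1 else 0

lemma cr_h {ω : Config TriE} {a b : ℤ} {x y : Vx} (h : Adj ω x y) (h1 : ω (a, b, 1) = false)
    (h2 : ω (a, b, 2) = false) : cr a (b + 1) x y = cr (a - 1) (b + 1) x y := by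
  obtain ⟨c, d⟩ := x
  have n1 : ∀ c d, ω (c, d, 1) = true → ¬ (c = a ∧ d = b) := by
    rintro c d h ⟨rfl, rfl⟩; simp [h] at h1
  have n2 : ∀ c d, ω (c, d, 2) = true → ¬ (c = a ∧ d = b) := by
    rintro c d h ⟨rfl, rfl⟩; simp [h] at h2
  rcases adj_iff.1 h with
    (⟨g, rfl⟩ | ⟨g, rfl⟩ | ⟨g, rfl⟩ | ⟨g, rfl⟩ | ⟨g, rfl⟩ | ⟨g, rfl⟩) <;>
    first
    | (have := n1 _ _ g; simp only [cr]; split_ifs <;> omega)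
    | (have := n2 _ _ g; simp only [cr]; split_ifs <;> omega)
    | (simp only [cr]; split_ifs <;> omega)

lemma cr_r {ω : Config TriE} {a b : ℤ} {x y : Vx} (h : Adj ω x y) (h0 : ω (a, b, 0) = false)
    (h1 : ω (a, b, 1) = false) :
    cr a b x y - cr a (b + 1) x y = hrow a b y - hrow a b x := by
  obtain ⟨c, d⟩ := x
  have n0 : ∀ c d, ω (c, d, 0) = true → ¬ (c = a ∧ d = b) := by
    rintro c d h ⟨rfl, rfl⟩; simp [h] at h0
  have n1 : ∀ c d, ω (c, d, 1) = true → ¬ (c = a ∧ d = b) := by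
    rintro c d h ⟨rfl, rfl⟩; simp [h] at h1
  rcases adj_iff.1 h with
    (⟨g, rfl⟩ | ⟨g, rfl⟩ | ⟨g, rfl⟩ | ⟨g, rfl⟩ | ⟨g, rfl⟩ | ⟨g, rfl⟩) <;>
    first
    | (have := n0 _ _ g; simp only [cr, hrow]; split_ifs <;> omega)
    | (have := n1 _ _ g; simp only [cr, hrow]; split_ifs <;> omega)
    | (simp only [cr, hrow]; split_ifs <;> omega)

lemma cr_l {ω : Config TriE} {a b : ℤ} {x y : Vx} (h : Adj ω x y) (h0 : ω (a, b, 0) = false)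
    (h2 : ω (a, b, 2) = false) :
    cr a b x y - cr (a - 1) (b + 1) x y = hrow a b y - hrow a b x := by
  obtain ⟨c, d⟩ := x
  have n0 : ∀ c d, ω (c, d, 0) = true → ¬ (c = a ∧ d = b) := by
    rintro c d h ⟨rfl, rfl⟩; simp [h] at h0
  have n2 : ∀ c d, ω (c, d, 2) = true → ¬ (c = a ∧ d = b) := by
    rintro c d h ⟨rfl, rfl⟩; simp [h] at h2
  rcases adj_iff.1 h with
    (⟨g, rfl⟩ | ⟨g, rfl⟩ | ⟨g, rfl⟩ | ⟨g, rfl⟩ | ⟨g, rfl⟩ | ⟨g, rfl⟩) <;>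
    first
    | (have := n0 _ _ g; simp only [cr, hrow]; split_ifs <;> omega)
    | (have := n2 _ _ g; simp only [cr, hrow]; split_ifs <;> omega)
    | (simp only [cr, hrow]; split_ifs <;> omega)

/-- Net crossing number of a path to the left of the downwards pointing triangle at `z`. -/
def Ncr (γ : ℕ → Vx) (L : ℕ) (z : Vx) : ℤ := ∑ i ∈ Finset.range L, cr z.1 z.2 (γ i) (γ (i + 1))

lemma Ncr_adj {ω : Config TriE} {R : Set Vx} {γ : ℕ → Vx} {L : ℕ} (hγ : IsPath ω R γ L)
    {s t : Vx} (hst : Adj (dualC ω) s t)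
    (hrow : ∀ b, (s.2 = b ∧ t.2 = b + 1) ∨ (t.2 = b ∧ s.2 = b + 1) → (γ 0).2 ≠ b ∧ (γ L).2 ≠ b) :
    Ncr γ L s = Ncr γ L t := by
  have hsum : ∀ a b, ∑ i ∈ Finset.range L, (Perc.hrow a b (γ (i + 1)) - Perc.hrow a b (γ i)) =
      Perc.hrow a b (γ L) - Perc.hrow a b (γ 0) := fun a b =>
    Finset.sum_range_sub (fun i => Perc.hrow a b (γ i)) L
  have hz : ∀ a b, (γ 0).2 ≠ b ∧ (γ L).2 ≠ b → Perc.hrow a b (γ L) - Perc.hrow a b (γ 0) = 0 := by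
    intro a b h; simp [Perc.hrow, h.1, h.2]
  obtain ⟨⟨a, b, i⟩, h, h2⟩ := hst
  fin_cases i
  · simp [dualC] at h
    have key : Ncr γ L (a + 1, b) = Ncr γ L (a, b) := by
      refine Finset.sum_congr rfl fun i hi => ?_
      have := cr_h (hγ i (Finset.mem_range.1 hi)).1 h.1 h.2
      simpa using this
    rcases h2 with ⟨rfl, rfl⟩ | ⟨rfl, rfl⟩ <;> simp [src, tgt, key]
  · simp [dualC] at h
    have key : (γ 0).2 ≠ b ∧ (γ L).2 ≠ b → Ncr γ L (a + 1, b) = Ncr γ L (a, b + 1) := by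
      intro hb
      rw [← sub_eq_zero, Ncr, Ncr, ← Finset.sum_sub_distrib, ← hz (a + 1) b hb, ← hsum]
      refine Finset.sum_congr rfl fun i hi => ?_
      have := cr_l (hγ i (Finset.mem_range.1 hi)).1 h.1 h.2
      simpa using this
    rcases h2 with ⟨rfl, rfl⟩ | ⟨rfl, rfl⟩ <;> simp only [src, tgt] at hrow ⊢
    · exact key (hrow b (by simp))
    · exact (key (hrow b (by simp))).symm
  · simp [dualC] at h
    have key : (γ 0).2 ≠ b ∧ (γ L).2 ≠ b → Ncr γ L (a, b) = Ncr γ L (a, b + 1) := by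
      intro hb
      rw [← sub_eq_zero, Ncr, Ncr, ← Finset.sum_sub_distrib, ← hz a b hb, ← hsum]
      refine Finset.sum_congr rfl fun i hi => ?_
      have := cr_r (hγ i (Finset.mem_range.1 hi)).1 h.1 h.2
      simpa using this
    rcases h2 with ⟨rfl, rfl⟩ | ⟨rfl, rfl⟩ <;> simp only [src, tgt] at hrow ⊢
    · exact key (hrow b (by simp))
    · exact (key (hrow b (by simp))).symm

lemma Ncr_conn {ω : Config TriE} {R R' : Set Vx} {γ : ℕ → Vx} {L : ℕ} (hγ : IsPath ω R γ L)
    {s t : Vx} (hst : Conn (dualC ω) R' s t)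
    (hrow : ∀ b, (∃ z ∈ R', z.2 = b) → (∃ z ∈ R', z.2 = b + 1) → (γ 0).2 ≠ b ∧ (γ L).2 ≠ b) :
    Ncr γ L s = Ncr γ L t := by
  induction hst with
  | refl => rfl
  | @tail x y _ hs ih =>
    rw [ih]
    refine Ncr_adj hγ hs.1 fun b hb => ?_
    rcases hb with ⟨h1, h2⟩ | ⟨h1, h2⟩
    · exact hrow b ⟨x, hs.2.1, h1⟩ ⟨y, hs.2.2, h2⟩
    · exact hrow b ⟨y, hs.2.2, h1⟩ ⟨x, hs.2.1, h2⟩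

lemma Ncr_eq_zero {ω : Config TriE} {R : Set Vx} {γ : ℕ → Vx} {L : ℕ} (hγ : IsPath ω R γ L)
    {s : Vx} (hs : ∀ z ∈ R, z.2 = s.2 → s.1 < z.1) : Ncr γ L s = 0 := by
  refine Finset.sum_eq_zero fun i hi => ?_
  obtain ⟨-, h1, h2⟩ := hγ i (Finset.mem_range.1 hi)
  have h1 := hs _ h1
  have h2 := hs _ h2
  simp only [cr]
  rw [if_neg (by rintro ⟨_, h, h'⟩; have := h2 h; omega),
    if_neg (by rintro ⟨_, h, h'⟩; have := h1 h; omega), sub_zero]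

lemma Ncr_eq_one {ω : Config TriE} {R : Set Vx} {γ : ℕ → Vx} {L : ℕ} (hγ : IsPath ω R γ L)
    {s : Vx} (hs : ∀ z ∈ R, z.2 = s.2 → z.1 ≤ s.1) (h0 : (γ 0).2 < s.2) (hL : s.2 ≤ (γ L).2) :
    Ncr γ L s = 1 := by
  have : Ncr γ L s = ∑ i ∈ Finset.range L, ((if s.2 ≤ (γ (i + 1)).2 then (1:ℤ) else 0) -
      (if s.2 ≤ (γ i).2 then (1:ℤ) else 0)) := by
    refine Finset.sum_congr rfl fun i hi => ?_
    obtain ⟨h, h1, h2⟩ := hγ i (Finset.mem_range.1 hi)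
    have h1 := hs _ h1
    have h2 := hs _ h2
    have h3 := h.abs_snd
    rw [abs_le] at h3
    simp only [cr]
    split_ifs <;> omega
  rw [this, Finset.sum_range_sub (fun i => if s.2 ≤ (γ i).2 then (1:ℤ) else 0), if_pos hL,
    if_neg (by omega), sub_zero]

/-- An open path going up and a dual path going across cannot coexist. -/
lemma no_dual_cross {ω : Config TriE} {R R' : Set Vx} {u v s t : Vx} {y0 y1 : ℤ}
    (h : Conn ω R u v) (hu : u.2 ≤ y0) (hv : y1 ≤ v.2)
    (hd : Conn (dualC ω) R' s t) (hs' : s ∈ R') (hR' : ∀ z ∈ R', y0 < z.2 ∧ z.2 ≤ y1)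
    (hs : ∀ z ∈ R, z.2 = s.2 → s.1 < z.1) (ht : ∀ z ∈ R, z.2 = t.2 → z.1 ≤ t.1) : False := by
  obtain ⟨γ, L, h0, hL, hγ⟩ := h.exists_path
  have ht' := hR' _ (hd.mem hs')
  have h1 := Ncr_eq_zero hγ hs
  have h2 := Ncr_eq_one hγ ht (by rw [h0]; omega) (by rw [hL]; omega)
  have h3 := Ncr_conn hγ hd (by
    rintro b ⟨z, hz, rfl⟩ ⟨z', hz', h'⟩
    have := hR' z hz
    have := hR' z' hz'
    rw [h0, hL]
    omega)
  omega

/-- The edges avoiding a set of vertices. -/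
noncomputable def avoidC (W : Set Vx) : Config TriE := by
  classical exact fun e => decide (src e ∉ W ∧ tgt e ∉ W)

lemma Adj.avoid {ω : Config TriE} {W : Set Vx} {u v : Vx} (h : Adj ω u v) (hu : u ∉ W)
    (hv : v ∉ W) : Adj (avoidC W) u v := by
  obtain ⟨e, h1, h2⟩ := h
  refine ⟨e, ?_, h2⟩
  rcases h2 with ⟨rfl, rfl⟩ | ⟨rfl, rfl⟩ <;> simp [avoidC, hu, hv]

lemma Adj.dual_avoid {ω : Config TriE} {W : Set Vx} {u v : Vx} (h : Adj ω u v) (hu : u ∈ W)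
    (hv : v ∈ W) : Adj (dualC (avoidC W)) u v := by
  obtain ⟨⟨a, b, i⟩, h1, h2⟩ := h
  refine ⟨(a, b, i), ?_, h2⟩
  fin_cases i <;> rcases h2 with ⟨rfl, rfl⟩ | ⟨rfl, rfl⟩ <;>
    simp [src, tgt] at hu hv <;> simp [dualC, avoidC, src, tgt, hu, hv]

/-- A vertical and a horizontal crossing of the same rectangle meet. -/
lemma cross_meet {ω ω' : Config TriE} {R R' : Set Vx} {u v s t : Vx} {x0 x1 y0 y1 : ℤ}
    (h : Conn ω R u v) (huR : u ∈ R) (hu : u.2 ≤ y0) (hv : y1 ≤ v.2)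
    (hR : ∀ z ∈ R, x0 ≤ z.1 ∧ z.1 ≤ x1)
    (h' : Conn ω' R' s t) (hsR : s ∈ R') (hs : s.1 ≤ x0) (ht : x1 ≤ t.1)
    (hR' : ∀ z ∈ R', y0 ≤ z.2 ∧ z.2 ≤ y1) :
    ∃ z ∈ R ∩ R', Conn ω R u z ∧ Conn ω' R' s z := by
  by_contra! hcon
  set W : Set Vx := {z | z ∈ R' ∧ Conn ω' R' s z} with hW
  set X : Set Vx := {z | z ∈ R ∧ Conn ω R u z} with hX
  have hXW : ∀ z ∈ X, z ∉ W := fun z hz hz' => hcon z ⟨hz.1, hz'.1⟩ hz.2 hz'.2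
  have hsW : s ∈ W := ⟨hsR, Conn.refl _⟩
  have huX : u ∈ X := ⟨huR, Conn.refl _⟩
  have c1 : Conn (avoidC W) X u v := by
    clear hv
    induction h with
    | refl => exact Conn.refl _
    | @tail x y hx hs ih =>
      have hxX : x ∈ X := ⟨hs.2.1, hx⟩
      have hyX : y ∈ X := ⟨hs.2.2, Conn.trans hx (Conn.step hs.1 hs.2.1 hs.2.2)⟩
      exact ih.trans (Conn.step (hs.1.avoid (hXW _ hxX) (hXW _ hyX)) hxX hyX)
  have c2 : Conn (dualC (avoidC W)) W s t := by
    clear ht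
    induction h' with
    | refl => exact Conn.refl _
    | @tail x y hx hs ih =>
      have hxX : x ∈ W := ⟨hs.2.1, hx⟩
      have hyX : y ∈ W := ⟨hs.2.2, Conn.trans hx (Conn.step hs.1 hs.2.1 hs.2.2)⟩
      exact ih.trans (Conn.step (hs.1.dual_avoid hxX hyX) hxX hyX)
  set u' : Vx := (u.1, min (u.2 - 1) (y0 - 1)) with hu'
  set X' : Set Vx := X ∪ {z | z.1 = u.1 ∧ z.2 < y0} with hX'
  have hdown : ∀ k : ℕ, Conn (avoidC W) X' (u.1, u.2 - k) u := by
    intro k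
    induction k with
    | zero => simpa using Conn.refl _
    | succ k ih =>
      refine Conn.trans (Conn.step ?_ (Or.inr ⟨rfl, by simp; omega⟩) ?_) ih
      · have hn : ∀ j : ℕ, (u.1, u.2 - (j:ℤ)) ∉ W := by
          intro j hj
          rcases Nat.eq_zero_or_pos j with rfl | hj0
          · simp at hj; exact hXW u huX hj
          · have := (hR' _ hj.1).1; simp at this; omega
        refine ⟨(u.1, u.2 - k - 1, 2), ?_, Or.inl ⟨by simp [src]; ring, by simp [tgt]⟩⟩
        have h1 := hn (k + 1)
        have h2 := hn k
        push_cast at h1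
        rw [← sub_sub] at h1
        simp [avoidC, src, tgt, h1, h2]
      · rcases Nat.eq_zero_or_pos k with rfl | hk
        · left; simpa using huX
        · right; exact ⟨rfl, by simp; omega⟩
  have c1' : Conn (avoidC W) X' (u.1, u.2 - (1:ℕ)) v := (hdown 1).trans (c1.monoR subset_union_left)
  refine no_dual_cross (y0 := y0 - 1) (y1 := y1) c1' (by simp; omega) hv c2 hsW
    (fun z hz => by have := hR' z hz.1; omega) ?_ ?_
  · rintro z (hz | hz) hzs
    · have h1 := (hR z hz.1).1
      by_contra hlt
      have : z = s := Prod.ext (by omega) hzs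
      exact hXW z hz (this ▸ hsW)
    · have := (hR' s hsR).1
      have := hz.2
      omega
  · rintro z (hz | hz) _
    · exact (hR z hz.1).2.trans ht
    · rw [hz.1]; exact (hR u huR).2.trans ht

lemma mem_Box {a b x0 x1 y0 y1 : ℤ} : ((a, b) : Vx) ∈ Box x0 x1 y0 y1 ↔
    x0 ≤ a ∧ a ≤ x1 ∧ y0 ≤ b ∧ b ≤ y1 := Iff.rfl

lemma zmod2_self (x : ZMod 2) : x + x = 0 := CharTwo.add_self_eq_zero x

lemma parity_sum (r x : ℤ → ℤ → ZMod 2) (m n : ℕ)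
    (h0 : ∀ a : ℕ, a ≤ m → r a 0 = 1) (hn : ∀ a : ℕ, a ≤ m → r a n = 0)
    (hU : ∀ a b : ℕ, a < m → b < n → (r a b + r (a + 1) b) * x a b +
      (r (a + 1) b + r a (b + 1)) * x a (b + 1) + (r a b + r a (b + 1)) * x (a - 1) (b + 1) = 0)
    (hx : ∀ b : ℕ, b < n → r 0 b ≠ r 0 (b + 1) → x (-1) (b + 1) = 1) :
    ∃ b : ℕ, b < n ∧ r m b ≠ r m (b + 1) ∧ x (m - 1) (b + 1) = 1 := by
  set T : ℕ → ZMod 2 := fun a => ∑ b ∈ Finset.range n,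
    (r a b + r a (b + 1)) * x ((a:ℤ) - 1) (b + 1) with hT
  have hT0 : T 0 = 1 := by
    have h1 : T 0 = ∑ b ∈ Finset.range n, (r 0 ((b + 1 : ℕ) : ℤ) - r 0 (b : ℕ)) := by
      refine Finset.sum_congr rfl fun b hb => ?_
      rcases eq_or_ne (r 0 b) (r 0 (b + 1)) with h | h
      · simp [h, zmod2_self]
      · have := hx b (Finset.mem_range.1 hb) h
        simp only [Nat.cast_zero, zero_sub, this, mul_one]
        rw [CharTwo.sub_eq_add, add_comm]; push_cast; rfl
    rw [h1, Finset.sum_range_sub (fun b : ℕ => r 0 b)]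
    have := h0 0 (Nat.zero_le _)
    have h2 := hn 0 (Nat.zero_le _)
    simp only [Nat.cast_zero] at this h2 ⊢
    rw [this, h2]; rfl
  have hTs : ∀ a : ℕ, a < m → T (a + 1) = T a := by
    intro a ha
    have hs : ∑ b ∈ Finset.range n, (r a b + r (a + 1) b) * x a b =
        ∑ b ∈ Finset.range n, (r a (b + 1) + r (a + 1) (b + 1)) * x a (b + 1) := by
      have h1 := Finset.sum_range_succ (fun b : ℕ => (r a b + r (a + 1) b) * x a b) n
      rw [Finset.sum_range_succ'] at h1
      have e1 := h0 a ha.le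
      have e2 := h0 (a + 1) ha
      have e3 := hn a ha.le
      have e4 := hn (a + 1) ha
      push_cast at e2 e4
      simp only [Nat.cast_zero, e1, e2, e3, e4, Nat.cast_add, Nat.cast_one, zmod2_self, zero_mul,
        add_zero] at h1
      exact h1.symm
    have h3 := Finset.sum_congr rfl fun b hb => hU a b ha (Finset.mem_range.1 hb)
    rw [Finset.sum_add_distrib, Finset.sum_add_distrib, hs, ← Finset.sum_add_distrib,
      Finset.sum_const_zero] at h3
    have h4 : T (a + 1) = ∑ b ∈ Finset.range n, ((r a (b + 1) + r (a + 1) (b + 1)) * x a (b + 1) +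
        (r (a + 1) b + r a (b + 1)) * x a (b + 1)) := by
      refine Finset.sum_congr rfl fun b _ => ?_
      push_cast
      rw [← add_mul, add_sub_cancel_right]
      congr 1
      have := zmod2_self (r a (b + 1))
      linear_combination -this
    rw [← h4] at h3
    have h5 : T (a + 1) + T a = 0 := h3
    exact CharTwo.add_eq_zero.1 h5
  have hTm : ∀ a : ℕ, a ≤ m → T a = 1 := by
    intro a
    induction a with
    | zero => exact fun _ => hT0
    | succ a ih => exact fun h => (hTs a h).trans (ih (by omega))
  have hm := hTm m le_rfl
  have hm' : ∑ b ∈ Finset.range n, (r m b + r m (b + 1)) * x ((m:ℤ) - 1) (b + 1) ≠ 0 := by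
    have : T m ≠ 0 := by rw [hm]; exact one_ne_zero
    exact this
  obtain ⟨b, hb, hne⟩ := Finset.exists_ne_zero_of_sum_ne_zero hm'
  refine ⟨b, Finset.mem_range.1 hb, fun h => hne (by rw [h, zmod2_self, zero_mul]), ?_⟩
  have hz : ∀ z : ZMod 2, z ≠ 0 → z = 1 := by decide
  exact hz _ (right_ne_zero_of_mul hne)

/-- If there is no vertical crossing, there is a dual path from left to right. -/
lemma exists_dual_path (ω : Config TriE) (m n : ℕ) (h : ω ∉ VC 0 m 0 n) :
    ∃ b b' : ℕ, b < n ∧ b' < n ∧ ω (0, b, 2) = false ∧ ω (m, b', 2) = false ∧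
      Conn (dualC ω) (Box (-1) (m - 1) 1 n) (-1, b + 1) (m - 1, b' + 1) := by
  classical
  set B := Box 0 (m:ℤ) 0 n with hB
  set X : Vx → Prop := fun v => v ∈ B ∧ ∃ u ∈ B, u.2 = 0 ∧ Conn ω B u v with hX
  have hXadj : ∀ u v, X u → v ∈ B → Adj ω u v → X v := by
    rintro u v ⟨hu, w, hw, hw0, hc⟩ hv ha
    exact ⟨hv, w, hw, hw0, hc.trans (Conn.step ha hu hv)⟩
  have hXiff : ∀ u v, u ∈ B → v ∈ B → Adj ω u v → (X u ↔ X v) := fun u v hu hv ha =>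
    ⟨fun h => hXadj _ _ h hv ha, fun h => hXadj _ _ h hu ha.symm⟩
  set r : ℤ → ℤ → ZMod 2 := fun a b => if X (a, b) then 1 else 0 with hr
  have hrne : ∀ {u v : Vx}, u ∈ B → v ∈ B → r u.1 u.2 ≠ r v.1 v.2 → ¬ Adj ω u v := by
    intro u v hu hv hne ha
    exact hne (by simp only [hr, hXiff u v hu hv ha])
  set D := Box (-1) ((m:ℤ) - 1) 1 n with hD
  set P : Vx → Prop := fun z => ∃ b0 : ℕ, b0 < n ∧ r 0 b0 ≠ r 0 (b0 + 1) ∧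
    Conn (dualC ω) D (-1, b0 + 1) z with hP
  set x : ℤ → ℤ → ZMod 2 := fun a b => if P (a, b) then 1 else 0 with hx
  have hxeq : ∀ {u v : Vx}, Adj (dualC ω) u v → u ∈ D → v ∈ D → x u.1 u.2 = x v.1 v.2 := by
    intro u v ha hu hv
    have : P u ↔ P v :=
      ⟨fun ⟨b0, h1, h2, h3⟩ => ⟨b0, h1, h2, h3.trans (Conn.step ha hu hv)⟩,
        fun ⟨b0, h1, h2, h3⟩ => ⟨b0, h1, h2, h3.trans (Conn.step ha.symm hv hu)⟩⟩
    simp only [hx, this]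
  have hcl : ∀ {e : TriE}, src e ∈ B → tgt e ∈ B →
      r (src e).1 (src e).2 ≠ r (tgt e).1 (tgt e).2 → ω e = false := by
    intro e h1 h2 h3
    by_contra h4
    exact hrne h1 h2 h3 ⟨e, by simpa using h4, Or.inl ⟨rfl, rfl⟩⟩
  have hr0 : ∀ a : ℕ, a ≤ m → r a 0 = 1 := by
    intro a ha
    have hm : ((a:ℤ), (0:ℤ)) ∈ B := ⟨by simp, by simpa using ha, by simp, by simp⟩
    have : X (a, 0) := ⟨hm, _, hm, rfl, Conn.refl _⟩
    simp [hr, this]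
  have hrn : ∀ a : ℕ, a ≤ m → r a n = 0 := by
    intro a ha
    have : ¬ X (a, n) := by
      rintro ⟨hm, u, hu, hu0, hc⟩
      exact h ⟨u, (a, n), ⟨hu, hm, hu0, rfl⟩, hc⟩
    simp [hr, this]
  have hz : ∀ z : ZMod 2, z = 0 ∨ z = 1 := by decide
  obtain ⟨b', hb', hne, hx1⟩ := parity_sum r x m n hr0 hrn (by
    intro a b ha hb
    have k0 : r a b ≠ r (a + 1) b → ω (a, b, 0) = false := fun h =>
      hcl (e := ((a:ℤ), (b:ℤ), 0)) ⟨by simp [src], by simp [src]; omega, by simp [src],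
        by simp [src]; omega⟩ ⟨by simp [tgt]; omega, by simp [tgt]; omega, by simp [tgt],
        by simp [tgt]; omega⟩ (by simpa [src, tgt] using h)
    have k1 : r (a + 1) b ≠ r a (b + 1) → ω (a, b, 1) = false := fun h =>
      hcl (e := ((a:ℤ), (b:ℤ), 1)) ⟨by simp [src]; omega, by simp [src]; omega, by simp [src],
        by simp [src]; omega⟩ ⟨by simp [tgt], by simp [tgt]; omega, by simp [tgt]; omega,
        by simp [tgt]; omega⟩ (by simpa [src, tgt] using h)
    have k2 : r a b ≠ r a (b + 1) → ω (a, b, 2) = false := fun h =>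
      hcl (e := ((a:ℤ), (b:ℤ), 2)) ⟨by simp [src], by simp [src]; omega, by simp [src],
        by simp [src]; omega⟩ ⟨by simp [tgt], by simp [tgt]; omega, by simp [tgt]; omega,
        by simp [tgt]; omega⟩ (by simpa [src, tgt] using h)
    have kb : r a b ≠ r (a + 1) b → 1 ≤ b := by
      intro h
      by_contra hb0
      obtain rfl : b = 0 := by omega
      have h1 := hr0 a ha.le
      have h2 := hr0 (a + 1) ha
      push_cast at h1 h2 h
      exact h (by rw [h1, h2])
    have m1 : ((a:ℤ) - 1, (b:ℤ) + 1) ∈ D := mem_Box.2 (by omega)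
    have m2 : ((a:ℤ), (b:ℤ) + 1) ∈ D := mem_Box.2 (by omega)
    have m3 : 1 ≤ b → ((a:ℤ), (b:ℤ)) ∈ D := fun h =>
      mem_Box.2 (by omega)
    have j01 : r a b ≠ r (a + 1) b → r (a + 1) b ≠ r a (b + 1) → x a b = x a (b + 1) := by
      intro h0 h1
      refine hxeq (u := (a, b)) (v := (a, b + 1)) ?_ (m3 (kb h0)) m2
      exact ⟨(a, b, 2), by simp [dualC, k0 h0, k1 h1], Or.inl ⟨by simp [src], by simp [tgt]⟩⟩
    have j02 : r a b ≠ r (a + 1) b → r a b ≠ r a (b + 1) → x a b = x (a - 1) (b + 1) := by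
      intro h0 h1
      refine hxeq (u := (a, b)) (v := (a - 1, b + 1)) ?_ (m3 (kb h0)) m1
      exact ⟨(a - 1, b, 1), by simp [dualC, k0 h0, k2 h1], Or.inl ⟨by simp [src], by simp [tgt]⟩⟩
    have j12 : r (a + 1) b ≠ r a (b + 1) → r a b ≠ r a (b + 1) →
        x (a - 1) (b + 1) = x a (b + 1) := by
      intro h0 h1
      refine hxeq (u := (a - 1, b + 1)) (v := (a, b + 1)) ?_ m1 m2
      exact ⟨(a - 1, b + 1, 0), by simp [dualC, k1 h0, k2 h1],
        Or.inl ⟨by simp [src], by simp [tgt]⟩⟩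
    generalize r a b = r0 at *
    generalize r (a + 1) b = r1 at *
    generalize r a (b + 1) = r2 at *
    generalize x a b = x0 at *
    generalize x a (b + 1) = x1 at *
    generalize x (a - 1) (b + 1) = x2 at *
    clear * - j01 j02 j12
    revert r0 r1 r2 x0 x1 x2
    decide) (by
    intro b hb hne
    have : P (-1, b + 1) := ⟨b, hb, hne, Conn.refl _⟩
    simp [hx, this])
  have hPz : P ((m:ℤ) - 1, (b':ℤ) + 1) := by
    by_contra hc
    simp [hx, hc] at hx1
  obtain ⟨b, hb, hbne, hc⟩ := hPz
  refine ⟨b, b', hb, hb', ?_, ?_, hc⟩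
  · exact hcl (e := (0, (b:ℤ), 2)) ⟨by simp [src], by simp [src], by simp [src], by simp [src]; omega⟩
      ⟨by simp [tgt], by simp [tgt], by simp [tgt]; omega, by simp [tgt]; omega⟩
      (by simpa [src, tgt] using hbne)
  · exact hcl (e := ((m:ℤ), (b':ℤ), 2)) ⟨by simp [src], by simp [src], by simp [src],
      by simp [src]; omega⟩ ⟨by simp [tgt], by simp [tgt], by simp [tgt]; omega,
      by simp [tgt]; omega⟩ (by simpa [src, tgt] using hne)

lemma dualC_HC_of_not_VC {ω : Config TriE} {m n : ℕ} (h : ω ∉ VC 0 m 0 n) :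
    dualC ω ∈ HC (-1) (m - 1) 1 n := by
  obtain ⟨b, b', hb, hb', -, -, hc⟩ := exists_dual_path ω m n h
  exact HC_of_conn hc (mem_Box.2 (by omega)) (by omega) le_rfl le_rfl
    fun z hz => ⟨hz.2.2.1, hz.2.2.2⟩

lemma dualC_trC (x y : ℤ) (ω : Config TriE) : dualC (trC x y ω) = trC x y (dualC ω) := by
  ext ⟨a, b, i⟩
  fin_cases i <;> simp [dualC, trC] <;> ring_nf

lemma dualC_HC_of_not_VC' {ω : Config TriE} {x0 x1 y0 y1 : ℤ} (hx : x0 ≤ x1) (hy : y0 ≤ y1)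
    (h : ω ∉ VC x0 x1 y0 y1) : dualC ω ∈ HC (x0 - 1) (x1 - 1) (y0 + 1) y1 := by
  obtain ⟨m, hm⟩ := Int.eq_ofNat_of_zero_le (sub_nonneg.2 hx)
  obtain ⟨n, hn⟩ := Int.eq_ofNat_of_zero_le (sub_nonneg.2 hy)
  have h1 : trC x0 y0 ω ∉ VC 0 m 0 n := by
    rw [trC_mem_VC]
    convert h using 3 <;> omega
  have h2 := dualC_HC_of_not_VC h1
  rw [dualC_trC, trC_mem_HC] at h2
  convert h2 using 1
  congr 1 <;> omega

lemma not_VC_of_dualC_HC {ω : Config TriE} {x0 x1 y0 y1 : ℤ}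
    (h : dualC ω ∈ HC (x0 - 1) x1 (y0 + 1) y1) : ω ∉ VC x0 x1 y0 y1 := by
  rintro ⟨u, v, ⟨hu, hv, h1, h2⟩, hc⟩
  obtain ⟨s, t, ⟨hs, ht, h3, h4⟩, hd⟩ := h
  exact no_dual_cross hc h1.le h2.ge hd hs (fun z hz => ⟨by have := hz.2.2.1; omega, hz.2.2.2⟩)
    (fun z hz _ => by have := hz.1; omega) (fun z hz _ => by have := hz.2.1; omega)

/-- The edges grouped by upwards pointing triangles. -/
def cU : (ℤ × ℤ) × Fin 3 ≃ TriE where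
  toFun k := (k.1.1, k.1.2, k.2)
  invFun e := ((e.1, e.2.1), e.2.2)
  left_inv _ := rfl
  right_inv _ := rfl

/-- The edges grouped by downwards pointing triangles. -/
def cD : (ℤ × ℤ) × Fin 3 ≃ TriE where
  toFun k := (if k.2 = 2 then k.1.1 else k.1.1 - 1, if k.2 = 0 then k.1.2 + 1 else k.1.2, k.2)
  invFun e := ((if e.2.2 = 2 then e.1 else e.1 + 1, if e.2.2 = 0 then e.2.1 - 1 else e.2.1), e.2.2)
  left_inv := by
    rintro ⟨⟨a, b⟩, i⟩
    fin_cases i <;> simp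
  right_inv := by
    rintro ⟨a, b, i⟩
    fin_cases i <;> simp

lemma dualC_eq (ω : Config TriE) :
    dualC ω = starMap cD univ (fun e => !(ω (cU (cD.symm e)))) := by
  ext ⟨a, b, i⟩
  obtain ⟨⟨k, j⟩, hk⟩ := cD.surjective (a, b, i)
  rw [← hk, starMap_mem _ _ _ (mem_univ _)]
  simp only [Equiv.symm_apply_apply]
  obtain ⟨k1, k2⟩ := k
  fin_cases j <;> simp [cD, cU, dualC, Bool.and_comm]

/-- The intensities of a highly inhomogeneous self-dual measure. -/
structure IsHI (p : ℝ) (q q' : ℤ → ℝ) : Prop where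
  hp : p ∈ Ioo (0:ℝ) 1
  hq : ∀ n, q n ∈ Icc (0:ℝ) 1
  hq' : ∀ n, q' n ∈ Icc (0:ℝ) 1
  hk : ∀ n, kappaT p (q n) (q' n) = 0

lemma IsHI.mem {p : ℝ} {q q' : ℤ → ℝ} (h : IsHI p q q') (e : TriE) : triHI p q q' e ∈ Icc (0:ℝ) 1 := by
  unfold triHI
  split_ifs
  · exact ⟨h.hp.1.le, h.hp.2.le⟩
  · exact h.hq _
  · exact h.hq' _

lemma dualC_FD (e : TriE) : FD {ω | dualC ω e = true} := by
  classical
  obtain ⟨a, b, i⟩ := e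
  refine ⟨{(a + 1, b - 1, 1), (a + 1, b - 1, 2), (a + 1, b, 0), (a + 1, b, 2), (a, b, 0),
    (a, b, 1)}, fun ω ω' h h1 => ?_⟩
  simp only [mem_ofPred_eq, dualC] at h1 ⊢
  rw [← h _ (by simp), ← h _ (by simp), ← h _ (by simp), ← h _ (by simp), ← h _ (by simp),
    ← h _ (by simp)]
  exact h1

lemma dual_law {p : ℝ} {q q' : ℤ → ℝ} (h : IsHI p q q') {A : Set (Config TriE)} (hA : FD A) :
    (bern (triHI p q q')).real (dualC ⁻¹' A) =
      (bern (triHI p q q')).real (triMap cD univ ⁻¹' A) := by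
  have hinv : ∀ e, triHI p q q' (cU (cD.symm e)) = triHI p q q' e := by
    rintro ⟨a, b, i⟩
    fin_cases i <;> simp [cU, cD, triHI]
  rw [star_tri_real cD univ (triHI p q q') (fun e => 1 - triHI p q q' e) ?_ (fun _ _ _ => rfl)
    (fun k hk => absurd (mem_univ k) hk) hA]
  · have h1 : dualC ⁻¹' A = (fun ω (e : TriE) => ω (cU (cD.symm e))) ⁻¹'
        ((fun ω e => !(ω e)) ⁻¹' (starMap cD univ ⁻¹' A)) := by
      ext ω
      simp only [mem_preimage, dualC_eq]
    have hs : FD (starMap cD univ ⁻¹' A) := hA.preimage _ (cellMap_FD _ _)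
    have hns : FD ((fun ω e => !(ω e)) ⁻¹' (starMap cD univ ⁻¹' A)) := by
      refine hs.preimage _ fun e => ?_
      have := FD.edge e false
      simpa using this
    rw [h1, bern_real_inj _ (fun e => cU (cD.symm e)) ((cD.symm.trans cU).injective) hns,
      funext hinv]
    exact bern_real_not _ h.mem hs
  · rintro ⟨a, b⟩ _
    refine ⟨fun i => h.mem _, ?_⟩
    simpa [cD, triHI] using h.hk b

lemma le_triMap (c : (ℤ × ℤ) × Fin 3 ≃ TriE) (F : Set (ℤ × ℤ)) (ω : Config TriE) :
    ω ≤ triMap c F ω := by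
  intro e
  obtain ⟨⟨k, j⟩, rfl⟩ := c.surjective e
  by_cases hk : k ∈ F
  · rw [triMap_mem _ _ _ hk]
    cases ω (c (k, j)) <;> simp
  · rw [triMap_notMem _ _ _ hk]

lemma triMap_true (c : (ℤ × ℤ) × Fin 3 ≃ TriE) (F : Set (ℤ × ℤ)) (ω : Config TriE) {k : ℤ × ℤ}
    {i : Fin 3} (h : triMap c F ω (c (k, i)) = true) :
    ω (c (k, i)) = true ∨ k ∈ F ∧ ω (c (k, i + 1)) = true ∧ ω (c (k, i + 2)) = true := by
  by_cases hk : k ∈ F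
  · rw [triMap_mem _ _ _ hk] at h
    simpa [hk] using h
  · rw [triMap_notMem _ _ _ hk] at h
    exact Or.inl h

lemma triMap_cD_zero {F : Set (ℤ × ℤ)} {ω : Config TriE} {a b : ℤ}
    (h : triMap cD F ω (a, b, 0) = true) : ω (a, b, 0) = true ∨
      (a + 1, b - 1) ∈ F ∧ ω (a, b - 1, 1) = true ∧ ω (a + 1, b - 1, 2) = true := by
  have := triMap_true cD F ω (k := (a + 1, b - 1)) (i := 0) (by simpa [cD] using h)
  simpa [cD] using this

lemma triMap_cD_one {F : Set (ℤ × ℤ)} {ω : Config TriE} {a b : ℤ}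
    (h : triMap cD F ω (a, b, 1) = true) : ω (a, b, 1) = true ∨
      (a + 1, b) ∈ F ∧ ω (a + 1, b, 2) = true ∧ ω (a, b + 1, 0) = true := by
  have := triMap_true cD F ω (k := (a + 1, b)) (i := 1) (by simpa [cD] using h)
  simpa [cD] using this

lemma triMap_cD_two {F : Set (ℤ × ℤ)} {ω : Config TriE} {a b : ℤ}
    (h : triMap cD F ω (a, b, 2) = true) : ω (a, b, 2) = true ∨
      (a, b) ∈ F ∧ ω (a - 1, b + 1, 0) = true ∧ ω (a - 1, b, 1) = true := by
  have := triMap_true cD F ω (k := (a, b)) (i := 2) (by simpa [cD] using h)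
  simpa [cD] using this

/-- An edge of the completion along downwards pointing triangles is realised by at most two edges
of this triangle. -/
lemma triMap_cD_conn {ω : Config TriE} {F : Set (ℤ × ℤ)} {u v : Vx} {R R' : Set Vx} (hRR : R ⊆ R')
    (h : Adj (triMap cD F ω) u v) (hu : u ∈ R) (hv : v ∈ R)
    (h0 : ∀ a b, (a + 1, b - 1) ∈ F → ω (a, b - 1, 1) = true → (a, b) ∈ R → (a + 1, b) ∈ R →
      (a + 1, b - 1) ∈ R')
    (h1 : ∀ a b, (a + 1, b) ∈ F → (a + 1, b) ∈ R → (a, b + 1) ∈ R → (a + 1, b + 1) ∈ R')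
    (h2 : ∀ a b, (a, b) ∈ F → ω (a - 1, b, 1) = true → (a, b) ∈ R → (a, b + 1) ∈ R →
      (a - 1, b + 1) ∈ R') :
    Conn ω R' u v := by
  have key : ∀ e, triMap cD F ω e = true → src e ∈ R → tgt e ∈ R →
      Conn ω R' (src e) (tgt e) := by
    rintro ⟨a, b, i⟩ he hs ht
    fin_cases i
    · rcases triMap_cD_zero he with he | ⟨hF, he1, he2⟩
      · exact Conn.step ⟨_, he, Or.inl ⟨rfl, rfl⟩⟩ (hRR hs) (hRR ht)
      · simp [src, tgt] at hs ht ⊢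
        have hm := h0 a b hF he1 hs ht
        refine (Conn.step ⟨_, he1, Or.inr ⟨?_, ?_⟩⟩ (hRR hs) hm).trans
          (Conn.step ⟨_, he2, Or.inl ⟨?_, ?_⟩⟩ hm (hRR ht)) <;> simp [src, tgt]
    · rcases triMap_cD_one he with he | ⟨hF, he1, he2⟩
      · exact Conn.step ⟨_, he, Or.inl ⟨rfl, rfl⟩⟩ (hRR hs) (hRR ht)
      · simp [src, tgt] at hs ht ⊢
        have hm := h1 a b hF hs ht
        refine (Conn.step ⟨_, he1, Or.inl ⟨?_, ?_⟩⟩ (hRR hs) hm).trans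
          (Conn.step ⟨_, he2, Or.inr ⟨?_, ?_⟩⟩ hm (hRR ht)) <;> simp [src, tgt]
    · rcases triMap_cD_two he with he | ⟨hF, he1, he2⟩
      · exact Conn.step ⟨_, he, Or.inl ⟨rfl, rfl⟩⟩ (hRR hs) (hRR ht)
      · simp [src, tgt] at hs ht ⊢
        have hm := h2 a b hF he2 hs ht
        refine (Conn.step ⟨_, he2, Or.inl ⟨?_, ?_⟩⟩ (hRR hs) hm).trans
          (Conn.step ⟨_, he1, Or.inl ⟨?_, ?_⟩⟩ hm (hRR ht)) <;> simp [src, tgt]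
  obtain ⟨e, he, ⟨rfl, rfl⟩ | ⟨rfl, rfl⟩⟩ := h
  · exact key e he hu hv
  · exact (key e he hv hu).symm

lemma HC_of_triMap {ω : Config TriE} {x0 x1 y0 y1 : ℤ}
    (h : triMap cD univ ω ∈ HC x0 x1 y0 y1) : ω ∈ HC x0 x1 (y0 - 1) y1 := by
  obtain ⟨u, v, ⟨hu, hv, h1, h2⟩, hc⟩ := h
  have hx := hu.2.1
  have hc' : Conn ω {z | y0 - 1 ≤ z.2 ∧ z.2 ≤ y1} u v := by
    refine hc.map id fun x y hx hy ha => ?_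
    refine triMap_cD_conn (fun z hz => ⟨by have := hz.2.2.1; omega, hz.2.2.2⟩) ha hx hy ?_ ?_ ?_
    · intro a b _ _ h _
      rw [mem_Box] at h
      exact ⟨by simp; omega, by simp; omega⟩
    · intro a b _ _ h
      rw [mem_Box] at h
      exact ⟨by simp; omega, by simp; omega⟩
    · intro a b _ _ _ h
      rw [mem_Box] at h
      exact ⟨by simp; omega, by simp; omega⟩
  exact HC_of_conn hc' ⟨by have := hu.2.2.1; omega, hu.2.2.2⟩ (by omega) h1.le h2.ge fun z hz => hz

lemma HC_of_triMap_nodiag {ω : Config TriE} (hω : ∀ a b, ω (a, b, 1) = false) {x0 x1 y0 y1 : ℤ}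
    (h : triMap cD univ ω ∈ HC x0 x1 y0 y1) : ω ∈ HC x0 x1 y0 y1 := by
  obtain ⟨u, v, huv, hc⟩ := h
  refine ⟨u, v, huv, hc.map id fun x y hx hy ha => triMap_cD_conn subset_rfl ha hx hy ?_ ?_ ?_⟩
  · intro a b _ h; simp [hω] at h
  · intro a b _ h h'; rw [mem_Box] at *; omega
  · intro a b _ h; simp [hω] at h

lemma bern_ae_zero (f : TriE → ℝ) : ∀ᵐ ω ∂bern f, ∀ e, f e = 0 → ω e = false := by
  rw [ae_all_iff]
  intro e
  by_cases he : f e = 0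
  · have h1 : (bern f).map (fun ω => ω e) = bmeas (f e) :=
      Measure.infinitePi_map_eval (fun e => bmeas (f e)) e
    have h2 : (bern f) ((fun ω : Config TriE => ω e) ⁻¹' {true}) = 0 := by
      rw [← Measure.map_apply (measurable_pi_apply e) (Set.toFinite _).measurableSet, h1,
        bmeas_apply_singleton (by simp [he])]
      simp [he]
    rw [ae_iff]
    convert h2 using 2
    ext ω
    simp [he]
  · exact Filter.Eventually.of_forall fun ω h => absurd h he

/-- Either there is a vertical crossing or, in the dual, a horizontal one. -/
lemma VC_add_HC_ge {p : ℝ} {q q' : ℤ → ℝ} (h : IsHI p q q') {x0 x1 y0 y1 : ℤ} (hx : x0 ≤ x1)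
    (hy : y0 ≤ y1) : 1 ≤ (bern (triHI p q q')).real (VC x0 x1 y0 y1) +
      (bern (triHI p q q')).real (HC (x0 - 1) (x1 - 1) y0 y1) := by
  have h1 : (bern (triHI p q q')).real (VC x0 x1 y0 y1)ᶜ ≤
      (bern (triHI p q q')).real (dualC ⁻¹' (HC (x0 - 1) (x1 - 1) (y0 + 1) y1)) :=
    measureReal_mono fun ω hω => dualC_HC_of_not_VC' hx hy hω
  rw [dual_law h (HC_FD _ _ _ _), measureReal_compl (VC_FD _ _ _ _).measurableSet] at h1
  have h2 : (bern (triHI p q q')).real (triMap cD univ ⁻¹' (HC (x0 - 1) (x1 - 1) (y0 + 1) y1)) ≤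
      (bern (triHI p q q')).real (HC (x0 - 1) (x1 - 1) y0 y1) :=
    measureReal_mono fun ω hω => by simpa using HC_of_triMap hω
  rw [probReal_univ] at h1
  linarith

lemma VC_add_HC_ge_nodiag {p : ℝ} {q q' : ℤ → ℝ} (h : IsHI p q q') (hq0 : ∀ n, q n = 0)
    {x0 x1 y0 y1 : ℤ} (hx : x0 ≤ x1)
    (hy : y0 ≤ y1) : 1 ≤ (bern (triHI p q q')).real (VC x0 x1 y0 y1) +
      (bern (triHI p q q')).real (HC (x0 - 1) (x1 - 1) (y0 + 1) y1) := by
  have h1 : (bern (triHI p q q')).real (VC x0 x1 y0 y1)ᶜ ≤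
      (bern (triHI p q q')).real (dualC ⁻¹' (HC (x0 - 1) (x1 - 1) (y0 + 1) y1)) :=
    measureReal_mono fun ω hω => dualC_HC_of_not_VC' hx hy hω
  rw [dual_law h (HC_FD _ _ _ _), measureReal_compl (VC_FD _ _ _ _).measurableSet] at h1
  have h2 : (bern (triHI p q q')).real (triMap cD univ ⁻¹' (HC (x0 - 1) (x1 - 1) (y0 + 1) y1)) ≤
      (bern (triHI p q q')).real (HC (x0 - 1) (x1 - 1) (y0 + 1) y1) := by
    refine ENNReal.toReal_mono (measure_ne_top _ _) (measure_mono_ae ?_)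
    filter_upwards [bern_ae_zero (triHI p q q')] with ω hω hω'
    exact HC_of_triMap_nodiag (fun a b => hω (a, b, 1) (by simp [triHI, hq0])) hω'
  rw [probReal_univ] at h1
  linarith

lemma VC_add_HC_le {p : ℝ} {q q' : ℤ → ℝ} (h : IsHI p q q') (x0 x1 y0 y1 : ℤ) :
    (bern (triHI p q q')).real (VC x0 x1 y0 y1) +
      (bern (triHI p q q')).real (HC (x0 - 1) x1 (y0 + 1) y1) ≤ 1 := by
  have h1 : (bern (triHI p q q')).real (dualC ⁻¹' (HC (x0 - 1) x1 (y0 + 1) y1)) ≤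
      (bern (triHI p q q')).real (VC x0 x1 y0 y1)ᶜ :=
    measureReal_mono fun ω hω => not_VC_of_dualC_HC hω
  rw [dual_law h (HC_FD _ _ _ _), measureReal_compl (VC_FD _ _ _ _).measurableSet] at h1
  have h2 : (bern (triHI p q q')).real (HC (x0 - 1) x1 (y0 + 1) y1) ≤
      (bern (triHI p q q')).real (triMap cD univ ⁻¹' (HC (x0 - 1) x1 (y0 + 1) y1)) :=
    measureReal_mono fun ω hω => HC_upper _ _ _ _ (le_triMap _ _ _) hω
  rw [probReal_univ] at h1
  linarith

section

/-- The intensities with horizontal parameter `p` and row parameters `ρ`. -/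
noncomputable def rowInt (p : ℝ) (ρ : ℤ → ℝ × ℝ) : TriE → ℝ :=
  triHI p (fun n => (ρ n).1) (fun n => (ρ n).2)

/-- The percolation measure with horizontal parameter `p` and row parameters `ρ`. -/
noncomputable abbrev rowM (p : ℝ) (ρ : ℤ → ℝ × ℝ) : Measure (Config TriE) := bern (rowInt p ρ)

/-- The parameters of a row of the square lattice. -/
def sqRow (p : ℝ) : ℝ × ℝ := (0, 1 - p)

/-- The row parameters `ρ` are self-dual with respect to `p`. -/
def RowOK (p : ℝ) (ρ : ℤ → ℝ × ℝ) : Prop := IsHI p (fun n => (ρ n).1) (fun n => (ρ n).2)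

@[simp] lemma rowInt_zero (p : ℝ) (ρ : ℤ → ℝ × ℝ) (a b : ℤ) : rowInt p ρ (a, b, 0) = p := by
  simp [rowInt, triHI]
@[simp] lemma rowInt_one (p : ℝ) (ρ : ℤ → ℝ × ℝ) (a b : ℤ) : rowInt p ρ (a, b, 1) = (ρ b).1 := by
  simp [rowInt, triHI]
@[simp] lemma rowInt_two (p : ℝ) (ρ : ℤ → ℝ × ℝ) (a b : ℤ) : rowInt p ρ (a, b, 2) = (ρ b).2 := by
  simp [rowInt, triHI]

/-- A region with wide rows up to level `j`. -/
def stepBox (x0 x1 y0 y1 j : ℤ) : Set Vx :=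
  {z | y0 ≤ z.2 ∧ z.2 ≤ y1 ∧ x0 - 1 ≤ z.1 ∧ z.1 ≤ x1 + 1 ∧ (j < z.2 → x0 ≤ z.1 ∧ z.1 ≤ x1)}

lemma mem_stepBox {x0 x1 y0 y1 j a b : ℤ} : (a, b) ∈ stepBox x0 x1 y0 y1 j ↔
    y0 ≤ b ∧ b ≤ y1 ∧ x0 - 1 ≤ a ∧ a ≤ x1 + 1 ∧ (j < b → x0 ≤ a ∧ a ≤ x1) := Iff.rfl

lemma stepBox_subset (x0 x1 y0 y1 j : ℤ) :
    stepBox x0 x1 y0 y1 j ⊆ Box (x0 - 1) (x1 + 1) y0 y1 :=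
  fun _ h => ⟨h.2.2.1, h.2.2.2.1, h.1, h.2.1⟩

lemma stepBox_finite (x0 x1 y0 y1 j : ℤ) : (stepBox x0 x1 y0 y1 j).Finite :=
  (Box_finite _ _ _ _).subset (stepBox_subset x0 x1 y0 y1 j)

/-- The rearrangement of star edges under the exchange of rows `j - 1` and `j`. -/
def swapIdx (j : ℤ) (e : TriE) : TriE :=
  if e.2.1 = j ∧ e.2.2 = 0 then (e.1 + 1, j - 1, 2)
  else if e.2.1 = j - 1 ∧ e.2.2 = 1 then (e.1 + 1, j, 1)
  else if e.2.1 = j - 1 ∧ e.2.2 = 2 then (e.1 - 1, j, 2)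
  else if e.2.1 = j ∧ e.2.2 = 2 then (e.1, j, 0)
  else if e.2.1 = j ∧ e.2.2 = 1 then (e.1, j - 1, 1)
  else e

lemma swapIdx_inj (j : ℤ) : Function.Injective (swapIdx j) := by
  refine Function.LeftInverse.injective (g := fun e : TriE =>
    if e.2.1 = j - 1 ∧ e.2.2 = 2 then ((e.1 - 1, j, 0) : TriE)
    else if e.2.1 = j ∧ e.2.2 = 1 then (e.1 - 1, j - 1, 1)
    else if e.2.1 = j ∧ e.2.2 = 2 then (e.1 + 1, j - 1, 2)
    else if e.2.1 = j ∧ e.2.2 = 0 then (e.1, j, 2)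
    else if e.2.1 = j - 1 ∧ e.2.2 = 1 then (e.1, j, 1)
    else e) ?_
  rintro ⟨a, b, i⟩
  have h0 : j ≠ j - 1 := by omega
  have h0' : j - 1 ≠ j := by omega
  by_cases h1 : b = j
  · subst h1
    fin_cases i <;> simp [swapIdx, h0, h0']
  · by_cases h2 : b = j - 1
    · subst h2
      fin_cases i <;> simp [swapIdx, h0, h0']
    · fin_cases i <;> simp [swapIdx, h1, h2]

variable {x0 x1 y0 y1 j : ℤ}

lemma swap_A {y : Config TriE} {a b : ℤ} :
    starMap cU {k | k.2 = j} y (a, b, 0) = (if b = j then y (a, j, 1) && y (a, j, 2) else y (a, b, 0)) ∧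
    starMap cU {k | k.2 = j} y (a, b, 1) = (if b = j then y (a, j, 2) && y (a, j, 0) else y (a, b, 1)) ∧
    starMap cU {k | k.2 = j} y (a, b, 2) = (if b = j then y (a, j, 0) && y (a, j, 1) else y (a, b, 2)) := by
  by_cases h : b = j
  · subst h
    have hm : ((a, b) : ℤ × ℤ) ∈ ({k | k.2 = b} : Set (ℤ × ℤ)) := rfl
    refine ⟨?_, ?_, ?_⟩ <;> simp only [if_true]
    · exact starMap_mem cU _ y hm 0
    · exact starMap_mem cU _ y hm 1
    · exact starMap_mem cU _ y hm 2
  · have hm : ((a, b) : ℤ × ℤ) ∉ ({k | k.2 = j} : Set (ℤ × ℤ)) := h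
    simp only [if_neg h]
    exact ⟨starMap_notMem cU _ y hm 0, starMap_notMem cU _ y hm 1, starMap_notMem cU _ y hm 2⟩

lemma swap_B {y : Config TriE} (a b : ℤ) :
    starMap cD {k | k.2 = j - 1} (fun e => y (swapIdx j e)) (a, b, 0) =
      (if b = j then y (a + 1, j, 1) && y (a, j, 2) else y (a, b, 0)) ∧
    starMap cD {k | k.2 = j - 1} (fun e => y (swapIdx j e)) (a, b, 1) =
      (if b = j - 1 then y (a, j, 2) && y (a + 1, j - 1, 2) else if b = j then y (a, j - 1, 1)
        else y (a, b, 1)) ∧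
    starMap cD {k | k.2 = j - 1} (fun e => y (swapIdx j e)) (a, b, 2) =
      (if b = j - 1 then y (a, j - 1, 2) && y (a, j, 1) else if b = j then y (a, j, 0)
        else y (a, b, 2)) := by
  refine ⟨?_, ?_, ?_⟩
  · by_cases h : b = j
    · subst h
      have := starMap_mem cD {k | k.2 = b - 1} (fun e => y (swapIdx b e)) (k := (a + 1, b - 1)) rfl 0
      simpa [cD, swapIdx] using this
    · have := starMap_notMem cD {k | k.2 = j - 1} (fun e => y (swapIdx j e)) (k := (a + 1, b - 1))
        (by simpa using h) 0
      simpa [cD, swapIdx, h] using this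
  · by_cases h : b = j - 1
    · subst h
      have := starMap_mem cD {k | k.2 = j - 1} (fun e => y (swapIdx j e)) (k := (a + 1, j - 1)) rfl 1
      simpa [cD, swapIdx] using this
    · have := starMap_notMem cD {k | k.2 = j - 1} (fun e => y (swapIdx j e)) (k := (a + 1, b))
        (by simpa using h) 1
      by_cases h' : b = j
      · subst h'; simpa [cD, swapIdx, h] using this
      · simpa [cD, swapIdx, h, h'] using this
  · by_cases h : b = j - 1
    · subst h
      have := starMap_mem cD {k | k.2 = j - 1} (fun e => y (swapIdx j e)) (k := (a, j - 1)) rfl 2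
      simpa [cD, swapIdx] using this
    · have := starMap_notMem cD {k | k.2 = j - 1} (fun e => y (swapIdx j e)) (k := (a, b))
        (by simpa using h) 2
      by_cases h' : b = j
      · subst h'; simpa [cD, swapIdx, h] using this
      · simpa [cD, swapIdx, h, h'] using this

/-- Connections survive the exchange of a row of the square lattice with the row above. -/
lemma swap_conn {y : Config TriE} (hy : ∀ a, y (a, j - 1, 1) = false) (hj : y0 < j) {u v : Vx}
    (hu : u.2 ≠ j) (hv : v.2 ≠ j)
    (h : Conn (starMap cU {k | k.2 = j} y) (stepBox x0 x1 y0 y1 (j - 1)) u v) :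
    Conn (starMap cD {k | k.2 = j - 1} (fun e => y (swapIdx j e))) (stepBox x0 x1 y0 y1 (j - 1))
      u v := by
  set A := starMap cU {k | k.2 = j} y with hA
  set B := starMap cD {k | k.2 = j - 1} (fun e => y (swapIdx j e)) with hB
  set R := stepBox x0 x1 y0 y1 (j - 1) with hR
  -- moves in the new configuration
  have m0 : ∀ a, y (a + 1, j, 1) = true → y (a, j, 2) = true → Adj B (a, j) (a + 1, j) := by
    intro a h1 h2
    refine adj_e0 ?_
    rw [hB, (swap_B a j).1, if_pos rfl, h1, h2]; rfl
  have m1 : ∀ a, y (a, j, 2) = true → y (a + 1, j - 1, 2) = true → Adj B (a + 1, j - 1) (a, j) := by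
    intro a h1 h2
    have : Adj B (a + 1, j - 1) (a, j - 1 + 1) := by
      refine adj_e1 ?_
      rw [hB, (swap_B a (j - 1)).2.1, if_pos rfl, h1, h2]; rfl
    simpa using this
  have m2 : ∀ a, y (a, j - 1, 2) = true → y (a, j, 1) = true → Adj B (a, j - 1) (a, j) := by
    intro a h1 h2
    have : Adj B (a, j - 1) (a, j - 1 + 1) := by
      refine adj_e2 ?_
      rw [hB, (swap_B a (j - 1)).2.2, if_pos rfl, h1, h2]; rfl
    simpa using this
  have m3 : ∀ a, y (a, j, 0) = true → Adj B (a, j) (a, j + 1) := by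
    intro a h1
    refine adj_e2 ?_
    rw [hB, (swap_B a j).2.2, if_neg (by omega), if_pos rfl, h1]
  -- the invariant
  let Q : Vx → Prop := fun z => if z.2 = j then
      ((z.1, j - 1) ∈ R ∧ y (z.1, j - 1, 2) = true ∧ Conn B R u (z.1, j - 1)) ∨
      ((z.1, j) ∈ R ∧ y (z.1, j, 1) = true ∧ Conn B R u (z.1, j)) ∨
      ((z.1 - 1, j) ∈ R ∧ y (z.1 - 1, j, 2) = true ∧ Conn B R u (z.1 - 1, j))
    else Conn B R u z
  -- from a vertex of level `j` one can go to each of the star neighbours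
  have g1 : ∀ a, Q (a, j) → (a, j) ∈ R → y (a, j, 1) = true → Conn B R u (a, j) := by
    intro a hq hm h1
    simp only [Q, if_true] at hq
    rcases hq with ⟨r1, r2, r3⟩ | ⟨r1, r2, r3⟩ | ⟨r1, r2, r3⟩
    · exact r3.trans (Conn.step (m2 a r2 h1) r1 hm)
    · exact r3
    · have := m0 (a - 1) (by simpa using h1) r2
      rw [sub_add_cancel] at this
      exact r3.trans (Conn.step this r1 hm)
  have g2 : ∀ a, Q (a, j) → (a - 1, j) ∈ R → y (a - 1, j, 2) = true → Conn B R u (a - 1, j) := by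
    intro a hq hm h1
    simp only [Q, if_true] at hq
    rcases hq with ⟨r1, r2, r3⟩ | ⟨r1, r2, r3⟩ | ⟨r1, r2, r3⟩
    · have := m1 (a - 1) h1 (by simpa using r2)
      rw [sub_add_cancel] at this
      exact r3.trans (Conn.step this r1 hm)
    · have := m0 (a - 1) (by simpa using r2) h1
      rw [sub_add_cancel] at this
      exact r3.trans (Conn.step this.symm r1 hm)
    · exact r3
  have g0 : ∀ a, Q (a, j) → (a, j - 1) ∈ R → y (a, j - 1, 2) = true → Conn B R u (a, j - 1) := by
    intro a hq hm h1
    simp only [Q, if_true] at hq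
    rcases hq with ⟨r1, r2, r3⟩ | ⟨r1, r2, r3⟩ | ⟨r1, r2, r3⟩
    · exact r3
    · exact r3.trans (Conn.step (m2 a h1 r2).symm r1 hm)
    · have := m1 (a - 1) r2 (by simpa using h1)
      rw [sub_add_cancel] at this
      exact r3.trans (Conn.step this.symm r1 hm)
  have key : Q v := by
    clear hv
    induction h with
    | refl => simp only [Q, if_neg hu]; exact Conn.refl _
    | @tail x z _ hs ih =>
      obtain ⟨hadj, hx, hz⟩ := hs
      obtain ⟨a, b⟩ := x
      -- edges of `A` not touching level `j` and not in row `j` are edges of `B`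
      have nb : ∀ {z : Vx}, b ≠ j → z.2 ≠ j → Adj B (a, b) z → z ∈ R → Q z := by
        intro z h1 h2 h3 h4
        simp only [Q, if_neg h1] at ih
        simp only [Q, if_neg h2]
        exact ih.trans (Conn.step h3 hx h4)
      rcases adj_iff.1 hadj with (⟨h, rfl⟩ | ⟨h, rfl⟩ | ⟨h, rfl⟩ | ⟨h, rfl⟩ | ⟨h, rfl⟩ | ⟨h, rfl⟩)
      · by_cases hb : b = j
        · subst hb
          rw [hA, swap_A.1, if_pos rfl, Bool.and_eq_true] at h
          have := g1 a ih hx h.1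
          simp only [Q, if_true]
          exact Or.inr (Or.inr ⟨by simpa using hx, by simpa using h.2, by simpa using this⟩)
        · refine nb hb hb (adj_e0 ?_) hz
          rw [hA, swap_A.1, if_neg hb] at h
          rw [hB, (swap_B a b).1, if_neg hb, h]
      · by_cases hb : b = j
        · subst hb
          rw [hA, swap_A.1, if_pos rfl, Bool.and_eq_true] at h
          have := g2 a ih hz h.2
          simp only [Q, if_true]
          exact Or.inr (Or.inl ⟨hz, h.1, this⟩)
        · refine nb hb hb ?_ hz
          rw [hA, swap_A.1, if_neg hb] at h
          refine adj_iff.2 (Or.inr (Or.inl ⟨?_, rfl⟩))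
          rw [hB, (swap_B _ b).1, if_neg hb, h]
      · by_cases hb : b = j
        · subst hb
          rw [hA, swap_A.2.1, if_pos rfl, Bool.and_eq_true] at h
          have hm : (a - 1, b) ∈ R := by
            rw [hR, mem_stepBox] at *; omega
          have := g2 a ih hm h.1
          simp only [Q, if_neg (show b + 1 ≠ b by omega)]
          exact this.trans (Conn.step (m3 _ h.2) hm hz)
        · rw [hA, swap_A.2.1, if_neg hb] at h
          by_cases hb' : b = j - 1
          · subst hb'
            rw [hy] at h
            exact absurd h (by simp)
          · refine nb hb (by simp; omega) ?_ hz
            refine adj_iff.2 (Or.inr (Or.inr (Or.inl ⟨?_, rfl⟩)))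
            rw [hB, (swap_B _ b).2.1, if_neg hb', if_neg hb, h]
      · by_cases hb : b - 1 = j
        · subst hb
          rw [hA, swap_A.2.1, if_pos rfl, Bool.and_eq_true] at h
          have hm : (a, b - 1) ∈ R := by
            rw [hR, mem_stepBox] at *; omega
          simp only [Q, if_neg (show b ≠ b - 1 by omega)] at ih
          have h3 := m3 a h.2
          rw [sub_add_cancel] at h3
          simp only [Q, if_true]
          exact Or.inr (Or.inr ⟨by simpa using hm, by simpa using h.1,
            by simpa using ih.trans (Conn.step h3.symm hx hm)⟩)
        · rw [hA, swap_A.2.1, if_neg hb] at h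
          by_cases hb' : b = j
          · subst hb'
            rw [hy] at h
            exact absurd h (by simp)
          · refine nb hb' hb ?_ hz
            refine adj_iff.2 (Or.inr (Or.inr (Or.inr (Or.inl ⟨?_, rfl⟩))))
            rw [hB, (swap_B _ _).2.1, if_neg (by omega), if_neg hb, h]
      · by_cases hb : b = j
        · subst hb
          rw [hA, swap_A.2.2, if_pos rfl, Bool.and_eq_true] at h
          have := g1 a ih hx h.2
          simp only [Q, if_neg (show b + 1 ≠ b by omega)]
          exact this.trans (Conn.step (m3 _ h.1) hx hz)
        · rw [hA, swap_A.2.2, if_neg hb] at h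
          by_cases hb' : b = j - 1
          · subst hb'
            simp only [Q, if_neg hb] at ih
            simp only [Q, if_pos (show j - 1 + 1 = j by omega)]
            exact Or.inl ⟨hx, h, ih⟩
          · refine nb hb (by simp; omega) (adj_e2 ?_) hz
            rw [hB, (swap_B _ b).2.2, if_neg hb', if_neg hb, h]
      · by_cases hb : b - 1 = j
        · subst hb
          rw [hA, swap_A.2.2, if_pos rfl, Bool.and_eq_true] at h
          simp only [Q, if_neg (show b ≠ b - 1 by omega)] at ih
          have h3 := m3 a h.1
          rw [sub_add_cancel] at h3
          simp only [Q, if_true]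
          exact Or.inr (Or.inl ⟨hz, h.2, ih.trans (Conn.step h3.symm hx hz)⟩)
        · rw [hA, swap_A.2.2, if_neg hb] at h
          by_cases hb' : b = j
          · subst hb'
            have := g0 a ih hz h
            simp only [Q, if_neg hb]
            exact this
          · refine nb hb' hb ?_ hz
            refine adj_iff.2 (Or.inr (Or.inr (Or.inr (Or.inr (Or.inr ⟨?_, rfl⟩)))))
            rw [hB, (swap_B _ _).2.2, if_neg (by omega), if_neg hb, h]
  simpa only [Q, if_neg hv] using key

lemma kappa_sqRow {p : ℝ} : kappaT p (sqRow p).1 (sqRow p).2 = 0 := by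
  simp [kappaT, sqRow]

/-- Exchanging a row of the square lattice with the row above it. -/
lemma swap_le {p : ℝ} {ρ ρ' : ℤ → ℝ × ℝ} (hρ : RowOK p ρ) (h1 : ρ (j - 1) = sqRow p)
    (h2 : ρ' j = sqRow p) (h3 : ρ' (j - 1) = ρ j) (h4 : ∀ b, b ≠ j → b ≠ j - 1 → ρ' b = ρ b)
    (hj : y0 < j) {P : Vx → Vx → Prop} (hP : ∀ u v, P u v → u.2 ≠ j ∧ v.2 ≠ j) :
    (rowM p ρ).real (CE (stepBox x0 x1 y0 y1 (j - 1)) P) ≤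
      (rowM p ρ').real (CE (stepBox x0 x1 y0 y1 j) P) := by
  set R := stepBox x0 x1 y0 y1 (j - 1) with hR
  have fR : FD (CE R P) := CE_FD (stepBox_finite _ _ _ _ _) _
  set g : TriE → ℝ := fun e => if e.2.1 = j then 1 - rowInt p ρ e else rowInt p ρ e with hg
  have s1 : (rowM p ρ).real (CE R P) ≤ (rowM p ρ).real (triMap cU {k | k.2 = j} ⁻¹' (CE R P)) :=
    measureReal_mono fun ω hω => CE_upper R P (le_triMap cU _ ω) hω
  have s2 : (rowM p ρ).real (triMap cU {k | k.2 = j} ⁻¹' (CE R P)) =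
      (bern g).real (starMap cU {k | k.2 = j} ⁻¹' (CE R P)) := by
    refine star_tri_real cU _ _ _ ?_ ?_ ?_ fR
    · rintro ⟨a, b⟩ (hb : b = j)
      refine ⟨fun i => hρ.mem _, ?_⟩
      simpa [cU] using hρ.hk b
    · rintro ⟨a, b⟩ (hb : b = j) i
      simp [cU, hg, hb]
    · rintro ⟨a, b⟩ (hb : b ≠ j) i
      simp [cU, hg, hb]
  have s3 : (bern g).real (starMap cU {k | k.2 = j} ⁻¹' (CE R P)) ≤
      (bern g).real ((fun y e => y (swapIdx j e)) ⁻¹' (starMap cD {k | k.2 = j - 1} ⁻¹' (CE R P))) := by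
    refine ENNReal.toReal_mono (measure_ne_top _ _) (measure_mono_ae ?_)
    filter_upwards [bern_ae_zero g] with y hy
    rintro ⟨u, v, hp, hc⟩
    refine ⟨u, v, hp, swap_conn (fun a => hy _ ?_) hj (hP _ _ hp).1 (hP _ _ hp).2 hc⟩
    simp [hg, h1, sqRow]
  have fS : FD (starMap cD {k | k.2 = j - 1} ⁻¹' (CE R P)) := fR.preimage _ (cellMap_FD _ _)
  have s4 := bern_real_inj g (swapIdx j) (swapIdx_inj j) fS
  have s5 : (rowM p ρ').real (triMap cD {k | k.2 = j - 1} ⁻¹' (CE R P)) =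
      (bern fun x => g (swapIdx j x)).real (starMap cD {k | k.2 = j - 1} ⁻¹' (CE R P)) := by
    refine star_tri_real cD _ _ _ ?_ ?_ ?_ fR
    · rintro ⟨a, b⟩ (rfl : b = j - 1)
      refine ⟨fun i => ?_, ?_⟩
      · have := hρ.hp; have := hρ.hq j; have := hρ.hq' j
        fin_cases i <;> simp [cD, h3] <;> grind
      · simpa [cD, h3] using hρ.hk j
    · rintro ⟨a, b⟩ (rfl : b = j - 1) i
      fin_cases i <;> simp [cD, hg, swapIdx, h3, h1, sqRow]
    · rintro ⟨a, b⟩ (hb : b ≠ j - 1) i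
      have hb' : b + 1 ≠ j := by omega
      by_cases hbj : b = j
      · subst hbj
        fin_cases i <;> simp [cD, hg, swapIdx, h2, h1, sqRow, hb]
      · fin_cases i <;> simp [cD, hg, swapIdx, hb', hbj, hb, h4 b hbj hb]
  have s6 : (rowM p ρ').real (triMap cD {k | k.2 = j - 1} ⁻¹' (CE R P)) ≤
      (rowM p ρ').real (CE (stepBox x0 x1 y0 y1 j) P) := by
    refine measureReal_mono ?_
    rintro ω ⟨u, v, hp, hc⟩
    refine ⟨u, v, hp, hc.map id fun s t hs ht ha => ?_⟩
    have hRR : R ⊆ stepBox x0 x1 y0 y1 j := fun z hz =>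
      ⟨hz.1, hz.2.1, hz.2.2.1, hz.2.2.2.1, fun h => hz.2.2.2.2 (by omega)⟩
    refine triMap_cD_conn hRR ha hs ht ?_ ?_ ?_
    · rintro a b (hb : b - 1 = j - 1) _ h h'
      rw [hR] at h h'; rw [mem_stepBox] at *; omega
    · rintro a b (hb : b = j - 1) h h'
      rw [hR] at h h'; rw [mem_stepBox] at *; omega
    · rintro a b (hb : b = j - 1) _ h h'
      rw [hR] at h h'; rw [mem_stepBox] at *; omega
  rw [s2] at s1
  linarith

/-- The rows obtained from `ρ` by moving a row of the square lattice from `i` to `n`. -/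
def moveRow (p : ℝ) (ρ : ℤ → ℝ × ℝ) (i n : ℤ) : ℤ → ℝ × ℝ := fun b =>
  if b = n then sqRow p else if i ≤ b ∧ b < n then ρ (b + 1) else ρ b

lemma moveRow_self {p : ℝ} {ρ : ℤ → ℝ × ℝ} {i : ℤ} (h : ρ i = sqRow p) : moveRow p ρ i i = ρ := by
  ext1 b
  unfold moveRow
  split_ifs with h1 h2
  · rw [h1, h]
  · omega
  · rfl

lemma RowOK.of_forall {p : ℝ} {ρ ρ' : ℤ → ℝ × ℝ} (h : RowOK p ρ)
    (h' : ∀ b, ρ' b = sqRow p ∨ ∃ c, ρ' b = ρ c) : RowOK p ρ' := by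
  have hp := h.hp
  refine ⟨hp, fun n => ?_, fun n => ?_, fun n => ?_⟩ <;>
    rcases h' n with h1 | ⟨c, h1⟩ <;> simp only [h1]
  · simp [sqRow]
  · exact h.hq c
  · simp only [sqRow]; exact ⟨by linarith [hp.2], by linarith [hp.1]⟩
  · exact h.hq' c
  · exact kappa_sqRow
  · exact h.hk c

lemma moveRow_ok {p : ℝ} {ρ : ℤ → ℝ × ℝ} (h : RowOK p ρ) (i n : ℤ) : RowOK p (moveRow p ρ i n) := by
  refine h.of_forall fun b => ?_
  unfold moveRow
  split_ifs
  · exact Or.inl rfl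
  · exact Or.inr ⟨_, rfl⟩
  · exact Or.inr ⟨_, rfl⟩

/-- Moving a row of the square lattice up to level `n`. -/
lemma sweep_le {p : ℝ} {ρ : ℤ → ℝ × ℝ} (hρ : RowOK p ρ) {i n : ℤ} (h1 : ρ i = sqRow p)
    (hin : i ≤ n) (hi : y0 ≤ i) (hn : n < y1) :
    (rowM p ρ).real (VC x0 x1 y0 y1) ≤
      (rowM p (moveRow p ρ i n)).real (VC (x0 - 1) (x1 + 1) y0 y1) := by
  set P : Vx → Vx → Prop := fun u v => u ∈ Box (x0 - 1) (x1 + 1) y0 y1 ∧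
    v ∈ Box (x0 - 1) (x1 + 1) y0 y1 ∧ u.2 = y0 ∧ v.2 = y1 with hP
  have e0 : (rowM p ρ).real (VC x0 x1 y0 y1) ≤ (rowM p ρ).real (CE (stepBox x0 x1 y0 y1 i) P) := by
    refine measureReal_mono ?_
    have hb : Box x0 x1 y0 y1 ⊆ stepBox x0 x1 y0 y1 i := by
      rintro ⟨a, b⟩ hz
      rw [mem_Box] at hz; rw [mem_stepBox]; omega
    rintro ω ⟨u, v, ⟨hu, hv, h1, h2⟩, hc⟩
    exact ⟨u, v, ⟨stepBox_subset _ _ _ _ _ (hb hu), stepBox_subset _ _ _ _ _ (hb hv), h1, h2⟩,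
      hc.monoR hb⟩
  have e1 : ∀ n, i ≤ n → n < y1 → (rowM p ρ).real (CE (stepBox x0 x1 y0 y1 i) P) ≤
      (rowM p (moveRow p ρ i n)).real (CE (stepBox x0 x1 y0 y1 n) P) := by
    intro n hin
    induction n, hin using Int.leInduction with
    | base => intro _; rw [moveRow_self h1]
    | succ n hin ih =>
      intro hn
      refine (ih (by omega)).trans ?_
      have := swap_le (x0 := x0) (x1 := x1) (y0 := y0) (y1 := y1) (j := n + 1) (ρ := moveRow p ρ i n)
        (ρ' := moveRow p ρ i (n + 1)) (P := P) (moveRow_ok hρ i n) (by simp [moveRow])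
        (by simp [moveRow])
        (by simp only [moveRow]; split_ifs <;> first | rfl | omega | (congr 1; omega))
        (by
          intro b hb hb'
          simp only [moveRow]; split_ifs <;> first | rfl | omega)
        (by omega) (by
          rintro u v ⟨-, -, h3, h4⟩
          exact ⟨by rw [h3]; omega, by rw [h4]; omega⟩)
      simpa using this
  refine e0.trans ((e1 n hin hn).trans (measureReal_mono ?_))
  rintro ω ⟨u, v, hp, hc⟩
  exact ⟨u, v, hp, hc.monoR (stepBox_subset _ _ _ _ _)⟩

end

lemma bern_congr {E : Type} {f g : E → ℝ} {A : Set (Config E)} {S : Finset E}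
    (h : ∀ ω ω' : Config E, (∀ e ∈ S, ω e = ω' e) → ω ∈ A → ω' ∈ A)
    (hfg : ∀ e ∈ S, f e = g e) : (bern f).real A = (bern g).real A := by
  rw [bern_real_eq_sum f h, bern_real_eq_sum g h]
  refine Finset.sum_congr rfl fun x _ => ?_
  congr 1
  exact Finset.prod_congr rfl fun e _ => by rw [hfg e e.2]

lemma bern_pattern {E : Type} {f : E → ℝ} (hf : ∀ e, f e ∈ Icc (0:ℝ) 1) (S : Finset E)
    (φ : E → Bool) : (bern f).real {ω | ∀ e ∈ S, ω e = φ e} =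
      ∏ e ∈ S, if φ e then f e else 1 - f e := by
  have h1 : {ω : Config E | ∀ e ∈ S, ω e = φ e} = (S : Set E).pi fun e => {φ e} := by
    ext ω; simp [Set.mem_pi]
  rw [h1, measureReal_def, bern, Measure.infinitePi_pi _ (fun _ _ => (Set.toFinite _).measurableSet),
    ENNReal.toReal_prod]
  refine Finset.prod_congr rfl fun e _ => ?_
  rw [bmeas_apply_singleton (hf e), ENNReal.toReal_ofReal]
  have := hf e
  split_ifs
  · exact this.1
  · linarith [this.2]

/-- Events determined by edges of a horizontal strip only depend on the rows of this strip. -/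
lemma rowM_congr {p : ℝ} {ρ ρ' : ℤ → ℝ × ℝ} {y0 y1 : ℤ} (h : ∀ b, y0 ≤ b → b < y1 → ρ b = ρ' b)
    {A : Set (Config TriE)} {S : Finset TriE}
    (hA : ∀ ω ω' : Config TriE, (∀ e ∈ S, ω e = ω' e) → ω ∈ A → ω' ∈ A)
    (hS : ∀ e ∈ S, y0 ≤ (src e).2 ∧ (tgt e).2 ≤ y1) :
    (rowM p ρ).real A = (rowM p ρ').real A := by
  refine bern_congr hA ?_
  rintro ⟨a, b, i⟩ he
  have := hS _ he
  fin_cases i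
  · simp
  · simp [src, tgt] at this ⊢
    rw [h b this.1 (by omega)]
  · simp [src, tgt] at this ⊢
    rw [h b this.1 (by omega)]

lemma rowM_CE_congr {p : ℝ} {ρ ρ' : ℤ → ℝ × ℝ} {x0 x1 y0 y1 : ℤ}
    (h : ∀ b, y0 ≤ b → b < y1 → ρ b = ρ' b) (P : Vx → Vx → Prop) :
    (rowM p ρ).real (CE (Box x0 x1 y0 y1) P) = (rowM p ρ').real (CE (Box x0 x1 y0 y1) P) := by
  refine rowM_congr h (CE_dep (Box_finite _ _ _ _) P) fun e he => ?_
  simp only [Finite.mem_toFinset, edgesIn, mem_ofPred_eq] at he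
  exact ⟨he.1.2.2.1, he.2.2.2.2⟩

lemma rowM_VC_congr {p : ℝ} {ρ ρ' : ℤ → ℝ × ℝ} {x0 x1 y0 y1 : ℤ}
    (h : ∀ b, y0 ≤ b → b < y1 → ρ b = ρ' b) :
    (rowM p ρ).real (VC x0 x1 y0 y1) = (rowM p ρ').real (VC x0 x1 y0 y1) := rowM_CE_congr h _

lemma rowM_VC_shift (p : ℝ) (ρ : ℤ → ℝ × ℝ) (x0 x1 y0 y1 x y : ℤ) :
    (rowM p ρ).real (VC (x0 + x) (x1 + x) (y0 + y) (y1 + y)) =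
      (rowM p fun b => ρ (b + y)).real (VC x0 x1 y0 y1) := by
  have h1 : VC (x0 + x) (x1 + x) (y0 + y) (y1 + y) = trC x y ⁻¹' (VC x0 x1 y0 y1) := by
    ext ω; rw [mem_preimage, trC_mem_VC]
  rw [h1, bern_trC _ _ _ (VC_FD _ _ _ _)]
  congr 3

lemma rowM_HC_shift (p : ℝ) (ρ : ℤ → ℝ × ℝ) (x0 x1 y0 y1 x y : ℤ) :
    (rowM p ρ).real (HC (x0 + x) (x1 + x) (y0 + y) (y1 + y)) =
      (rowM p fun b => ρ (b + y)).real (HC x0 x1 y0 y1) := by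
  have h1 : HC (x0 + x) (x1 + x) (y0 + y) (y1 + y) = trC x y ⁻¹' (HC x0 x1 y0 y1) := by
    ext ω; rw [mem_preimage, trC_mem_HC]
  rw [h1, bern_trC _ _ _ (HC_FD _ _ _ _)]
  congr 3

/-- Exchanging horizontal edges and left edges of row `y0`. -/
def flipIdx (y0 : ℤ) (e : TriE) : TriE :=
  if e.2.1 = y0 ∧ e.2.2 = 2 then (e.1, y0, 0)
  else if e.2.1 = y0 ∧ e.2.2 = 0 then (e.1, y0, 2) else e

lemma flipIdx_inj (y0 : ℤ) : Function.Injective (flipIdx y0) := by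
  refine Function.LeftInverse.injective (g := flipIdx y0) ?_
  rintro ⟨a, b, i⟩
  by_cases h1 : b = y0
  · subst h1
    fin_cases i <;> simp [flipIdx]
  · simp [flipIdx, h1]

/-- A left edge of row `y0` is open and its upper endpoint is connected to level `y1`. -/
def riseE (x0 x1 y0 y1 : ℤ) : Set (Config TriE) :=
  {ω | ∃ i, ω (i, y0, 2) = true ∧ (i, y0 + 1) ∈ Box x0 x1 (y0 + 1) y1 ∧
    ∃ v, v.2 = y1 ∧ Conn ω (Box x0 x1 (y0 + 1) y1) (i, y0 + 1) v}

open scoped Classical in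
lemma riseE_dep {x0 x1 y0 y1 : ℤ} (ω ω' : Config TriE)
    (h : ∀ e ∈ (edgesIn_finite (Box_finite x0 x1 (y0 + 1) y1)).toFinset ∪
      (Finset.Icc x0 x1).image (fun i => ((i, y0, 2) : TriE)), ω e = ω' e)
    (hω : ω ∈ riseE x0 x1 y0 y1) : ω' ∈ riseE x0 x1 y0 y1 := by
  obtain ⟨i, h1, h2, v, h3, h4⟩ := hω
  refine ⟨i, ?_, h2, v, h3, h4.congr fun e he he' => h e ?_⟩
  · rw [← h _ ?_, h1]
    rw [mem_Box] at h2
    refine Finset.mem_union_right _ (Finset.mem_image_of_mem _ (Finset.mem_Icc.2 ⟨h2.1, h2.2.1⟩))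
  · exact Finset.mem_union_left _ (by simpa using ⟨he, he'⟩)

/-- Replacing the bottom row by a row of the square lattice increases the probability of
vertical crossings. -/
lemma bottom_le {p : ℝ} {ρ ρ' : ℤ → ℝ × ℝ} (hρ : RowOK p ρ) {x0 x1 y0 y1 : ℤ} (hy : y0 < y1)
    (h1 : ρ' y0 = sqRow p) (h2 : ∀ b, b ≠ y0 → ρ' b = ρ b) :
    (rowM p ρ).real (VC x0 x1 y0 y1) ≤ (rowM p ρ').real (VC x0 x1 y0 y1) := by
  classical
  have fV : FD (VC x0 x1 y0 y1) := VC_FD _ _ _ _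
  set g : TriE → ℝ := fun e => if e.2.1 = y0 then 1 - rowInt p ρ e else rowInt p ρ e with hg
  have s1 : (rowM p ρ).real (VC x0 x1 y0 y1) ≤
      (rowM p ρ).real (triMap cU {k | k.2 = y0} ⁻¹' (VC x0 x1 y0 y1)) :=
    measureReal_mono fun ω hω => VC_upper _ _ _ _ (le_triMap cU _ ω) hω
  have s2 : (rowM p ρ).real (triMap cU {k | k.2 = y0} ⁻¹' (VC x0 x1 y0 y1)) =
      (bern g).real (starMap cU {k | k.2 = y0} ⁻¹' (VC x0 x1 y0 y1)) := by
    refine star_tri_real cU _ _ _ ?_ ?_ ?_ fV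
    · rintro ⟨a, b⟩ (hb : b = y0)
      refine ⟨fun i => hρ.mem _, ?_⟩
      simpa [cU] using hρ.hk b
    · rintro ⟨a, b⟩ (hb : b = y0) i
      simp [cU, hg, hb]
    · rintro ⟨a, b⟩ (hb : b ≠ y0) i
      simp [cU, hg, hb]
  have fE : FD (riseE x0 x1 y0 y1) := ⟨_, riseE_dep⟩
  have s3 : (bern g).real (starMap cU {k | k.2 = y0} ⁻¹' (VC x0 x1 y0 y1)) ≤
      (bern g).real ((fun y e => y (flipIdx y0 e)) ⁻¹' (riseE x0 x1 y0 y1)) := by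
    refine measureReal_mono ?_
    rintro y ⟨u, v, ⟨hu, hv, hu0, hv1⟩, hc⟩
    set A := starMap cU {k | k.2 = y0} y with hA
    set z : Config TriE := fun e => y (flipIdx y0 e) with hz
    have key : y0 + 1 ≤ v.2 → ∃ i, z (i, y0, 2) = true ∧ (i, y0 + 1) ∈ Box x0 x1 (y0 + 1) y1 ∧
        Conn z (Box x0 x1 (y0 + 1) y1) (i, y0 + 1) v := by
      clear hv hv1
      induction hc with
      | refl => intro h; omega
      | @tail b c _ hs ih =>
        intro hc
        obtain ⟨hadj, hb, hcm⟩ := hs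
        have hcb : c ∈ Box x0 x1 (y0 + 1) y1 := ⟨hcm.1, hcm.2.1, hc, hcm.2.2.2⟩
        by_cases hb1 : y0 + 1 ≤ b.2
        · obtain ⟨i, h3, h4, h5⟩ := ih hb1
          have hbb : b ∈ Box x0 x1 (y0 + 1) y1 := ⟨hb.1, hb.2.1, hb1, hb.2.2.2⟩
          have h6 : Conn A (Box x0 x1 (y0 + 1) y1) b c := Conn.step hadj hbb hcb
          refine ⟨i, h3, h4, h5.trans (h6.congr ?_)⟩
          rintro ⟨a, r, k⟩ he he'
          have hr : r ≠ y0 := by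
            have h7 := he.2.2.1
            have h8 : (src (a, r, k)).2 = r := by unfold src; split_ifs <;> rfl
            omega
          fin_cases k
          · simp [hA, hz, swap_A, flipIdx, hr]
          · simp [hA, hz, swap_A, flipIdx, hr]
          · simp [hA, hz, swap_A, flipIdx, hr]
        · obtain ⟨a, r⟩ := b
          have hr : r = y0 := by
            have := hb.2.2.1; simp at this hb1; omega
          subst hr
          have hrr : r - 1 ≠ r := by omega
          rcases adj_iff.1 hadj with (⟨h, rfl⟩ | ⟨h, rfl⟩ | ⟨h, rfl⟩ | ⟨h, rfl⟩ | ⟨h, rfl⟩ | ⟨h, rfl⟩)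
          · simp at hc
          · simp at hc
          · refine ⟨a - 1, ?_, hcb, Conn.refl _⟩
            simp [hA, swap_A] at h
            simp [hz, flipIdx, h.2]
          · simp at hc
          · refine ⟨a, ?_, hcb, Conn.refl _⟩
            simp [hA, swap_A] at h
            simp [hz, flipIdx, h.1]
          · simp at hc
    obtain ⟨i, h3, h4, h5⟩ := key (by omega)
    exact ⟨i, h3, h4, v, hv1, h5⟩
  have s4 := bern_real_inj g (flipIdx y0) (flipIdx_inj y0) fE
  have s5 : (bern fun x => g (flipIdx y0 x)).real (riseE x0 x1 y0 y1) =
      (rowM p ρ').real (riseE x0 x1 y0 y1) := by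
    refine bern_congr riseE_dep ?_
    intro e he
    rcases Finset.mem_union.1 he with he | he
    · obtain ⟨a, r, k⟩ := e
      simp only [Finite.mem_toFinset, edgesIn, mem_ofPred_eq] at he
      have hr : r ≠ y0 := by
        have h7 := he.1.2.2.1
        have h8 : (src (a, r, k)).2 = r := by unfold src; split_ifs <;> rfl
        omega
      fin_cases k <;> simp [hg, flipIdx, hr, h2]
    · obtain ⟨i, -, rfl⟩ := Finset.mem_image.1 he
      simp [hg, flipIdx, h1, sqRow]
  have s6 : (rowM p ρ').real (riseE x0 x1 y0 y1) ≤ (rowM p ρ').real (VC x0 x1 y0 y1) := by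
    refine measureReal_mono ?_
    rintro ω ⟨i, h3, h4, v, h5, h6⟩
    have hsub : Box x0 x1 (y0 + 1) y1 ⊆ Box x0 x1 y0 y1 := fun z hz => by
      have := hz.2.2.1; exact ⟨hz.1, hz.2.1, by omega, hz.2.2.2⟩
    have h7 := h6.mem h4
    have hi : (i, y0) ∈ Box x0 x1 y0 y1 := by rw [mem_Box] at *; omega
    exact ⟨(i, y0), v, ⟨hi, hsub h7, rfl, h5⟩,
      (Conn.step (adj_e2 h3) hi (hsub h4)).trans (h6.monoR hsub)⟩
  rw [s2] at s1
  linarith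

lemma rowM_le_sq_aux {p : ℝ} {y0 y1 : ℤ} (k : ℕ) : ∀ (ρ : ℤ → ℝ × ℝ) (x0 x1 : ℤ), RowOK p ρ →
    (∀ b, y0 + k ≤ b → b < y1 → ρ b = sqRow p) → y0 + k ≤ y1 →
    (rowM p ρ).real (VC x0 x1 y0 y1) ≤
      (rowM p fun _ => sqRow p).real (VC (x0 - k) (x1 + k) y0 y1) := by
  induction k with
  | zero =>
    intro ρ x0 x1 hρ h h1
    simp only [Nat.cast_zero, add_zero, sub_zero] at *
    exact (rowM_VC_congr h).le
  | succ k ih =>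
    intro ρ x0 x1 hρ h h1
    push_cast at h h1
    set ρ1 : ℤ → ℝ × ℝ := fun b => if b = y0 then sqRow p else ρ b with h1def
    have hok : RowOK p ρ1 := hρ.of_forall fun b => by
      simp only [h1def]; split_ifs
      · exact Or.inl rfl
      · exact Or.inr ⟨_, rfl⟩
    have e1 := bottom_le (x0 := x0) (x1 := x1) (ρ' := ρ1) hρ (show y0 < y1 by omega) (by simp [h1def])
      (fun b hb => by simp [h1def, hb])
    have e2 := sweep_le (x0 := x0) (x1 := x1) (y0 := y0) (y1 := y1) hok (i := y0) (n := y0 + k) (by simp [h1def])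
      (by omega) le_rfl (by omega)
    have e3 := ih (moveRow p ρ1 y0 (y0 + k)) (x0 - 1) (x1 + 1) (moveRow_ok hok _ _) (by
      intro b hb hb1
      simp only [moveRow, h1def]
      split_ifs <;> first | rfl | omega | (exact h b (by omega) hb1)) (by omega)
    refine e1.trans (e2.trans (e3.trans (le_of_eq ?_)))
    push_cast
    congr 2 <;> ring

/-- Comparison of a highly inhomogeneous measure with the square lattice. -/
lemma rowM_le_sq {p : ℝ} {ρ : ℤ → ℝ × ℝ} (hρ : RowOK p ρ) (x0 x1 y0 : ℤ) (k : ℕ) :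
    (rowM p ρ).real (VC x0 x1 y0 (y0 + k)) ≤
      (rowM p fun _ => sqRow p).real (VC (x0 - k) (x1 + k) y0 (y0 + k)) :=
  rowM_le_sq_aux k ρ x0 x1 hρ (fun b h h' => by omega) le_rfl

/-- The edges at the vertex `(u, K)`. -/
def edgesAt (u K : ℤ) : Finset TriE :=
  {(u, K, 0), (u - 1, K, 0), (u - 1, K, 1), (u, K - 1, 1), (u, K, 2), (u, K - 1, 2)}

lemma mem_edgesAt {u K : ℤ} {e : TriE} : e ∈ edgesAt u K ↔ src e = (u, K) ∨ tgt e = (u, K) := by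
  obtain ⟨a, b, i⟩ := e
  fin_cases i <;> simp [edgesAt, src, tgt] <;> omega

/-- Close all edges at the vertex `(u, K)`. -/
def closeAt (u K : ℤ) (ω : Config TriE) : Config TriE :=
  fun e => if e ∈ edgesAt u K then false else ω e

lemma closeAt_le (u K : ℤ) (ω : Config TriE) : closeAt u K ω ≤ ω := by
  intro e; unfold closeAt; split_ifs <;> simp

/-- The edges at `(u, K)` are closed, except for the edge `(u, K - 1, i)`. -/
def deadEnd (u K : ℤ) (i : Fin 3) : Set (Config TriE) :=
  {ω | ∀ e ∈ edgesAt u K, ω e = decide (e = (u, K - 1, i))}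

lemma deadEnd_prob {p : ℝ} {ρ : ℤ → ℝ × ℝ} (hρ : RowOK p ρ) {K : ℤ} (hK : ρ K = sqRow p) :
    ∃ i : Fin 3, (i = 1 ∨ i = 2) ∧
      ∀ u, (1 - p) ^ 3 * p ^ 2 / 2 ≤ (rowM p ρ).real (deadEnd u K i) := by
  have h0 := hρ.hp
  have h1 := hρ.hq (K - 1)
  have h2 := hρ.hq' (K - 1)
  have hk := hρ.hk (K - 1)
  unfold kappaT at hk
  have hn : K - 1 ≠ K := by omega
  have hn' : ¬ K = K - 1 := by omega
  have h3 : ∀ u : ℤ, ¬ u - 1 = u := by intro u; omega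
  have h3' : ∀ u : ℤ, ¬ u = u - 1 := by intro u; omega
  set t := (ρ (K - 1)).1
  set t' := (ρ (K - 1)).2
  have key : p ≤ (1 - t) * (1 - t') := by nlinarith [mul_nonneg h1.1 h2.1, h0.1, h0.2]
  have hs : 1 - p ≤ t + t' := by nlinarith [mul_nonneg h1.1 h2.1, h0.1, h0.2, mul_nonneg h0.1.le (mul_nonneg h1.1 h2.1)]
  have hp' : 0 ≤ 1 - p := by linarith [h0.2]
  have fin : ∀ x y : ℝ, (1 - p) / 2 ≤ x → p ≤ y →
      (1 - p) ^ 3 * p ^ 2 / 2 ≤ (1 - p) ^ 2 * p * (x * y) := by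
    intro x y hx hy
    have : (1 - p) / 2 * p ≤ x * y := mul_le_mul hx hy h0.1.le (by linarith)
    have := mul_le_mul_of_nonneg_left this (mul_nonneg (sq_nonneg (1 - p)) h0.1.le)
    nlinarith
  rcases le_total t t' with h | h
  · refine ⟨2, Or.inr rfl, fun u => ?_⟩
    rw [deadEnd, bern_pattern (f := rowInt p ρ) hρ.mem, edgesAt]
    repeat rw [Finset.prod_insert (by simp [hn, h3, hn', h3'])]
    rw [Finset.prod_singleton]
    simp [hK, sqRow, hn', h3]
    have := fin t' (1 - t) (by linarith) (by nlinarith [h1.1, h1.2, h2.1, h2.2])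
    convert this using 1
    ring
  · refine ⟨1, Or.inl rfl, fun u => ?_⟩
    rw [deadEnd, bern_pattern (f := rowInt p ρ) hρ.mem, edgesAt]
    repeat rw [Finset.prod_insert (by simp [hn, h3, hn', h3'])]
    rw [Finset.prod_singleton]
    simp [hK, sqRow, hn', h3]
    have := fin t (1 - t') (by linarith) (by nlinarith [h1.1, h1.2, h2.1, h2.2])
    convert this using 1
    ring

/-- A dead end is useless for connections between other vertices. -/
lemma Conn.of_deadEnd {ω : Config TriE} {u K : ℤ} {i : Fin 3} (h : ω ∈ deadEnd u K i) {R : Set Vx}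
    {z v w : Vx} (hz : src (u, K - 1, i) = z ∧ tgt (u, K - 1, i) = (u, K)) (hzR : z ∈ R)
    (hv : v ≠ (u, K)) (hw : w ≠ (u, K)) (hc : Conn ω R v w) : Conn (closeAt u K ω) R v w := by
  classical
  have hzc : z ≠ (u, K) := by
    rw [← hz.1]; unfold src
    intro hh; split_ifs at hh <;> simp at hh
  have := hc.map (ω' := closeAt u K ω) (R' := R) (fun x => if x = (u, K) then z else x) (by
    rintro x y hx hy ⟨e, he, hxy⟩
    by_cases hS : e ∈ edgesAt u K
    · have := h e hS
      rw [he, eq_comm, decide_eq_true_iff] at this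
      subst this
      rw [hz.1, hz.2] at hxy
      rcases hxy with ⟨rfl, rfl⟩ | ⟨rfl, rfl⟩
      · simp [hzc]; exact Conn.refl _
      · simp [hzc]; exact Conn.refl _
    · have hx' : x ≠ (u, K) := by
        rintro rfl; apply hS; rw [mem_edgesAt]; rcases hxy with h | h
        · exact Or.inl h.1
        · exact Or.inr h.2
      have hy' : y ≠ (u, K) := by
        rintro rfl; apply hS; rw [mem_edgesAt]; rcases hxy with h | h
        · exact Or.inr h.2
        · exact Or.inl h.1
      simp only [hx', hy', if_false]
      exact Conn.step ⟨e, by simp [closeAt, hS, he], hxy⟩ hx hy)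
  simpa [hv, hw] using this

lemma lossy {p : ℝ} {ρ : ℤ → ℝ × ℝ} (hρ : RowOK p ρ) {x0 x1 y0 K : ℤ} (hK : ρ K = sqRow p)
    (hy : y0 ≤ K - 1) :
    (1 - (1 - p) ^ 3 * p ^ 2 / 2) * (rowM p ρ).real (VC x0 x1 y0 (K + 1)) +
      (1 - p) ^ 3 * p ^ 2 / 2 * (rowM p ρ).real (VC x0 x1 y0 (K - 1)) ≤
      (rowM p ρ).real (VC (x0 - 1) (x1 + 1) y0 K) := by
  classical
  set ε := (1 - p) ^ 3 * p ^ 2 / 2 with hε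
  obtain ⟨i, hi, hO⟩ := deadEnd_prob hρ hK
  set s : ℤ := if i = 1 then 1 else 0 with hs
  have hsv : (i = 1 ∧ s = 1) ∨ (i = 2 ∧ s = 0) := by rcases hi with rfl | rfl <;> simp [hs]
  have hend : ∀ a : ℤ, src (a - s, K - 1, i) = (a, K - 1) ∧ tgt (a - s, K - 1, i) = (a - s, K) := by
    intro a; rcases hsv with ⟨h1, h2⟩ | ⟨h1, h2⟩ <;> simp [h1, h2, src, tgt]
  set μ := rowM p ρ with hμ
  set E1 := VC x0 x1 y0 (K + 1) with hE1
  set T := VC (x0 - 1) (x1 + 1) y0 K with hT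
  set W := VC x0 x1 y0 (K - 1) with hW
  have hET : E1 ⊆ T := VC_mono (by omega) le_rfl (by omega) (by omega) (by omega)
  have hEW : E1 ⊆ W := VC_mono (by omega) le_rfl (by omega) (by omega) (by omega)
  set R := Box x0 x1 y0 (K - 1) with hR
  have hRf : R.Finite := Box_finite _ _ _ _
  let P : ℤ → Vx → Vx → Prop := fun a u v => u = (a, K - 1) ∧ v.2 = y0 ∧ v ∈ R
  let L : ℤ → Set (Config TriE) := fun a => {ω | ω ∈ CE R (P a) ∧ ∀ a' < a, x0 ≤ a' → ω ∉ CE R (P a')}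
  let D : ℤ → Set (Config TriE) := fun a => {ω | closeAt (a - s) K ω ∉ E1}
  let S0 := (edgesIn_finite (Box_finite x0 x1 y0 (K + 1))).toFinset
  have hdep : ∀ a, ∀ ω ω' : Config TriE, (∀ e ∈ S0 \ edgesAt (a - s) K, ω e = ω' e) →
      ω ∈ L a ∩ D a → ω' ∈ L a ∩ D a := by
    rintro a ω ω' h ⟨⟨h1, h2⟩, h3⟩
    have hR' : ∀ e ∈ (edgesIn_finite hRf).toFinset, ω e = ω' e := by
      intro e he
      refine h e ?_
      simp only [Finite.mem_toFinset, edgesIn, mem_ofPred_eq] at he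
      rw [Finset.mem_sdiff, mem_edgesAt]
      refine ⟨?_, ?_⟩
      · simp only [S0, Finite.mem_toFinset, edgesIn, mem_ofPred_eq]
        refine ⟨⟨he.1.1, he.1.2.1, he.1.2.2.1, ?_⟩, ⟨he.2.1, he.2.2.1, he.2.2.2.1, ?_⟩⟩
        · linarith [he.1.2.2.2]
        · linarith [he.2.2.2.2]
      · rintro (h' | h')
        · have := he.1.2.2.2; rw [h'] at this; simp at this
        · have := he.2.2.2.2; rw [h'] at this; simp at this
    refine ⟨⟨CE_dep hRf _ _ _ hR' h1, fun a' h4 h5 h6 => h2 a' h4 h5 ?_⟩, fun h4 => h3 ?_⟩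
    · exact CE_dep hRf _ _ _ (fun e he => (hR' e he).symm) h6
    · refine CE_dep (Box_finite x0 x1 y0 (K + 1)) _ _ _ (fun e he => ?_) h4
      unfold closeAt
      split_ifs with hS
      · rfl
      · exact (h e (Finset.mem_sdiff.2 ⟨he, hS⟩)).symm
  have hfd : ∀ a, FD (L a ∩ D a) := fun a => ⟨_, hdep a⟩
  have hOdep : ∀ a, ∀ ω ω' : Config TriE, (∀ e ∈ edgesAt (a - s) K, ω e = ω' e) →
      ω ∈ deadEnd (a - s) K i → ω' ∈ deadEnd (a - s) K i := by
    intro a ω ω' h h1 e he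
    rw [← h e he]; exact h1 e he
  have hOfd : ∀ a, FD (deadEnd (a - s) K i) := fun a => ⟨_, hOdep a⟩
  have hcov : W \ E1 ⊆ ⋃ a ∈ Finset.Icc x0 x1, L a ∩ D a := by
    rintro ω ⟨⟨u, v, ⟨hu, hv, h1, h2⟩, hc⟩, hE⟩
    have hD : ∀ a, ω ∈ D a := fun a h => hE (VC_upper _ _ _ _ (closeAt_le _ _ _) h)
    have hex : ∃ n : ℕ, ω ∈ CE R (P (x0 + n)) := by
      refine ⟨(v.1 - x0).toNat, v, u, ⟨?_, h1, hu⟩, hc.symm⟩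
      have := hv.1
      ext <;> simp
      · omega
      · exact h2
    let n := Nat.find hex
    have hn := Nat.find_spec hex
    refine mem_biUnion (x := x0 + (n : ℤ)) ?_ ⟨⟨hn, fun a' h3 h4 h5 => ?_⟩, hD _⟩
    · obtain ⟨u', v', ⟨h3, h4, h5⟩, h6⟩ := hn
      have := h6.symm.mem h5
      rw [h3] at this
      have := mem_Box.1 this
      rw [Finset.coe_Icc]
      exact ⟨this.1, this.2.1⟩
    · refine Nat.find_min hex (m := (a' - x0).toNat) ?_ ?_
      · show _ < n
        omega
      · have : x0 + ((a' - x0).toNat : ℤ) = a' := by omega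
        rw [this]; exact h5
  have hsub : (⋃ a ∈ Finset.Icc x0 x1, deadEnd (a - s) K i ∩ (L a ∩ D a)) ⊆ T \ E1 := by
    intro ω hω
    simp only [mem_iUnion] at hω
    obtain ⟨a, ha, hd, ⟨⟨u, v, ⟨h1, h2, h3⟩, h4⟩, _⟩, hDa⟩ := hω
    rw [Finset.mem_Icc] at ha
    subst h1
    constructor
    · refine ⟨v, (a - s, K), ⟨?_, ?_, h2, rfl⟩, ?_⟩
      · exact ⟨by linarith [h3.1], by linarith [h3.2.1], h3.2.2.1, by linarith [h3.2.2.2]⟩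
      · rcases hsv with ⟨_, h⟩ | ⟨_, h⟩ <;> rw [h, mem_Box] <;> omega
      · refine (h4.symm.monoR ?_).trans (Conn.step ⟨_, ?_, Or.inl (hend a)⟩ ?_ ?_)
        · rintro x ⟨h5, h6, h7, h8⟩
          exact ⟨by omega, by omega, by omega, by omega⟩
        · have := hd (a - s, K - 1, i) (by rw [mem_edgesAt]; exact Or.inr (hend a).2)
          simpa using this
        · exact mem_Box.2 (by omega)
        · rcases hsv with ⟨_, h⟩ | ⟨_, h⟩ <;> rw [h, mem_Box] <;> omega
    · rintro ⟨u', v', ⟨hu', hv', h5, h6⟩, hc⟩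
      refine hDa ⟨u', v', ⟨hu', hv', h5, h6⟩, ?_⟩
      refine Conn.of_deadEnd hd (hend a) (mem_Box.2 (by omega)) ?_ ?_ hc
      · rintro rfl; simp at h5; omega
      · rintro rfl; simp at h6
  have hdisj : (↑(Finset.Icc x0 x1) : Set ℤ).PairwiseDisjoint
      fun a => deadEnd (a - s) K i ∩ (L a ∩ D a) := by
    intro a ha b hb hab
    rw [Finset.coe_Icc] at ha hb
    refine Set.disjoint_left.2 fun ω h1 h2 => ?_
    rcases lt_or_gt_of_ne hab with h | h
    · exact h2.2.1.2 a h ha.1 h1.2.1.1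
    · exact h1.2.1.2 b h hb.1 h2.2.1.1
  have h1 : μ.real (W \ E1) ≤ ∑ a ∈ Finset.Icc x0 x1, μ.real (L a ∩ D a) :=
    (measureReal_mono hcov (measure_ne_top _ _)).trans (measureReal_biUnion_finset_le _ _)
  have h2 : ∑ a ∈ Finset.Icc x0 x1, μ.real (deadEnd (a - s) K i ∩ (L a ∩ D a)) ≤ μ.real (T \ E1) := by
    rw [← measureReal_biUnion_finset hdisj
      (fun a _ => ((hOfd a).inter (hfd a)).measurableSet) (fun _ _ => measure_ne_top _ _)]
    exact measureReal_mono hsub (measure_ne_top _ _)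
  have h3 : ε * ∑ a ∈ Finset.Icc x0 x1, μ.real (L a ∩ D a) ≤
      ∑ a ∈ Finset.Icc x0 x1, μ.real (deadEnd (a - s) K i ∩ (L a ∩ D a)) := by
    rw [Finset.mul_sum]
    refine Finset.sum_le_sum fun a _ => ?_
    rw [hμ, bern_indep _ (Finset.disjoint_sdiff) (hOdep a) (hdep a)]
    exact mul_le_mul_of_nonneg_right (hO _) measureReal_nonneg
  have hε0 : 0 ≤ ε := by
    have := hρ.hp
    have h1 : 0 ≤ 1 - p := by linarith [this.2]
    positivity
  have h4 := measureReal_sdiff_add_inter (μ := μ) (s := T) (VC_FD x0 x1 y0 (K + 1)).measurableSet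
  have h5 := measureReal_sdiff_add_inter (μ := μ) (s := W) (VC_FD x0 x1 y0 (K + 1)).measurableSet
  rw [← hE1, inter_eq_self_of_subset_right hET] at h4
  rw [← hE1, inter_eq_self_of_subset_right hEW] at h5
  have := mul_le_mul_of_nonneg_left h1 hε0
  nlinarith

lemma rowOK_shift {p : ℝ} {ρ : ℤ → ℝ × ℝ} (hρ : RowOK p ρ) (y : ℤ) :
    RowOK p (fun b => ρ (b + y)) :=
  hρ.of_forall fun b => Or.inr ⟨b + y, rfl⟩

lemma rowOK_sq {p : ℝ} (hp : p ∈ Ioo (0:ℝ) 1) : RowOK p (fun _ => sqRow p) where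
  hp := hp
  hq := fun n => by simp [sqRow]
  hq' := fun n => by simp [sqRow, hp.1.le, hp.2.le]
  hk := fun n => kappa_sqRow

/-- `a` square rows, followed by `b` rows taken from `ρ`. -/
def mixRow (p : ℝ) (ρ : ℤ → ℝ × ℝ) (a b : ℕ) : ℤ → ℝ × ℝ := fun n =>
  if (a : ℤ) ≤ n ∧ n < a + b then ρ (n - a) else sqRow p

lemma mixRow_ok {p : ℝ} {ρ : ℤ → ℝ × ℝ} (hρ : RowOK p ρ) (a b : ℕ) : RowOK p (mixRow p ρ a b) :=
  hρ.of_forall fun n => by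
    unfold mixRow
    split_ifs
    · exact Or.inr ⟨_, rfl⟩
    · exact Or.inl rfl

lemma moveRow_mixRow (p : ℝ) (ρ : ℤ → ℝ × ℝ) (a b : ℕ) :
    moveRow p (mixRow p ρ (a + 1) (b + 1)) a (a + b + 1) = mixRow p ρ a (b + 1) := by
  funext n
  unfold moveRow mixRow
  push_cast
  split_ifs <;> first | rfl | (congr 1; ring1) | (exfalso; omega)

lemma mixRow_step {p : ℝ} {ρ : ℤ → ℝ × ℝ} (hρ : RowOK p ρ) (x0 x1 : ℤ) (a b w : ℕ) :
    (1 - (1 - p) ^ 3 * p ^ 2 / 2) *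
        (rowM p (mixRow p ρ (a + 1) (b + 1))).real (VC (x0 - w) (x1 + w) 0 (a + b + 2)) +
      (1 - p) ^ 3 * p ^ 2 / 2 * (rowM p (mixRow p ρ a b)).real (VC (x0 - w) (x1 + w) 0 (a + b)) ≤
      (rowM p (mixRow p ρ a (b + 1))).real
        (VC (x0 - (w + 2 : ℕ)) (x1 + (w + 2 : ℕ)) 0 (a + b + 1)) := by
  have hp := hρ.hp
  have hp1 : 0 ≤ 1 - p := by linarith [hp.2]
  have hp2 : (1 - p) ^ 3 ≤ 1 := pow_le_one₀ hp1 (by linarith [hp.1])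
  have hp3 : p ^ 2 ≤ 1 := pow_le_one₀ hp.1.le hp.2.le
  have hε0 : 0 ≤ (1 - p) ^ 3 * p ^ 2 / 2 := by positivity
  have hε1 : 0 ≤ 1 - (1 - p) ^ 3 * p ^ 2 / 2 := by
    have : (1 - p) ^ 3 * p ^ 2 ≤ 1 := mul_le_one₀ hp2 (by positivity) hp3
    linarith
  have h1 := sweep_le (mixRow_ok hρ (a + 1) (b + 1)) (i := a) (n := a + b + 1)
    (x0 := x0 - w) (x1 := x1 + w) (y0 := 0) (y1 := a + b + 2)
    (by unfold mixRow; rw [if_neg]; push_cast; omega) (by omega) (by omega) (by omega)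
  rw [moveRow_mixRow] at h1
  have h2 := lossy (mixRow_ok hρ a (b + 1)) (x0 := x0 - w - 1) (x1 := x1 + w + 1) (y0 := 0)
    (K := a + b + 1) (by unfold mixRow; rw [if_neg]; push_cast; omega) (by omega)
  have h3 : (rowM p (mixRow p ρ a b)).real (VC (x0 - w) (x1 + w) 0 (a + b)) ≤
      (rowM p (mixRow p ρ a (b + 1))).real (VC (x0 - w - 1) (x1 + w + 1) 0 (a + b + 1 - 1)) := by
    rw [show (a + b + 1 - 1 : ℤ) = a + b by ring,
      rowM_VC_congr (ρ' := mixRow p ρ a (b + 1)) (fun n h4 h5 => ?_)]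
    · exact measureReal_mono (VC_mono (by omega) le_rfl le_rfl (by omega) (by omega))
    · unfold mixRow
      push_cast
      split_ifs <;> first | rfl | (exfalso; omega)
  have e1 : (x0 - (w + 2 : ℕ) : ℤ) = x0 - w - 1 - 1 := by push_cast; ring
  have e2 : (x1 + (w + 2 : ℕ) : ℤ) = x1 + w + 1 + 1 := by push_cast; ring
  rw [e1, e2]
  refine le_trans ?_ h2
  rw [show (a + b + 1 + 1 : ℤ) = a + b + 2 by ring]
  exact add_le_add (mul_le_mul_of_nonneg_left h1 hε1) (mul_le_mul_of_nonneg_left h3 hε0)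

lemma mixRow_ge {p : ℝ} {ρ : ℤ → ℝ × ℝ} (hρ : RowOK p ρ) (x0 x1 : ℤ) {z : ℝ}
    (hz : z = 1 - (1 - p) ^ 3 * p ^ 2 / 2 / 2) (b d a : ℕ) :
    (rowM p fun _ => sqRow p).real (VC x0 x1 0 ((a + d : ℕ) : ℤ)) * (1 - 2 ^ b * z ^ d) ≤
      (rowM p (mixRow p ρ a b)).real
        (VC (x0 - (2 * (d + b) : ℕ)) (x1 + (2 * (d + b) : ℕ)) 0 ((a + b : ℕ) : ℤ)) := by
  have hp := hρ.hp
  have hp1 : 0 ≤ 1 - p := by linarith [hp.2]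
  have hp2 : (1 - p) ^ 3 ≤ 1 := pow_le_one₀ hp1 (by linarith [hp.1])
  have hp3 : p ^ 2 ≤ 1 := pow_le_one₀ hp.1.le hp.2.le
  set ε := (1 - p) ^ 3 * p ^ 2 / 2 with hε
  have hε0 : 0 ≤ ε := by positivity
  have hε1 : ε ≤ 1 / 2 := by
    have : (1 - p) ^ 3 * p ^ 2 ≤ 1 := mul_le_one₀ hp2 (by positivity) hp3
    rw [hε]; linarith
  have hz0 : 0 ≤ z := by rw [hz]; linarith
  have hz1 : z ≤ 1 := by rw [hz]; linarith
  induction b generalizing d a with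
  | zero =>
    have h0 : (0:ℝ) ≤ (rowM p fun _ => sqRow p).real (VC x0 x1 0 ((a + d : ℕ) : ℤ)) :=
      measureReal_nonneg
    have h1 : (rowM p fun _ => sqRow p).real (VC x0 x1 0 ((a + d : ℕ) : ℤ)) * (1 - 2 ^ 0 * z ^ d) ≤
        (rowM p fun _ => sqRow p).real (VC x0 x1 0 ((a + d : ℕ) : ℤ)) :=
      mul_le_of_le_one_right h0 (by have := pow_nonneg hz0 d; linarith)
    refine h1.trans ?_
    rw [rowM_VC_congr (ρ' := mixRow p ρ a 0) (fun n h4 h5 => ?_)]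
    · exact measureReal_mono (VC_mono (by omega) le_rfl (by push_cast; omega) (by push_cast; omega)
        (by push_cast; omega))
    · unfold mixRow
      rw [if_neg]; push_cast; omega
  | succ b ihb =>
    induction d generalizing a with
    | zero =>
      refine le_trans ?_ measureReal_nonneg
      refine mul_nonpos_of_nonneg_of_nonpos measureReal_nonneg ?_
      have : (1:ℝ) ≤ 2 ^ (b + 1) := one_le_pow₀ (by norm_num)
      simpa using this
    | succ d ihd =>
      have h1 := ihd (a + 1)
      have h2 := ihb (d + 1) a
      have h3 := mixRow_step hρ x0 x1 a b (2 * (d + b + 1))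
      rw [← hε] at h3
      have e1 : ((a + 1 + (b + 1) : ℕ) : ℤ) = a + b + 2 := by push_cast; ring
      have e2 : ((a + (b + 1) : ℕ) : ℤ) = a + b + 1 := by push_cast; ring
      have e3 : ((a + b : ℕ) : ℤ) = a + b := by push_cast; ring
      have e4 : 2 * (d + 1 + b) = 2 * (d + b + 1) := by ring
      have e5 : 2 * (d + (b + 1)) = 2 * (d + b + 1) := by ring
      have e6 : 2 * (d + 1 + (b + 1)) = 2 * (d + b + 1) + 2 := by ring
      have e7 : a + 1 + d = a + (d + 1) := by ring
      rw [e1, e5, e7] at h1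
      rw [e3, e4] at h2
      rw [e2, e6]
      refine le_trans ?_ h3
      set θ := (rowM p fun _ => sqRow p).real (VC x0 x1 0 ((a + (d + 1) : ℕ) : ℤ))
      have hθ : 0 ≤ θ := measureReal_nonneg
      have h4 := mul_le_mul_of_nonneg_left h1 (show 0 ≤ 1 - ε by linarith)
      have h5 := mul_le_mul_of_nonneg_left h2 hε0
      refine le_trans ?_ (add_le_add h4 h5)
      have h6 : 0 ≤ θ * 2 ^ b * z ^ d := by positivity
      have h7 : 0 ≤ 2 * z - (2 * (1 - ε) + ε * z) := by rw [hz]; nlinarith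
      have h8 := mul_nonneg h6 h7
      rw [pow_succ, pow_succ]
      nlinarith

/-- Comparison of vertical crossing probabilities, up to linear changes of scale. -/
def Cmp (μ ν : Measure (Config TriE)) : Prop :=
  ∃ m : ℕ, 1 ≤ m ∧ ∃ c : ℕ, ∀ ε : ℝ, 0 < ε → ∃ k0 : ℕ, ∀ k : ℕ, k0 ≤ k → ∀ x0 x1 y y' : ℤ,
    μ.real (VC x0 x1 y (y + m * k)) ≤ ν.real (VC (x0 - c * k) (x1 + c * k) y' (y' + k)) + ε

lemma cmp_to_sq {p : ℝ} {ρ : ℤ → ℝ × ℝ} (hρ : RowOK p ρ) :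
    Cmp (rowM p ρ) (rowM p fun _ => sqRow p) := by
  refine ⟨1, le_rfl, 1, fun ε hε => ⟨0, fun k _ x0 x1 y y' => ?_⟩⟩
  have h1 := rowM_le_sq hρ x0 x1 y k
  have h2 := rowM_VC_shift p (fun _ => sqRow p) (x0 - k) (x1 + k) y (y + k) 0 (y' - y)
  simp only [add_zero, add_sub_cancel] at h2
  rw [show y + k + (y' - y) = y' + k by ring] at h2
  simp only [Nat.cast_one, one_mul]
  rw [h2]
  linarith

lemma cmp_of_sq {p : ℝ} {ρ : ℤ → ℝ × ℝ} (hρ : RowOK p ρ) :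
    Cmp (rowM p fun _ => sqRow p) (rowM p ρ) := by
  have hp := hρ.hp
  have hp1 : 0 < 1 - p := by linarith [hp.2]
  have hp2 : (1 - p) ^ 3 ≤ 1 := pow_le_one₀ hp1.le (by linarith [hp.1])
  have hp3 : p ^ 2 ≤ 1 := pow_le_one₀ hp.1.le hp.2.le
  have hp0 := hp.1
  obtain ⟨z, hz⟩ : ∃ z, z = 1 - (1 - p) ^ 3 * p ^ 2 / 2 / 2 := ⟨_, rfl⟩
  have hz1 : z < 1 := by
    rw [hz]; have : 0 < (1 - p) ^ 3 * p ^ 2 / 2 / 2 := by positivity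
    linarith
  have hz0 : 0 ≤ z := by
    have : (1 - p) ^ 3 * p ^ 2 ≤ 1 := mul_le_one₀ hp2 (by positivity) hp3
    rw [hz]; linarith
  obtain ⟨m, hm⟩ := exists_pow_lt_of_lt_one (show (0:ℝ) < 1 / 4 by norm_num) hz1
  have hm1 : 1 ≤ m := by
    rcases Nat.eq_zero_or_pos m with rfl | h
    · norm_num at hm
    · exact h
  refine ⟨m, hm1, 2 * (m + 1), fun ε hε => ?_⟩
  obtain ⟨k0, hk0⟩ := exists_pow_lt_of_lt_one hε (show (1:ℝ) / 2 < 1 by norm_num)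
  refine ⟨k0, fun k hk x0 x1 y y' => ?_⟩
  have h1 := mixRow_ge (rowOK_shift hρ y') x0 x1 hz k (m * k) 0
  have h2 := rowM_VC_shift p (fun _ => sqRow p) x0 x1 0 (m * k) 0 y
  have h3 := rowM_VC_shift p ρ (x0 - (2 * (m + 1) : ℕ) * k) (x1 + (2 * (m + 1) : ℕ) * k) 0 k 0 y'
  simp only [add_zero, zero_add] at h2 h3
  rw [add_comm y, h2, add_comm y', h3]
  rw [rowM_VC_congr (ρ := mixRow p _ 0 k) (ρ' := fun b => ρ (b + y')) (fun n h4 h5 => ?_)] at h1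
  · simp only [zero_add] at h1
    have e : ((2 * (m * k + k) : ℕ) : ℤ) = (2 * (m + 1) : ℕ) * k := by push_cast; ring
    rw [e] at h1
    have h6 : (2:ℝ) ^ k * z ^ (m * k) ≤ ε := by
      rw [pow_mul, ← mul_pow]
      refine le_trans (pow_le_pow_left₀ (by positivity) (show 2 * z ^ m ≤ 1 / 2 by linarith) k) ?_
      exact (pow_le_pow_of_le_one (by norm_num) (by norm_num) hk).trans hk0.le
    have h7 : (rowM p fun _ => sqRow p).real (VC x0 x1 0 ((m * k : ℕ) : ℤ)) ≤ 1 :=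
      measureReal_le_one
    have h8 : (0:ℝ) ≤ (rowM p fun _ => sqRow p).real (VC x0 x1 0 ((m * k : ℕ) : ℤ)) :=
      measureReal_nonneg
    push_cast at h1 h6 h7 h8 ⊢
    have h9 : (0:ℝ) ≤ 2 ^ k * z ^ (m * k) := by positivity
    nlinarith
  · unfold mixRow
    rw [if_pos]
    · simp
    · push_cast at h5 ⊢; omega

lemma VC_stack {ω : Config TriE} {x0 x1 y0 y1 y2 y3 : ℤ} (h01 : y0 ≤ y1) (h23 : y2 ≤ y3)
    (h1 : ω ∈ VC x0 x1 y0 y2) (h2 : ω ∈ HC x0 x1 y1 y2) (h3 : ω ∈ VC x0 x1 y1 y3) :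
    ω ∈ VC x0 x1 y0 y3 := by
  obtain ⟨u1, v1, ⟨hu1, hv1, a1, b1⟩, c1⟩ := h1
  obtain ⟨s, t, ⟨hs, ht, a2, b2⟩, c2⟩ := h2
  obtain ⟨u3, v3, ⟨hu3, hv3, a3, b3⟩, c3⟩ := h3
  obtain ⟨z1, hz1, d1, e1⟩ := cross_meet c1 hu1 (by omega) b1.ge (fun z hz => ⟨hz.1, hz.2.1⟩)
    c2 hs a2.le b2.ge (fun z hz => ⟨hz.2.2.1, hz.2.2.2⟩)
  obtain ⟨z2, hz2, d2, e2⟩ := cross_meet c3 hu3 a3.le (by omega) (fun z hz => ⟨hz.1, hz.2.1⟩)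
    c2 hs a2.le b2.ge (fun z hz => ⟨hz.2.2.1, hz.2.2.2⟩)
  have s1 : Box x0 x1 y0 y2 ⊆ Box x0 x1 y0 y3 := fun z ⟨p1, p2, p3, p4⟩ => ⟨p1, p2, p3, by omega⟩
  have s2 : Box x0 x1 y1 y2 ⊆ Box x0 x1 y0 y3 :=
    fun z ⟨p1, p2, p3, p4⟩ => ⟨p1, p2, by omega, by omega⟩
  have s3 : Box x0 x1 y1 y3 ⊆ Box x0 x1 y0 y3 := fun z ⟨p1, p2, p3, p4⟩ => ⟨p1, p2, by omega, p4⟩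
  exact ⟨u1, v3, ⟨s1 hu1, s3 hv3, a1, b3⟩, (d1.monoR s1).trans <| (e1.symm.monoR s2).trans <|
    (e2.monoR s2).trans <| (d2.symm.monoR s3).trans (c3.monoR s3)⟩

lemma VC_overlap {f : TriE → ℝ} {δ : ℝ} (hδ : 0 ≤ δ) {x0 x1 : ℤ} {h g : ℕ}
    (hV : ∀ y, δ ≤ (bern f).real (VC x0 x1 y (y + h + g)))
    (hH : ∀ y, δ ≤ (bern f).real (HC x0 x1 y (y + h))) (j : ℕ) (y : ℤ) :
    δ ^ (2 * j + 1) ≤ (bern f).real (VC x0 x1 y (y + g * j + h + g)) := by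
  induction j with
  | zero => simpa using hV y
  | succ j ih =>
    have h1 := hH (y + g * j + g)
    have h2 := hV (y + g * j + g)
    have f1 := bern_fkg f (VC_upper x0 x1 y (y + g * j + h + g))
      (HC_upper x0 x1 (y + g * j + g) (y + g * j + g + h)) (VC_FD _ _ _ _) (HC_FD _ _ _ _)
    have f2 := bern_fkg f ((VC_upper x0 x1 y (y + g * j + h + g)).inter
      (HC_upper x0 x1 (y + g * j + g) (y + g * j + g + h)))
      (VC_upper x0 x1 (y + g * j + g) (y + g * j + g + h + g))
      ((VC_FD _ _ _ _).inter (HC_FD _ _ _ _)) (VC_FD _ _ _ _)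
    have e1 : 2 * (j + 1) + 1 = 2 * j + 1 + 1 + 1 := by ring
    rw [e1, pow_succ, pow_succ]
    refine ((mul_le_mul ((mul_le_mul ih h1 hδ measureReal_nonneg).trans f1) h2 hδ
      measureReal_nonneg).trans f2).trans (measureReal_mono ?_)
    rintro ω ⟨⟨g1, g2⟩, g3⟩
    have e2 : y + g * (j + 1 : ℕ) + h + g = y + g * j + g + h + g := by push_cast; ring
    rw [show y + (g:ℤ) * j + g + h = y + g * j + h + g by ring] at g2
    rw [e2]
    refine VC_stack ?_ (by omega) g1 g2 g3
    nlinarith [(Nat.cast_nonneg j : (0:ℤ) ≤ j), (Nat.cast_nonneg g : (0:ℤ) ≤ g)]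

lemma VC_long {f : TriE → ℝ} {δ : ℝ} (hδ : 0 ≤ δ) {x0 x1 : ℤ} {h : ℕ}
    (hV : ∀ y, δ ≤ (bern f).real (VC x0 x1 y (y + 3 * h)))
    (hH : ∀ y, δ ≤ (bern f).real (HC x0 x1 y (y + h))) (j : ℕ) (y : ℤ) :
    δ ^ (2 * j + 1) ≤ (bern f).real (VC x0 x1 y (y + 2 * h * j + 3 * h)) := by
  have key := VC_overlap (g := 2 * h) hδ (fun y => ?_) hH j y
  · rwa [show y + ((2 * h : ℕ) : ℤ) * j + h + (2 * h : ℕ) = y + 2 * h * j + 3 * h by push_cast; ring]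
      at key
  · rw [show y + (h : ℤ) + (2 * h : ℕ) = y + 3 * h by push_cast; ring]
    exact hV y

/-- Crossings of rectangles of aspect ratio three have probability bounded below. -/
def Good (f : TriE → ℝ) : Prop :=
  ∃ δ : ℝ, 0 < δ ∧ ∃ n0 : ℕ, ∀ n : ℕ, n0 ≤ n → ∀ x y : ℤ,
    δ ≤ (bern f).real (HC (x - 3 * n) (x + 3 * n) (y - n) (y + n)) ∧
    δ ≤ (bern f).real (VC (x - n) (x + n) (y - 3 * n) (y + 3 * n))

/-- Transposition of intensities. -/
def tpF (f : TriE → ℝ) : TriE → ℝ := fun e => f (e.2.1, e.1, 2 - e.2.2)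

lemma tpF_VC (f : TriE → ℝ) (x0 x1 y0 y1 : ℤ) :
    (bern (tpF f)).real (VC x0 x1 y0 y1) = (bern f).real (HC y0 y1 x0 x1) := by
  unfold tpF
  rw [← bern_tpC f (VC_FD x0 x1 y0 y1)]
  congr 1; ext ω; exact tpC_mem_VC

lemma tpF_HC (f : TriE → ℝ) (x0 x1 y0 y1 : ℤ) :
    (bern (tpF f)).real (HC x0 x1 y0 y1) = (bern f).real (VC y0 y1 x0 x1) := by
  unfold tpF
  rw [← bern_tpC f (HC_FD x0 x1 y0 y1)]
  congr 1; ext ω; exact tpC_mem_HC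

lemma Good.tp {f : TriE → ℝ} (h : Good f) : Good (tpF f) := by
  obtain ⟨δ, hδ, n0, h⟩ := h
  refine ⟨δ, hδ, n0, fun n hn x y => ?_⟩
  rw [tpF_VC, tpF_HC]
  exact (h n hn y x).symm

lemma Good.tall {f : TriE → ℝ} (hf : Good f) (A : ℕ) : ∃ δ : ℝ, 0 < δ ∧ ∃ k0 : ℕ, ∀ k : ℕ, k0 ≤ k →
    ∀ x y : ℤ, δ ≤ (bern f).real (VC x (x + k) y (y + A * k)) := by
  obtain ⟨δ, hδ, n0, h⟩ := hf
  refine ⟨δ ^ (2 * A + 1), pow_pos hδ _, 2 * n0 + 2, fun k hk x y => ?_⟩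
  obtain ⟨n, hn⟩ : ∃ n, n = k / 2 := ⟨_, rfl⟩
  have h1 := VC_long (f := f) (δ := δ) hδ.le (x0 := x) (x1 := x + 2 * n) (h := 2 * n) (fun y => by
      have := (h n (by omega) (x + n) (y + 3 * n)).2
      refine this.trans (measureReal_mono (VC_mono ?_ ?_ ?_ ?_ ?_)) <;> push_cast <;> omega)
    (fun y => by
      have := (h n (by omega) (x + n) (y + n)).1
      refine this.trans (measureReal_mono (HC_mono ?_ ?_ ?_ ?_ ?_)) <;> push_cast <;> omega) A y
  refine h1.trans (measureReal_mono (VC_mono ?_ le_rfl ?_ le_rfl (by omega)))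
  · have : (0:ℤ) ≤ A * k := by positivity
    omega
  · have e : (k:ℤ) ≤ 2 * n + 1 := by omega
    have : (1:ℤ) ≤ n := by omega
    have hA : (0:ℤ) ≤ A := by positivity
    push_cast
    nlinarith [mul_le_mul_of_nonneg_left e hA, mul_le_mul_of_nonneg_left this hA]

lemma Good.wide {f : TriE → ℝ} (hf : Good f) (A : ℕ) : ∃ δ : ℝ, 0 < δ ∧ ∃ k0 : ℕ, ∀ k : ℕ, k0 ≤ k →
    ∀ x y : ℤ, δ ≤ (bern f).real (HC x (x + A * k) y (y + k)) := by
  obtain ⟨δ, hδ, k0, h⟩ := hf.tp.tall A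
  refine ⟨δ, hδ, k0, fun k hk x y => ?_⟩
  have := h k hk y x
  rwa [tpF_VC] at this

/-- Transfer of the crossing estimates between comparable self-dual measures. -/
lemma Good.transfer {p p' : ℝ} {ρ ρ' : ℤ → ℝ × ℝ} (hρ : RowOK p ρ) (hρ' : RowOK p' ρ')
    (h1 : Cmp (rowM p ρ) (rowM p' ρ')) (h2 : Cmp (rowM p' ρ') (rowM p ρ))
    (hG : Good (rowInt p ρ)) : Good (rowInt p' ρ') := by
  obtain ⟨m1, hm1, c1, h1⟩ := h1
  obtain ⟨m2, hm2, c2, h2⟩ := h2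
  have V : ∃ δ : ℝ, 0 < δ ∧ ∃ k0 : ℕ, ∀ k : ℕ, k0 ≤ k → ∀ x y : ℤ,
      δ ≤ (rowM p' ρ').real (VC x (x + (2 * c1 + 1 : ℕ) * k) y (y + k)) := by
    obtain ⟨δ, hδ, ka, ha⟩ := hG.tall m1
    obtain ⟨kb, hb⟩ := h1 (δ / 2) (by linarith)
    refine ⟨δ / 2, by linarith, max ka kb, fun k hk x y => ?_⟩
    have e1 := ha k (by omega) (x + c1 * k) 0
    have e2 := hb k (by omega) (x + c1 * k) (x + c1 * k + k) 0 y
    rw [show x + (c1:ℤ) * k - c1 * k = x by ring, show x + (c1:ℤ) * k + k + c1 * k =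
      x + (2 * c1 + 1 : ℕ) * k by push_cast; ring] at e2
    linarith
  have H : ∀ A : ℕ, ∃ δ : ℝ, 0 < δ ∧ ∃ k0 : ℕ, ∀ k : ℕ, k0 ≤ k → ∀ x y : ℤ,
      δ ≤ (rowM p' ρ').real (HC x (x + A * k) y (y + m2 * k)) := by
    intro A
    obtain ⟨δ, hδ, ka, ha⟩ := hG.wide (2 * (A + 1 + 2 * c2))
    obtain ⟨kb, hb⟩ := h2 (δ / 2) (by linarith)
    refine ⟨δ / 2, by linarith, ka + kb + 2, fun k hk x y => ?_⟩
    have hAk : (0:ℤ) ≤ A * k := by positivity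
    have hmk : (0:ℤ) ≤ m2 * k := by positivity
    have e1 := VC_add_HC_ge hρ' (x0 := x + 1) (x1 := x + A * k + 1) (y0 := y) (y1 := y + m2 * k)
      (by omega) (by omega)
    rw [add_sub_cancel_right, add_sub_cancel_right] at e1
    have e2 := hb k (by omega) (x + 1) (x + A * k + 1) y 0
    have e3 := VC_add_HC_le hρ (x + 1 - c2 * k) (x + A * k + 1 + c2 * k) 0 (0 + k)
    have e4 := ha (k - 1) (by omega) (x - c2 * k) 1
    have e5 : (rowM p ρ).real (HC (x - c2 * k) (x - c2 * k + (2 * (A + 1 + 2 * c2) : ℕ) * (k - 1 : ℕ)) 1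
        (1 + (k - 1 : ℕ))) ≤ (rowM p ρ).real
        (HC (x + 1 - c2 * k - 1) (x + A * k + 1 + c2 * k) (0 + 1) (0 + k)) := by
      have hc : (0:ℤ) ≤ c2 * k := by positivity
      refine measureReal_mono (HC_mono (by omega) (by omega) ?_ (by omega) (by omega))
      obtain ⟨k', rfl⟩ : ∃ k', k = k' + 2 := ⟨k - 2, by omega⟩
      have : k' + 2 - 1 = k' + 1 := by omega
      rw [this]
      push_cast
      nlinarith [(Nat.cast_nonneg k' : (0:ℤ) ≤ k'), (by positivity : (0:ℤ) ≤ A * k'),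
        (by positivity : (0:ℤ) ≤ c2 * k')]
    change 1 ≤ (rowM p' ρ').real _ + (rowM p' ρ').real _ at e1
    change (rowM p ρ).real _ + (rowM p ρ).real _ ≤ 1 at e3
    change _ ≤ (rowM p ρ).real _ at e4
    linarith
  obtain ⟨δ1, hδ1, k1, V⟩ := V
  obtain ⟨C, hC⟩ : ∃ C, C = 2 * c1 + 1 := ⟨_, rfl⟩
  rw [← hC] at V
  obtain ⟨δ2, hδ2, k2, H⟩ := H (48 * C * m2)
  have hC1 : 1 ≤ C := by omega
  set δ := min δ1 δ2 with hδ
  have hδ0 : 0 < δ := lt_min hδ1 hδ2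
  refine ⟨min δ (δ ^ (2 * (12 * C) + 1)), lt_min hδ0 (pow_pos hδ0 _),
    2 * C * (m2 * (k2 + 1) + k1 + 1), fun n hn x y => ?_⟩
  obtain ⟨h, hh⟩ : ∃ h, h = n / (2 * C) := ⟨_, rfl⟩
  have hh1 : 2 * C * h ≤ n := by rw [hh]; exact Nat.mul_div_le _ _
  have hh2 : n < 2 * C * (h + 1) := by rw [hh]; exact Nat.lt_mul_div_succ _ (by omega)
  have hh3 : m2 * (k2 + 1) + k1 + 1 ≤ h := by
    rw [hh]; exact (Nat.le_div_iff_mul_le (by omega)).2 (by rw [mul_comm]; exact hn)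
  obtain ⟨k, hk⟩ : ∃ k, k = h / m2 := ⟨_, rfl⟩
  have hk1 : m2 * k ≤ h := by rw [hk]; exact Nat.mul_div_le _ _
  have hk2 : h < m2 * (k + 1) := by rw [hk]; exact Nat.lt_mul_div_succ _ (by omega)
  have hk3 : k2 + 1 ≤ k := by
    rw [hk]; exact (Nat.le_div_iff_mul_le (by omega)).2 (by rw [mul_comm]; omega)
  have hhn : h ≤ n := le_trans (by nlinarith) hh1
  have hn4 : n ≤ 4 * C * h := by
    have : C * 1 ≤ C * h := Nat.mul_le_mul_left _ (by omega)
    nlinarith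
  have hw : 6 * n ≤ 48 * C * m2 * k := by
    have : h ≤ 2 * m2 * k := by nlinarith
    calc 6 * n ≤ 6 * (4 * C * h) := by omega
      _ ≤ 6 * (4 * C * (2 * m2 * k)) := by gcongr
      _ = _ := by ring
  have hw' : (6 * n : ℤ) ≤ (48 * C * m2 : ℕ) * k := by exact_mod_cast hw
  have hk1' : (m2 : ℤ) * k ≤ h := by exact_mod_cast hk1
  have hhn' : (h:ℤ) ≤ n := by exact_mod_cast hhn
  have HH : ∀ x y, δ ≤ (rowM p' ρ').real (HC x (x + 6 * n) y (y + h)) := fun x y =>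
    ((min_le_right _ _).trans (H k (by omega) x y)).trans
      (measureReal_mono (HC_mono (by omega) le_rfl (by omega) le_rfl (by omega)))
  constructor
  · refine (min_le_left _ _).trans ((HH (x - 3 * n) (y - n)).trans
      (measureReal_mono (HC_mono ?_ ?_ ?_ ?_ ?_))) <;> omega
  · refine (min_le_right _ _).trans ((VC_long hδ0.le (x0 := x - n) (x1 := x + n) (h := h)
      (fun y => ?_) (fun y => ?_) (12 * C) (y - 3 * n)).trans (measureReal_mono (VC_mono ?_ ?_ ?_ ?_ ?_)))
    · refine ((min_le_left _ _).trans (V (3 * h) (by omega) (x - n) y)).trans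
        (measureReal_mono (VC_mono ?_ ?_ ?_ ?_ ?_)) <;> push_cast
      · omega
      · omega
      · omega
      · omega
      · have : (2 * C * h : ℤ) ≤ n := by exact_mod_cast hh1
        nlinarith
    · refine (HH (x - n) y).trans (measureReal_mono (HC_mono ?_ ?_ ?_ ?_ ?_)) <;> omega
    · omega
    · omega
    · have : (n : ℤ) ≤ 4 * C * h := by exact_mod_cast hn4
      push_cast
      nlinarith
    · omega
    · omega

/-- The unit squares of `[0,n]²` that are reached from the left side through closed edges. -/
inductive Zr (n : ℤ) (ω : Config TriE) : Vx → Prop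
  | start (b : ℤ) : 0 ≤ b → b < n → ω (0, b, 2) = false → 0 < n → Zr n ω (0, b)
  | right (a b : ℤ) : Zr n ω (a, b) → ω (a + 1, b, 2) = false → a + 1 < n → Zr n ω (a + 1, b)
  | left (a b : ℤ) : Zr n ω (a, b) → ω (a, b, 2) = false → 0 < a → Zr n ω (a - 1, b)
  | up (a b : ℤ) : Zr n ω (a, b) → ω (a, b + 1, 0) = false → b + 1 < n → Zr n ω (a, b + 1)
  | down (a b : ℤ) : Zr n ω (a, b) → ω (a, b, 0) = false → 0 < b → Zr n ω (a, b - 1)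

/-- The set of squares reached from the left. -/
def ZS (n : ℤ) (ω : Config TriE) : Set Vx := {s | Zr n ω s}

lemma Zr.mem {n : ℤ} {ω : Config TriE} {s : Vx} (h : Zr n ω s) : s ∈ Box 0 (n - 1) 0 (n - 1) := by
  induction h <;> rw [mem_Box] at * <;> omega

/-- The left side together with the edges of a set of squares. -/
def bdE (n : ℤ) (z : Set Vx) : Set TriE :=
  {e | (e.2.2 = 2 ∧ e.1 = 0 ∧ 0 ≤ e.2.1 ∧ e.2.1 < n) ∨ ∃ a b, (a, b) ∈ z ∧
    (e = (a, b, 0) ∨ e = (a, b + 1, 0) ∨ e = (a, b, 2) ∨ e = (a + 1, b, 2))}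

/-- The endpoints of `bdE`. -/
def bdV (n : ℤ) (z : Set Vx) : Set Vx := {v | ∃ e ∈ bdE n z, v = src e ∨ v = tgt e}

lemma bdE_left {n b : ℤ} (z : Set Vx) (h : 0 ≤ b) (h' : b < n) : ((0, b, 2) : TriE) ∈ bdE n z :=
  Or.inl ⟨rfl, rfl, h, h'⟩

lemma bdE_face {n a b : ℤ} {z : Set Vx} (h : (a, b) ∈ z) :
    ((a, b, 0) : TriE) ∈ bdE n z ∧ ((a, b + 1, 0) : TriE) ∈ bdE n z ∧
    ((a, b, 2) : TriE) ∈ bdE n z ∧ ((a + 1, b, 2) : TriE) ∈ bdE n z :=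
  ⟨Or.inr ⟨a, b, h, by simp⟩, Or.inr ⟨a, b, h, by simp⟩, Or.inr ⟨a, b, h, by simp⟩,
    Or.inr ⟨a, b, h, by simp⟩⟩

lemma bdV_subset {n : ℤ} {z : Set Vx} (hz : z ⊆ Box 0 (n - 1) 0 (n - 1)) :
    bdV n z ⊆ Box 0 n 0 n := by
  rintro v ⟨⟨x, y, i⟩, he, hv⟩
  rcases he with ⟨h1, h2, h3, h4⟩ | ⟨a, b, hab, he⟩
  · simp at h1 h2 h3 h4
    subst h1 h2
    rcases hv with rfl | rfl <;> simp [src, tgt, mem_Box] <;> omega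
  · have := hz hab
    rw [mem_Box] at this
    rcases he with he | he | he | he <;> (simp only [Prod.mk.injEq] at he; obtain ⟨rfl, rfl, rfl⟩ := he)
      <;> rcases hv with rfl | rfl <;> simp [src, tgt, mem_Box] <;> omega

lemma ZS_congr {n : ℤ} {ω ω' : Config TriE} (h : ∀ e ∈ bdE n (ZS n ω), ω e = ω' e) :
    ZS n ω' = ZS n ω := by
  apply subset_antisymm
  · intro s hs
    change Zr n ω' s at hs
    change Zr n ω s
    induction hs with
    | start b h1 h2 h3 h4 => exact .start b h1 h2 ((h _ (bdE_left _ h1 h2)).trans h3) h4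
    | right a b _ h2 h3 ih => exact .right a b ih ((h _ (bdE_face ih).2.2.2).trans h2) h3
    | left a b _ h2 h3 ih => exact .left a b ih ((h _ (bdE_face ih).2.2.1).trans h2) h3
    | up a b _ h2 h3 ih => exact .up a b ih ((h _ (bdE_face ih).2.1).trans h2) h3
    | down a b _ h2 h3 ih => exact .down a b ih ((h _ (bdE_face ih).1).trans h2) h3
  · intro s hs
    change Zr n ω s at hs
    change Zr n ω' s
    induction hs with
    | start b h1 h2 h3 h4 => exact .start b h1 h2 ((h _ (bdE_left _ h1 h2)).symm.trans h3) h4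
    | right a b g h2 h3 ih => exact .right a b ih ((h _ (bdE_face g).2.2.2).symm.trans h2) h3
    | left a b g h2 h3 ih => exact .left a b ih ((h _ (bdE_face g).2.2.1).symm.trans h2) h3
    | up a b g h2 h3 ih => exact .up a b ih ((h _ (bdE_face g).2.1).symm.trans h2) h3
    | down a b g h2 h3 ih => exact .down a b ih ((h _ (bdE_face g).1).symm.trans h2) h3

/-- The squares reached from the left are reached by dual paths. -/
lemma Zr.dual {n : ℤ} {ω ω' : Config TriE} (hd : ∀ a b, ω' (a, b, 1) = false)
    (h : ∀ e ∈ bdE n (ZS n ω), ω e = false → ω' e = false) {s : Vx} (hs : Zr n ω s) :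
    ∃ b, 1 ≤ b ∧ b ≤ n ∧ Conn (dualC ω') (Box (-1) (n - 1) 1 n) (-1, b) (s.1, s.2 + 1) := by
  induction hs with
  | start b h1 h2 h3 h4 =>
    refine ⟨b + 1, by omega, by omega, Conn.step ?_ (mem_Box.2 (by omega)) (mem_Box.2 (by omega))⟩
    have := adj_e0 (ω := dualC ω') (a := -1) (b := b + 1) (by
      simp [dualC, hd, h _ (bdE_left _ h1 h2) h3])
    simpa using this
  | right a b g h2 h3 ih =>
    obtain ⟨c, hc, hc', ih⟩ := ih
    have := mem_Box.1 g.mem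
    refine ⟨c, hc, hc', ih.trans (Conn.step ?_ (mem_Box.2 (by omega)) (mem_Box.2 (by omega)))⟩
    exact adj_e0 (by simp [dualC, hd, h _ (bdE_face g).2.2.2 h2])
  | left a b g h2 h3 ih =>
    obtain ⟨c, hc, hc', ih⟩ := ih
    have := mem_Box.1 g.mem
    refine ⟨c, hc, hc', ih.trans (Conn.step ?_ (mem_Box.2 (by omega)) (mem_Box.2 (by omega)))⟩
    have := adj_e0 (ω := dualC ω') (a := a - 1) (b := b + 1) (by
      simp [dualC, hd, h _ (bdE_face g).2.2.1 h2])
    simpa using this.symm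
  | up a b g h2 h3 ih =>
    obtain ⟨c, hc, hc', ih⟩ := ih
    have := mem_Box.1 g.mem
    refine ⟨c, hc, hc', ih.trans (Conn.step ?_ (mem_Box.2 (by omega)) (mem_Box.2 (by omega)))⟩
    exact adj_e2 (by simp [dualC, hd, h _ (bdE_face g).2.1 h2])
  | down a b g h2 h3 ih =>
    obtain ⟨c, hc, hc', ih⟩ := ih
    have := mem_Box.1 g.mem
    refine ⟨c, hc, hc', ih.trans (Conn.step ?_ (mem_Box.2 (by omega)) (mem_Box.2 (by omega)))⟩
    have := adj_e2 (ω := dualC ω') (a := a) (b := b) (by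
      simp [dualC, hd, h _ (bdE_face g).1 h2])
    simpa using this.symm

/-- Restriction of a configuration to a set of edges. -/
noncomputable def resC (T : Set TriE) (ω : Config TriE) : Config TriE := by
  classical exact fun e => ω e && decide (e ∈ T)

lemma resC_true {T : Set TriE} {ω : Config TriE} {e : TriE} :
    resC T ω e = true ↔ ω e = true ∧ e ∈ T := by simp [resC]

lemma resC_le (T : Set TriE) (ω : Config TriE) : resC T ω ≤ ω := by
  intro e; simp only [resC]; cases ω e <;> simp

lemma resC_false {T : Set TriE} {ω : Config TriE} {e : TriE} (he : e ∈ T)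
    (h : resC T ω e = false) : ω e = false := by
  simpa [resC, he] using h

lemma Zr_of_dual {n : ℤ} {ω : Config TriE} {s t : Vx} (hs : s.1 = -1) (hn : 0 < n)
    (h : Conn (dualC (resC (bdE n (ZS n ω)) ω)) (Box (-1) (n - 1) 1 n) s t) :
    t.1 = -1 ∨ Zr n ω (t.1, t.2 - 1) := by
  induction h with
  | refl => exact Or.inl hs
  | @tail x y _ h ih =>
    obtain ⟨ha, hx, hy⟩ := h
    obtain ⟨a, b⟩ := x
    set ω1 := resC (bdE n (ZS n ω)) ω with hω1
    have K : ∀ e ∈ bdE n (ZS n ω), ω1 e = false → ω e = false := fun e he h => resC_false he h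
    have S0 : ∀ b, 1 ≤ b → b ≤ n → ω1 (0, b - 1, 2) = false → Zr n ω (0, b - 1) := fun b h1 h2 h =>
      .start _ (by omega) (by omega) (K _ (bdE_left _ (by omega) (by omega)) h) hn
    have SR : ∀ a b, Zr n ω (a, b) → ω1 (a + 1, b, 2) = false → a + 1 < n → Zr n ω (a + 1, b) :=
      fun a b g h1 h2 => .right a b g (K _ (bdE_face g).2.2.2 h1) h2
    have SL : ∀ a b, Zr n ω (a, b) → ω1 (a, b, 2) = false → a - 1 = -1 ∨ Zr n ω (a - 1, b) := by
      intro a b g h1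
      have := mem_Box.1 g.mem
      rcases this.1.eq_or_lt with h | h
      · left; omega
      · exact Or.inr (.left a b g (K _ (bdE_face g).2.2.1 h1) h)
    have SU : ∀ a b, Zr n ω (a, b - 1) → ω1 (a, b, 0) = false → b < n → Zr n ω (a, b) := by
      intro a b g h1 h2
      have := Zr.up a (b - 1) g (K _ (bdE_face g).2.1 (by simpa using h1)) (by omega)
      simpa using this
    have SD : ∀ a b, Zr n ω (a, b) → ω1 (a, b, 0) = false → 0 < b → Zr n ω (a, b - 1) :=
      fun a b g h1 h2 => .down a b g (K _ (bdE_face g).1 h1) h2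
    rw [mem_Box] at hx
    rcases adj_iff.1 ha with
      (⟨g, rfl⟩ | ⟨g, rfl⟩ | ⟨g, rfl⟩ | ⟨g, rfl⟩ | ⟨g, rfl⟩ | ⟨g, rfl⟩) <;> rw [mem_Box] at hy <;>
      simp [dualC] at g <;> simp only at ih ⊢
    · right
      rcases ih with rfl | ih
      · exact S0 b (by omega) (by omega) (by simpa using g.2)
      · exact SR _ _ ih g.2 (by omega)
    · rcases ih with rfl | ih
      · omega
      · exact SL _ _ ih g.2
    · rcases ih with rfl | ih
      · omega
      · have := SU _ _ ih g.1 (by omega)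
        simpa using SL _ _ this g.2
    · right
      have : Zr n ω (a + 1, b - 1) := by
        rcases ih with rfl | ih
        · exact S0 b (by omega) (by omega) (by simpa using g.2)
        · exact SR _ _ ih g.2 (by omega)
      exact SD _ _ this g.1 (by omega)
    · rcases ih with rfl | ih
      · exact Or.inl rfl
      · have := SU _ _ ih g.1 (by omega)
        right; simpa using this
    · rcases ih with rfl | ih
      · exact Or.inl rfl
      · right; exact SD _ _ ih g.1 (by omega)

/-- A vertical crossing can be found along the boundary of the region explored from the left. -/
lemma VC_res {n : ℕ} (hn : 0 < n) {ω : Config TriE} (hd : ∀ a b, ω (a, b, 1) = false)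
    (h : ω ∈ VC 0 n 0 n) : resC (bdE n (ZS n ω)) ω ∈ VC 0 n 0 n := by
  by_contra hcon
  obtain ⟨b, b', hb, hb', h1, h2, hc⟩ := exists_dual_path _ n n hcon
  rcases Zr_of_dual rfl (by omega) hc with h3 | h3
  · simp at h3; omega
  simp only [add_sub_cancel_right] at h3
  have h5 : ω (n, b', 2) = false := by
    refine resC_false ?_ h2
    have := (bdE_face (n := n) (z := ZS n ω) h3).2.2.2
    simpa using this
  obtain ⟨c, hc1, hc2, hc⟩ := h3.dual hd (fun e _ h => h)
  refine not_VC_of_dualC_HC (x0 := 0) (x1 := n) (y0 := 0) (y1 := n) ?_ h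
  have h6 : Conn (dualC ω) (Box (-1) n 1 n) (n - 1, b' + 1) (n, b' + 1) := by
    refine Conn.step ?_ (mem_Box.2 (by omega)) (mem_Box.2 (by omega))
    have := adj_e0 (ω := dualC ω) (a := n - 1) (b := b' + 1) (by simp [dualC, hd, h5])
    simpa using this
  refine ⟨(-1, c), ((n:ℤ), (b':ℤ) + 1), ⟨mem_Box.2 (by omega), mem_Box.2 (by omega), rfl, rfl⟩,
    (hc.monoR fun z hz => ?_).trans h6⟩
  obtain ⟨x, y⟩ := z
  rw [mem_Box] at *
  omega

/-- Removal of the diagonal edges. -/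
def nd (ω : Config TriE) : Config TriE := fun e => if e.2.2 = 1 then false else ω e

lemma nd_eq {ω : Config TriE} (hd : ∀ a b, ω (a, b, 1) = false) : nd ω = ω := by
  ext ⟨a, b, i⟩
  by_cases hi : i = 1 <;> simp [nd, hi, hd]

/-- Reflection of edges in row zero. -/
def rfE (e : TriE) : TriE := (e.1, if e.2.2 = 2 then -e.2.1 - 1 else -e.2.1, e.2.2)

lemma rfE_rfE (e : TriE) : rfE (rfE e) = e := by
  obtain ⟨a, b, i⟩ := e
  by_cases hi : i = 2 <;> simp [rfE, hi]

lemma Adj.reflect {ω ω' : Config TriE} (hd : ∀ a b, ω (a, b, 1) = false) {u v : Vx} (h : Adj ω u v)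
    (hω : ∀ e, ω e = true → ((src e = u ∧ tgt e = v) ∨ (src e = v ∧ tgt e = u)) → ω' (rfE e) = true) :
    Adj ω' (u.1, -u.2) (v.1, -v.2) := by
  obtain ⟨⟨a, b, i⟩, h, h2⟩ := h
  have h3 := hω _ h h2
  fin_cases i
  · refine ⟨_, h3, ?_⟩
    rcases h2 with ⟨rfl, rfl⟩ | ⟨rfl, rfl⟩ <;> simp [src, tgt, rfE]
  · simp [hd] at h
  · refine ⟨_, h3, ?_⟩
    rcases h2 with ⟨rfl, rfl⟩ | ⟨rfl, rfl⟩ <;> simp [src, tgt, rfE] <;> omega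

/-- The vertices of `bdE` together with their reflections. -/
def bdQ (n : ℤ) (z : Set Vx) : Set Vx := {v | v ∈ bdV n z ∨ (v.1, -v.2) ∈ bdV n z}

/-- The right side is connected to the explored region without touching its reflection before. -/
def hitE (n m : ℤ) (z : Set Vx) : Set (Config TriE) :=
  {ω | ∃ w x v, w.1 = m ∧ w ∈ Box 0 m (1 - n) (n - 1) \ bdQ n z ∧
    Conn (nd ω) (Box 0 m (1 - n) (n - 1) \ bdQ n z) w x ∧ Adj (nd ω) x v ∧
    v ∈ Box 0 m (1 - n) (n - 1) ∧ v ∈ bdV n z}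

lemma dualC_anti {ω ω' : Config TriE} (h : ω ≤ ω') : dualC ω' ≤ dualC ω := by
  have h' : ∀ e, ω' e = false → ω e = false := fun e he => by
    have := h e; rw [he, Bool.le_iff_imp] at this; simpa using this
  rintro ⟨a, b, i⟩
  rw [Bool.le_iff_imp]
  fin_cases i <;> simp [dualC] <;> exact fun h1 h2 => ⟨h' _ h1, h' _ h2⟩

lemma bdE_row {n : ℤ} {z : Set Vx} (hz : z ⊆ Box 0 (n - 1) 0 (n - 1)) {e : TriE}
    (he : e ∈ bdE n z) : 0 ≤ e.2.1 ∧ (e.2.2 = 0 ∨ e.2.2 = 2) := by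
  rcases he with ⟨h1, -, h2, -⟩ | ⟨a, b, hab, he⟩
  · exact ⟨h2, Or.inr h1⟩
  · have := mem_Box.1 (hz hab)
    rcases he with rfl | rfl | rfl | rfl <;> simp <;> omega

lemma bdV_cases {n : ℤ} {z : Set Vx} {v : Vx} (hv : v ∈ bdV n z) :
    v.1 = 0 ∨ ∃ a b, (a, b) ∈ z ∧
      (v = (a, b) ∨ v = (a + 1, b) ∨ v = (a, b + 1) ∨ v = (a + 1, b + 1)) := by
  obtain ⟨⟨x, y, i⟩, he, hv⟩ := hv
  rcases he with ⟨h1, h2, h3, h4⟩ | ⟨a, b, hab, he⟩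
  · left
    simp at h1 h2
    subst h1 h2
    rcases hv with rfl | rfl <;> simp [src, tgt]
  · right
    refine ⟨a, b, hab, ?_⟩
    rcases he with he | he | he | he <;> (simp only [Prod.mk.injEq] at he; obtain ⟨rfl, rfl, rfl⟩ := he)
      <;> rcases hv with rfl | rfl <;> simp [src, tgt]

lemma VC_connected {n : ℕ} {m : ℤ} (hn : 0 < n) (hm : n ≤ m) {ω : Config TriE}
    (hd : ∀ a b, ω (a, b, 1) = false)
    (h : resC (bdE n (ZS n ω)) ω ∈ VC 0 n 0 n) (h' : ω ∈ hitE n m (ZS n ω)) :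
    ∃ u t w : Vx, u ∈ Box 0 (n:ℤ) 0 n ∧ u.2 = 0 ∧ t.2 = n ∧ Conn ω (Box 0 (n:ℤ) 0 n) u t ∧ w.1 = m ∧
      Conn ω (Box 0 m (-n) n) u w := by
  classical
  set z := ZS n ω with hz
  set T := bdE n z with hT
  set ω1 := resC T ω with hω1
  have hzB : z ⊆ Box 0 ((n:ℤ) - 1) 0 (n - 1) := fun s hs => Zr.mem hs
  obtain ⟨u, t, ⟨hu, ht, hu0, htn⟩, hc⟩ := h
  obtain ⟨w, x, v, hw, hwR, hwx, hxv, hvR, hvT⟩ := h'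
  rw [nd_eq hd] at hwx hxv
  set S := Box 0 (n:ℤ) 0 n with hS
  set R := Box 0 m (1 - n) ((n:ℤ) - 1) with hR
  set Q := bdQ n z with hQ
  set C : Set Vx := {y | Conn ω1 S u y} with hC
  have hCS : C ⊆ S := fun y hy => Conn.mem hy hu
  have hvS : v ∈ S := bdV_subset hzB hvT
  have hxR : x ∈ R \ Q := hwx.mem hwR
  suffices hvC : v ∈ C by
    refine ⟨u, t, w, hu, hu0, htn, hc.mono (resC_le _ _) subset_rfl, hw, ?_⟩
    have s1 : S ⊆ Box 0 m (-n) n := by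
      rintro ⟨a, b⟩ h; rw [mem_Box] at *; omega
    have s2 : R ⊆ Box 0 m (-n) n := by
      rintro ⟨a, b⟩ h; rw [mem_Box] at *; omega
    exact ((hvC.mono (resC_le _ _) s1).trans (Conn.step hxv.symm (s1 hvS) (s2 hxR.1))).trans
      (hwx.symm.monoR (sdiff_subset.trans s2))
  by_contra hvC
  have hCV : C ⊆ bdV n z := by
    have hA : ∀ x y, Adj ω1 x y → y ∈ bdV n z := by
      rintro x y ⟨e, he, h2⟩
      refine ⟨e, (resC_true.1 he).2, ?_⟩
      rcases h2 with ⟨rfl, rfl⟩ | ⟨rfl, rfl⟩ <;> simp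
    intro y hy
    cases hy with
    | tail _ h => exact hA _ _ h.1
    | refl =>
      cases hc.symm with
      | tail _ h => exact hA _ _ h.1
      | refl => omega
  set D : Set Vx := {y | y ∈ C ∨ (y.1, -y.2) ∈ C} with hD
  have hDQ : D ⊆ Q := fun y hy => hy.imp (fun h => hCV h) (fun h => hCV h)
  have hvD : v ∉ D := by
    rintro (h | h)
    · exact hvC h
    · have h1 := hCS h
      obtain ⟨a, b⟩ := v
      rw [mem_Box] at h1 hvS
      have : b = 0 := by omega
      subst this
      exact hvC (by simpa using h)
  set ω2 : Config TriE := fun e => decide (src e ∈ D ∧ tgt e ∈ D ∧ (ω1 e = true ∨ ω1 (rfE e) = true))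
    with hω2
  have hd1 : ∀ a b, ω1 (a, b, 1) = false := fun a b => by
    rw [Bool.eq_false_iff, ne_eq, resC_true]; simp [hd]
  have hd2 : ∀ a b, ω2 (a, b, 1) = false := fun a b => by
    simp [hω2, hd1, rfE]
  have hv2 : ∀ e, src e = v ∨ tgt e = v → ω2 e = false := by
    rintro e (rfl | rfl) <;> simp [hω2, hvD]
  have hT2 : ∀ e ∈ T, ω e = false → ω2 e = false := by
    intro e he h0
    have h1 : ω1 e = false := by rw [Bool.eq_false_iff, ne_eq, resC_true]; simp [h0]
    have h2 : ω1 (rfE e) = false := by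
      rw [Bool.eq_false_iff, ne_eq, resC_true]
      rintro ⟨h3, h4⟩
      obtain ⟨a, b, i⟩ := e
      have h5 := bdE_row hzB he
      have h6 := bdE_row hzB h4
      have : b = 0 ∧ i = 0 := by
        rcases h5.2 with h | h <;> simp at h <;> subst h <;> simp [rfE] at h5 h6 ⊢ <;> omega
      obtain ⟨rfl, rfl⟩ := this
      simp [rfE, h0] at h3
    simp [hω2, h1, h2]
  -- the doubled crossing
  have c1 : Conn ω2 (Box 0 n (-n) n) u t := by
    have : Conn ω1 C u t := by
      clear ht htn
      induction hc with
      | refl => exact Conn.refl _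
      | @tail a b ha hs ih =>
        exact ih.trans (Conn.step hs.1 ha (Conn.trans ha (Conn.step hs.1 hs.2.1 hs.2.2)))
    refine this.map id fun a b ha hb hab => ?_
    obtain ⟨e, h1, h2⟩ := hab
    have s1 : S ⊆ Box 0 n (-n) n := by
      rintro ⟨a, b⟩ h; rw [mem_Box] at *; omega
    refine Conn.step ⟨e, ?_, h2⟩ (s1 (hCS ha)) (s1 (hCS hb))
    rcases h2 with ⟨rfl, rfl⟩ | ⟨rfl, rfl⟩ <;> simp [hω2, hD, ha, hb, h1]
  have c2 : Conn ω2 (Box 0 n (-n) n) (u.1, -u.2) (t.1, -t.2) := by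
    have : Conn ω1 C u t := by
      clear ht htn c1
      induction hc with
      | refl => exact Conn.refl _
      | @tail a b ha hs ih =>
        exact ih.trans (Conn.step hs.1 ha (Conn.trans ha (Conn.step hs.1 hs.2.1 hs.2.2)))
    refine this.map (fun y => (y.1, -y.2)) fun a b ha hb hab => ?_
    have s1 : ∀ y ∈ S, (y.1, -y.2) ∈ Box 0 n (-n) n := by
      rintro ⟨a, b⟩ h; rw [mem_Box] at *; omega
    refine Conn.step (hab.reflect hd1 fun e h1 h2 => ?_) (s1 _ (hCS ha)) (s1 _ (hCS hb))
    have h4 : ∀ e : TriE, ω1 e = true → ((src (rfE e)).1, -(src (rfE e)).2) = src e ∨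
        ((src (rfE e)).1, -(src (rfE e)).2) = tgt e := by
      rintro ⟨a, b, i⟩ h
      fin_cases i
      · simp [rfE, src]
      · simp [hd1] at h
      · simp [rfE, src, tgt]; omega
    have h5 : ∀ e : TriE, ω1 e = true → ((tgt (rfE e)).1, -(tgt (rfE e)).2) = src e ∨
        ((tgt (rfE e)).1, -(tgt (rfE e)).2) = tgt e := by
      rintro ⟨a, b, i⟩ h
      fin_cases i
      · simp [rfE, tgt]
      · simp [hd1] at h
      · simp [rfE, src, tgt]
    have h6 : src e ∈ C ∧ tgt e ∈ C := by
      rcases h2 with ⟨rfl, rfl⟩ | ⟨rfl, rfl⟩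
      · exact ⟨ha, hb⟩
      · exact ⟨hb, ha⟩
    have h7 : src (rfE e) ∈ D := Or.inr (by rcases h4 e h1 with h | h <;> rw [h]; exacts [h6.1, h6.2])
    have h8 : tgt (rfE e) ∈ D := Or.inr (by rcases h5 e h1 with h | h <;> rw [h]; exacts [h6.1, h6.2])
    simp [hω2, h7, h8, rfE_rfE, h1]
  have hu' : (u.1, -u.2) = u := Prod.ext rfl (by simp [hu0])
  rw [hu'] at c2
  have c3 := c2.symm.trans c1
  -- the dual path
  set R' := Box (-1) m (1 - n) (n:ℤ) with hR'
  have hRR : R ⊆ R' := by rintro ⟨a, b⟩ h; rw [mem_Box] at *; omega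
  have d1 : ∃ b, (-1, b) ∈ R' ∧ Conn (dualC ω2) R' (-1, b) v := by
    rcases bdV_cases hvT with h0 | ⟨a, b, hab, hv⟩
    · obtain ⟨v1, v2⟩ := v
      simp only at h0
      subst h0
      have hvR' := mem_Box.1 (hRR hvR)
      have hb : (-1, v2) ∈ R' := mem_Box.2 (by omega)
      refine ⟨v2, hb, Conn.step ?_ hb (hRR hvR)⟩
      have := adj_e0 (ω := dualC ω2) (a := -1) (b := v2) (by
        simp [dualC, hd2, hv2 (0, v2 - 1, 2) (Or.inr (by simp [tgt]))])
      simpa using this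
    · obtain ⟨c, hc1, hc2, hc⟩ := Zr.dual hd2 hT2 hab
      have s1 : Box (-1) ((n:ℤ) - 1) 1 n ⊆ R' := by
        rintro ⟨a, b⟩ h; rw [mem_Box] at *; omega
      have habR := mem_Box.1 (hzB hab)
      have hf : (a, b + 1) ∈ R' := mem_Box.2 (by omega)
      refine ⟨c, mem_Box.2 (by omega), (hc.monoR s1).trans ?_⟩
      have hvR' := hRR hvR
      simp only
      rcases hv with rfl | rfl | rfl | rfl
      · exact Conn.step (adj_e2 (by
          simp [dualC, hd2, hv2 (a, b, 0) (Or.inl (by simp [src]))])).symm hf hvR'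
      · exact Conn.step (adj_e1 (by
          simp [dualC, hv2 (a + 1, b, 0) (Or.inl (by simp [src])),
            hv2 (a + 1, b, 2) (Or.inl (by simp [src]))])).symm hf hvR'
      · exact Conn.refl _
      · exact Conn.step (adj_e0 (by
          simp [dualC, hd2, hv2 (a + 1, b, 2) (Or.inr (by simp [tgt]))])) hf hvR'
  obtain ⟨b, hbR, d1⟩ := d1
  have hle : ω2 ≤ avoidC Dᶜ := by
    intro e
    rw [Bool.le_iff_imp]
    simp only [hω2, avoidC, decide_eq_true_eq, mem_compl_iff, not_not]
    exact fun h => ⟨h.1, h.2.1⟩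
  have hxD : x ∈ Dᶜ := fun h => hxR.2 (hDQ h)
  have d2 : Conn (dualC ω2) R' v x := Conn.step
    ((hxv.symm.dual_avoid hvD hxD).mono (dualC_anti hle)) (hRR hvR) (hRR hxR.1)
  have d3 : Conn (dualC ω2) R' x w := by
    refine hwx.symm.map id fun y y' hy hy' ha => Conn.step
      ((ha.dual_avoid (W := Dᶜ) (fun h => hy.2 (hDQ h)) (fun h => hy'.2 (hDQ h))).mono (dualC_anti hle))
      (hRR hy.1) (hRR hy'.1)
  refine no_dual_cross (y0 := -n) (y1 := n) c3 (by simp [htn]) htn.ge ((d1.trans d2).trans d3) hbR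
    (fun y hy => ⟨by have := hy.2.2.1; omega, hy.2.2.2⟩)
    (fun y hy _ => by have := hy.1; simp; omega) (fun y hy _ => by have := hy.2.1; omega)

/-- The intensities of critical bond percolation on the square lattice. -/
noncomputable def sqH : TriE → ℝ := rowInt (1 / 2) fun _ => sqRow (1 / 2)

lemma sqH_apply (e : TriE) : sqH e = if e.2.2 = 1 then 0 else 1 / 2 := by
  obtain ⟨a, b, i⟩ := e
  fin_cases i <;> simp [sqH, sqRow]; norm_num

lemma tpF_sqH : tpF sqH = sqH := by
  ext ⟨a, b, i⟩
  fin_cases i <;> simp [tpF, sqH_apply]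

lemma sqH_HC_shift (x0 x1 y0 y1 x y : ℤ) : (bern sqH).real (HC (x0 + x) (x1 + x) (y0 + y) (y1 + y)) =
    (bern sqH).real (HC x0 x1 y0 y1) := rowM_HC_shift _ _ _ _ _ _ _ _

lemma sqH_VC_eq (x0 x1 y0 y1 : ℤ) :
    (bern sqH).real (VC x0 x1 y0 y1) = (bern sqH).real (HC y0 y1 x0 x1) := by
  have := tpF_VC sqH x0 x1 y0 y1
  rwa [tpF_sqH] at this

lemma sqH_ae : ∀ᵐ ω ∂bern sqH, ∀ a b, ω (a, b, 1) = false := by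
  filter_upwards [bern_ae_zero sqH] with ω h a b
  exact h _ (by simp [sqH_apply])

lemma sqH_mono {A B : Set (Config TriE)} (h : ∀ ω, (∀ a b, ω (a, b, 1) = false) → ω ∈ A → ω ∈ B) :
    (bern sqH).real A ≤ (bern sqH).real B := by
  refine ENNReal.toReal_mono (measure_ne_top _ _) (measure_mono_ae ?_)
  filter_upwards [sqH_ae] with ω hω
  exact h ω hω

lemma sqH_HC_square (x y : ℤ) (w : ℕ) : 1 / 2 ≤ (bern sqH).real (HC x (x + w) y (y + w)) := by
  have h := VC_add_HC_ge_nodiag (rowOK_sq (p := 1 / 2) (by constructor <;> norm_num)) (fun _ => rfl)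
    (x0 := 0) (x1 := w) (y0 := 0) (y1 := w + 1) (by omega) (by omega)
  change 1 ≤ (bern sqH).real _ + (bern sqH).real _ at h
  rw [sqH_VC_eq] at h
  have h1 := sqH_HC_shift 0 w 0 w x y
  have h2 := sqH_HC_shift 0 w 0 w (-1) 1
  have h3 : (bern sqH).real (HC 0 (w + 1) 0 w) ≤ (bern sqH).real (HC 0 w 0 w) :=
    measureReal_mono (HC_mono (by omega) le_rfl (by omega) le_rfl le_rfl)
  rw [show x + (w:ℤ) = w + x by ring, show y + (w:ℤ) = w + y by ring]
  simp only [zero_add] at h1 h2 h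
  rw [h1]
  rw [show (0:ℤ) - 1 = -1 by ring, show (w:ℤ) - 1 = w + -1 by ring, h2] at h
  linarith

lemma Conn.first_hit {ω : Config TriE} {R Q : Set Vx} {w u : Vx} (h : Conn ω R w u) (hw : w ∈ R \ Q)
    (hu : u ∈ Q) : ∃ x v, Conn ω (R \ Q) w x ∧ Adj ω x v ∧ v ∈ R ∧ v ∈ Q := by
  by_contra! hcon
  have key : u ∉ Q ∧ Conn ω (R \ Q) w u := by
    clear hu
    induction h with
    | refl => exact ⟨hw.2, Conn.refl _⟩
    | @tail a b _ hs ih =>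
      have hb : b ∉ Q := hcon a b ih.2 hs.1 hs.2.2
      exact ⟨hb, ih.2.trans (Conn.step hs.1 (ih.2.mem hw) ⟨hs.2.2, hb⟩)⟩
  exact key.1 hu

lemma bdQ_left {n b : ℤ} (z : Set Vx) (h : -n < b) (h' : b < n) : ((0, b) : Vx) ∈ bdQ n z := by
  rcases le_total 0 b with hb | hb
  · exact Or.inl ⟨_, bdE_left z hb h', Or.inl (by simp [src])⟩
  · exact Or.inr ⟨_, bdE_left z (b := -b) (by omega) (by omega), Or.inl (by simp [src])⟩

lemma hitE_or {n m : ℤ} {z : Set Vx} (hz : z ⊆ Box 0 (n - 1) 0 (n - 1)) (hm : n < m) (h0 : 0 ≤ m)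
    {ω : Config TriE}
    (hd : ∀ a b, ω (a, b, 1) = false) (h : ω ∈ HC 0 m (1 - n) (n - 1)) :
    ω ∈ hitE n m z ∨ (fun e => ω (rfE e)) ∈ hitE n m z := by
  obtain ⟨u, w, ⟨hu, hw, hu0, hwm⟩, hc⟩ := h
  have hB : ∀ v ∈ bdV n z, v.1 ≤ n := fun v hv => (bdV_subset hz hv).2.1
  have hwQ : w ∉ bdQ n z := by
    rintro (h | h)
    · have := hB w h; omega
    · have : w.1 ≤ n := hB (w.1, -w.2) h; omega
  have huQ : u ∈ bdQ n z := by
    obtain ⟨u1, u2⟩ := u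
    rw [mem_Box] at hu
    simp only at hu0
    subst hu0
    exact bdQ_left z (by omega) (by omega)
  obtain ⟨x, v, h1, h2, h3, h4⟩ := hc.symm.first_hit ⟨hw, hwQ⟩ huQ
  rcases h4 with h4 | h4
  · left
    refine ⟨w, x, v, hwm, ⟨hw, hwQ⟩, ?_, ?_, h3, h4⟩ <;> rwa [nd_eq hd]
  · right
    have hd' : ∀ a b, (fun e => ω (rfE e)) (a, b, 1) = false := fun a b => by simp [rfE, hd]
    have hr : ∀ y ∈ Box 0 m (1 - n) (n - 1) \ bdQ n z, (y.1, -y.2) ∈ Box 0 m (1 - n) (n - 1) \ bdQ n z := by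
      rintro ⟨a, b⟩ ⟨hy, hy'⟩
      rw [mem_Box] at hy
      refine ⟨mem_Box.2 (by omega), fun h => hy' ?_⟩
      rcases h with h | h
      · exact Or.inr h
      · exact Or.inl (by simpa using h)
    refine ⟨(w.1, -w.2), (x.1, -x.2), (v.1, -v.2), hwm, hr _ ⟨hw, hwQ⟩, ?_, ?_, ?_, h4⟩
    · rw [nd_eq hd']
      exact h1.map (fun y => (y.1, -y.2)) fun a b ha hb hab =>
        Conn.step (hab.reflect hd fun e he _ => by simpa [rfE_rfE] using he) (hr _ ha) (hr _ hb)
    · rw [nd_eq hd']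
      exact h2.reflect hd fun e he _ => by simpa [rfE_rfE] using he
    · obtain ⟨a, b⟩ := v
      rw [mem_Box] at h3
      exact mem_Box.2 (by omega)

lemma bdE_ends {n : ℤ} {z : Set Vx} {e : TriE} (he : e ∈ bdE n z) : src e ∈ bdV n z ∧ tgt e ∈ bdV n z :=
  ⟨⟨e, he, Or.inl rfl⟩, ⟨e, he, Or.inr rfl⟩⟩

lemma hitE_dep {n m : ℤ} {z : Set Vx} {ω ω' : Config TriE}
    (h : ∀ e, e ∈ edgesIn (Box 0 m (1 - n) (n - 1)) → e ∉ bdE n z → ω e = ω' e) (hω : ω ∈ hitE n m z) :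
    ω' ∈ hitE n m z := by
  obtain ⟨w, x, v, hw, hwR, hwx, hxv, hvR, hvT⟩ := hω
  have hnd : ∀ e, e ∈ edgesIn (Box 0 m (1 - n) (n - 1)) → e ∉ bdE n z → nd ω e = nd ω' e :=
    fun e h1 h2 => by simp [nd, h e h1 h2]
  refine ⟨w, x, v, hw, hwR, hwx.congr fun e h1 h2 => hnd e ⟨h1.1, h2.1⟩ fun h3 =>
    h1.2 (Or.inl (bdE_ends h3).1), ?_, hvR, hvT⟩
  have hx := hwx.mem hwR
  obtain ⟨e, h1, h2⟩ := hxv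
  refine ⟨e, ?_, h2⟩
  rw [← hnd e, h1]
  · rcases h2 with ⟨rfl, rfl⟩ | ⟨rfl, rfl⟩
    · exact ⟨hx.1, hvR⟩
    · exact ⟨hvR, hx.1⟩
  · intro h3
    rcases h2 with ⟨rfl, rfl⟩ | ⟨rfl, rfl⟩
    · exact hx.2 (Or.inl (bdE_ends h3).1)
    · exact hx.2 (Or.inl (bdE_ends h3).2)

lemma hitE_FD (n m : ℤ) (z : Set Vx) : FD (hitE n m z) :=
  ⟨(edgesIn_finite (Box_finite _ _ _ _)).toFinset, fun _ _ h => hitE_dep fun e he _ => h e (by simpa using he)⟩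

lemma hitE_prob {n : ℕ} (hn : 3 ≤ n) {z : Set Vx} (hz : z ⊆ Box 0 ((n:ℤ) - 1) 0 (n - 1)) :
    1 / 4 ≤ (bern sqH).real (hitE n (2 * n - 2) z) := by
  have h1 := sqH_HC_square 0 (1 - n) (2 * n - 2)
  have h2 : (bern sqH).real ((fun ω e => ω (rfE e)) ⁻¹' hitE n (2 * n - 2) z) =
      (bern sqH).real (hitE n (2 * n - 2) z) := by
    rw [bern_real_inj _ rfE (Function.LeftInverse.injective rfE_rfE) (hitE_FD _ _ _)]
    rfl
  have h3 : (bern sqH).real (HC 0 (2 * n - 2) (1 - n) (n - 1)) ≤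
      (bern sqH).real (hitE n (2 * n - 2) z ∪ (fun ω e => ω (rfE e)) ⁻¹' hitE n (2 * n - 2) z) :=
    sqH_mono fun ω hd h => hitE_or hz (by omega) (by omega) hd h
  have h4 := measureReal_union_le (μ := bern sqH) (hitE n (2 * n - 2) z)
    ((fun ω e => ω (rfE e)) ⁻¹' hitE n (2 * n - 2) z)
  have e1 : ((2 * n - 2 : ℕ) : ℤ) = 2 * n - 2 := by omega
  rw [e1, zero_add, show (1:ℤ) - n + (2 * n - 2) = n - 1 by ring] at h1
  linarith

/-- A crossing of the square `[0,n]²` is connected to the column `m` inside `[0,m] × [-n,n]`. -/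
def linkE (n m : ℤ) : Set (Config TriE) :=
  {ω | ∃ u t w : Vx, u ∈ Box 0 n 0 n ∧ u.2 = 0 ∧ t.2 = n ∧ Conn ω (Box 0 n 0 n) u t ∧ w.1 = m ∧
    Conn ω (Box (min 0 m) (max n m) (-n) n) u w}

lemma linkE_upper (n m : ℤ) : IsUpperSet (linkE n m) := by
  rintro ω ω' h ⟨u, t, w, hu, h1, h2, h3, h4, h5⟩
  exact ⟨u, t, w, hu, h1, h2, h3.mono h subset_rfl, h4, h5.mono h subset_rfl⟩

lemma linkE_FD (n m : ℤ) : FD (linkE n m) := by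
  classical
  refine ⟨(edgesIn_finite (Box_finite 0 n 0 n)).toFinset ∪
    (edgesIn_finite (Box_finite (min 0 m) (max n m) (-n) n)).toFinset, ?_⟩
  rintro ω ω' h ⟨u, t, w, hu, h1, h2, h3, h4, h5⟩
  refine ⟨u, t, w, hu, h1, h2, h3.congr fun e h6 h7 => h e ?_, h4, h5.congr fun e h6 h7 => h e ?_⟩
  · exact Finset.mem_union_left _ (by simpa using ⟨h6, h7⟩)
  · exact Finset.mem_union_right _ (by simpa using ⟨h6, h7⟩)

/-- The event that the explored region is `z` and contains a vertical crossing. -/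
def explE (n : ℕ) (z : Set Vx) : Set (Config TriE) :=
  {ω | ZS n ω = z ∧ resC (bdE n z) ω ∈ VC 0 n 0 n}

lemma explE_dep {n : ℕ} {z : Set Vx} {ω ω' : Config TriE} (h : ∀ e ∈ bdE n z, ω e = ω' e)
    (hω : ω ∈ explE n z) : ω' ∈ explE n z := by
  obtain ⟨h1, h2⟩ := hω
  refine ⟨(ZS_congr (by rwa [h1])).trans h1, ?_⟩
  convert h2 using 1
  ext e
  by_cases he : e ∈ bdE n z
  · simp [resC, h e he]
  · simp [resC, he]

lemma bdE_finite {n : ℤ} {z : Set Vx} (hz : z ⊆ Box 0 (n - 1) 0 (n - 1)) : (bdE n z).Finite :=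
  (edgesIn_finite (Box_finite 0 n 0 n)).subset fun _ he =>
    ⟨bdV_subset hz (bdE_ends he).1, bdV_subset hz (bdE_ends he).2⟩

lemma linkE_prob {n : ℕ} (hn : 3 ≤ n) : 1 / 8 ≤ (bern sqH).real (linkE n (2 * n - 2)) := by
  classical
  set Z := (Box_finite 0 ((n:ℤ) - 1) 0 (n - 1)).finite_subsets.toFinset with hZ
  have hZm : ∀ z, z ∈ Z ↔ z ⊆ Box 0 ((n:ℤ) - 1) 0 (n - 1) := fun z => by simp [hZ]
  have hFD : ∀ z ∈ Z, FD (explE n z) := fun z hz =>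
    ⟨(bdE_finite ((hZm z).1 hz)).toFinset, fun ω ω' h => explE_dep fun e he => h e (by simpa using he)⟩
  have hdis : ∀ z z' : Set Vx, z ≠ z' → Disjoint (explE n z) (explE n z') := fun z z' h =>
    Set.disjoint_left.2 fun ω h1 h2 => h (h1.1.symm.trans h2.1)
  have h1 : (bern sqH).real (VC 0 n 0 n) ≤ (bern sqH).real (⋃ z ∈ Z, explE n z) :=
    sqH_mono fun ω hd h => mem_biUnion (x := ZS n ω) ((hZm _).2 fun s hs => Zr.mem hs)
      ⟨rfl, VC_res (by omega) hd h⟩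
  have h2 : (bern sqH).real (⋃ z ∈ Z, explE n z) = ∑ z ∈ Z, (bern sqH).real (explE n z) :=
    measureReal_biUnion_finset (fun z _ z' _ h => hdis z z' h) fun z hz => (hFD z hz).measurableSet
  have h3 : (bern sqH).real (⋃ z ∈ Z, explE n z ∩ hitE n (2 * n - 2) z) =
      ∑ z ∈ Z, (bern sqH).real (explE n z ∩ hitE n (2 * n - 2) z) :=
    measureReal_biUnion_finset (fun z _ z' _ h => (hdis z z' h).mono inter_subset_left inter_subset_left)
      fun z hz => ((hFD z hz).inter (hitE_FD _ _ _)).measurableSet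
  have h4 : ∀ z ∈ Z, (bern sqH).real (explE n z) * (1 / 4) ≤
      (bern sqH).real (explE n z ∩ hitE n (2 * n - 2) z) := by
    intro z hz
    have hz' := (hZm z).1 hz
    rw [bern_indep sqH (S := (bdE_finite hz').toFinset)
      (T := (edgesIn_finite (Box_finite 0 (2 * (n:ℤ) - 2) (1 - n) (n - 1))).toFinset \ (bdE_finite hz').toFinset)
      Finset.disjoint_sdiff (fun ω ω' h => explE_dep fun e he => h e (by simpa using he))
      (fun ω ω' h => hitE_dep fun e he he' => h e (by simpa using ⟨he, he'⟩))]
    exact mul_le_mul_of_nonneg_left (hitE_prob hn hz') measureReal_nonneg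
  have h5 : (bern sqH).real (⋃ z ∈ Z, explE n z ∩ hitE n (2 * n - 2) z) ≤
      (bern sqH).real (linkE n (2 * n - 2)) := by
    refine sqH_mono fun ω hd h => ?_
    simp only [mem_iUnion] at h
    obtain ⟨z, hz, ⟨rfl, h6⟩, h7⟩ := h
    obtain ⟨u, t, w, g1, g2, g3, g4, g5, g6⟩ := VC_connected (m := 2 * n - 2) (by omega) (by omega) hd h6 h7
    refine ⟨u, t, w, g1, g2, g3, g4, g5, ?_⟩
    rwa [min_eq_left (by omega), max_eq_right (by omega)]
  have h6 := sqH_HC_square 0 0 n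
  rw [zero_add, ← sqH_VC_eq] at h6
  have h7 := Finset.sum_le_sum h4
  rw [← Finset.sum_mul] at h7
  linarith

/-- Reflection of edges exchanging the columns `0` and `n`. -/
def mrE (n : ℤ) (e : TriE) : TriE := (if e.2.2 = 0 then n - e.1 - 1 else n - e.1, e.2.1, e.2.2)

lemma mrE_mrE (n : ℤ) (e : TriE) : mrE n (mrE n e) = e := by
  obtain ⟨a, b, i⟩ := e
  by_cases hi : i = 0
  · simp [mrE, hi]; ring
  · simp [mrE, hi]

lemma Adj.mirror {ω : Config TriE} (n : ℤ) (hd : ∀ a b, ω (a, b, 1) = false) {u v : Vx}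
    (h : Adj ω u v) : Adj (fun e => ω (mrE n e)) (n - u.1, u.2) (n - v.1, v.2) := by
  obtain ⟨⟨a, b, i⟩, h, h2⟩ := h
  fin_cases i
  · refine ⟨mrE n (a, b, 0), by simpa [mrE_mrE] using h, ?_⟩
    rcases h2 with ⟨rfl, rfl⟩ | ⟨rfl, rfl⟩ <;> simp [src, tgt, mrE] <;> omega
  · simp [hd] at h
  · refine ⟨mrE n (a, b, 2), by simpa [mrE_mrE] using h, ?_⟩
    rcases h2 with ⟨rfl, rfl⟩ | ⟨rfl, rfl⟩ <;> simp [src, tgt, mrE]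

lemma linkE_mirror {n m : ℤ} {ω : Config TriE} (hd : ∀ a b, ω (a, b, 1) = false)
    (h : ω ∈ linkE n m) : (fun e => ω (mrE n e)) ∈ linkE n (n - m) := by
  obtain ⟨u, t, w, hu, h1, h2, h3, h4, h5⟩ := h
  refine ⟨(n - u.1, u.2), (n - t.1, t.2), (n - w.1, w.2), ?_, h1, h2, ?_, by simp [h4], ?_⟩
  · obtain ⟨a, b⟩ := u
    rw [mem_Box] at hu
    exact mem_Box.2 (by omega)
  · refine h3.map (fun y => (n - y.1, y.2)) fun x y hx hy hxy => Conn.step (hxy.mirror n hd) ?_ ?_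
    · obtain ⟨a, b⟩ := x
      rw [mem_Box] at hx
      exact mem_Box.2 (by omega)
    · obtain ⟨a, b⟩ := y
      rw [mem_Box] at hy
      exact mem_Box.2 (by omega)
  · refine h5.map (fun y => (n - y.1, y.2)) fun x y hx hy hxy => Conn.step (hxy.mirror n hd) ?_ ?_
    · obtain ⟨a, b⟩ := x
      rw [mem_Box] at hx
      exact mem_Box.2 (by omega)
    · obtain ⟨a, b⟩ := y
      rw [mem_Box] at hy
      exact mem_Box.2 (by omega)

lemma linkE_prob' {n : ℕ} (hn : 3 ≤ n) : 1 / 8 ≤ (bern sqH).real (linkE n (n - (2 * n - 2))) := by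
  refine (linkE_prob hn).trans ?_
  have h2 : (bern sqH).real ((fun ω e => ω (mrE n e)) ⁻¹' linkE n (n - (2 * n - 2))) =
      (bern sqH).real (linkE n (n - (2 * n - 2))) := by
    rw [bern_real_inj _ (mrE n) (Function.LeftInverse.injective (mrE_mrE n)) (linkE_FD _ _)]
    rfl
  rw [← h2]
  exact sqH_mono fun ω hd h => linkE_mirror hd h

lemma HC_of_links {n m : ℤ} (hn : 0 ≤ n) (hm : n ≤ m) {ω : Config TriE} (h1 : ω ∈ linkE n m)
    (h2 : ω ∈ linkE n (n - m)) (h3 : ω ∈ HC 0 n 0 n) : ω ∈ HC (n - m) m (-n) n := by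
  obtain ⟨u, t, w, hu, hu0, htn, c1, hw, d1⟩ := h1
  obtain ⟨u', t', w', hu', hu0', htn', c1', hw', d1'⟩ := h2
  obtain ⟨s, r, ⟨hs, hr, hs0, hrn⟩, c⟩ := h3
  rw [min_eq_left (by omega), max_eq_right hm] at d1
  rw [min_eq_right (by omega), max_eq_left (by omega)] at d1'
  obtain ⟨x, hx, e1, f1⟩ := cross_meet c1 hu hu0.le htn.ge (fun z hz => ⟨hz.1, hz.2.1⟩) c hs hs0.le hrn.ge
    fun z hz => ⟨hz.2.2.1, hz.2.2.2⟩
  obtain ⟨x', hx', e1', f1'⟩ := cross_meet c1' hu' hu0'.le htn'.ge (fun z hz => ⟨hz.1, hz.2.1⟩) c hs hs0.le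
    hrn.ge fun z hz => ⟨hz.2.2.1, hz.2.2.2⟩
  have s1 : Box 0 n 0 n ⊆ Box (n - m) m (-n) n := by
    rintro ⟨a, b⟩ h; rw [mem_Box] at *; omega
  have s2 : Box 0 m (-n) n ⊆ Box (n - m) m (-n) n := by
    rintro ⟨a, b⟩ h; rw [mem_Box] at *; omega
  have s3 : Box (n - m) n (-n) n ⊆ Box (n - m) m (-n) n := by
    rintro ⟨a, b⟩ h; rw [mem_Box] at *; omega
  have hc : Conn ω (Box (n - m) m (-n) n) w' w :=
    (d1'.symm.monoR s3).trans <| ((((e1'.trans f1'.symm).trans f1).trans e1.symm).monoR s1).trans (d1.monoR s2)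
  have hw'm : w' ∈ Box (n - m) m (-n) n := (d1'.monoR s3).mem (s1 hu')
  exact ⟨w', w, ⟨hw'm, hc.mem hw'm, hw', hw⟩, hc⟩

lemma sqH_HC_long {n : ℕ} (hn : 3 ≤ n) (x y : ℤ) :
    1 / 128 ≤ (bern sqH).real (HC x (x + (3 * n - 4)) y (y + 2 * n)) := by
  have h1 := linkE_prob hn
  have h2 := linkE_prob' hn
  have h3 := sqH_HC_square 0 0 n
  rw [zero_add] at h3
  have f1 := bern_fkg sqH (linkE_upper n (2 * n - 2)) (linkE_upper n (n - (2 * n - 2))) (linkE_FD _ _)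
    (linkE_FD _ _)
  have f2 := bern_fkg sqH ((linkE_upper n (2 * n - 2)).inter (linkE_upper n (n - (2 * n - 2))))
    (HC_upper 0 n 0 n) ((linkE_FD _ _).inter (linkE_FD _ _)) (HC_FD _ _ _ _)
  have h4 : (bern sqH).real (linkE n (2 * n - 2) ∩ linkE n (n - (2 * n - 2)) ∩ HC 0 n 0 n) ≤
      (bern sqH).real (HC (n - (2 * n - 2)) (2 * n - 2) (-n) n) :=
    measureReal_mono fun ω h => HC_of_links (by omega) (by omega) h.1.1 h.1.2 h.2
  have h5 := sqH_HC_shift ((n:ℤ) - (2 * n - 2)) (2 * n - 2) (-n) n (x + n - 2) (y + n)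
  rw [show (n:ℤ) - (2 * n - 2) + (x + n - 2) = x by ring, show 2 * (n:ℤ) - 2 + (x + n - 2) = x + (3 * n - 4) by ring,
    show -(n:ℤ) + (y + n) = y by ring, show (n:ℤ) + (y + n) = y + 2 * n by ring] at h5
  have h6 : (1 / 8 : ℝ) * (1 / 8) ≤ (bern sqH).real (linkE n (2 * n - 2) ∩ linkE n (n - (2 * n - 2))) :=
    (mul_le_mul h1 h2 (by norm_num) measureReal_nonneg).trans f1
  have h7 := mul_le_mul h6 h3 (by norm_num) measureReal_nonneg
  rw [h5]
  linarith

lemma good_sqH : Good sqH := by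
  have hV : ∀ n : ℕ, 8 ≤ n → ∀ x y : ℤ,
      (1 / 128 : ℝ) ^ (2 * 8 + 1) ≤ (bern sqH).real (VC (x - n) (x + n) (y - 3 * n) (y + 3 * n)) := by
    intro n hn x y
    have h := VC_overlap (f := sqH) (δ := 1 / 128) (x0 := x - n) (x1 := x + n) (h := 2 * n) (g := n - 4)
      (by norm_num) (fun y => ?_) (fun y => ?_) 8 (y - 3 * n)
    · refine h.trans (measureReal_mono (VC_mono ?_ ?_ ?_ ?_ ?_)) <;> push_cast <;> omega
    · have := sqH_HC_long (n := n) (by omega) y (x - n)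
      rw [sqH_VC_eq]
      convert this using 3 <;> push_cast <;> omega
    · have := sqH_HC_square (x - n) y (2 * n)
      refine le_trans (by norm_num) (this.trans_eq ?_)
      congr 2; push_cast; ring
  refine ⟨(1 / 128) ^ (2 * 8 + 1), by positivity, 8, fun n hn x y => ⟨?_, hV n hn x y⟩⟩
  rw [← sqH_VC_eq]
  exact hV n hn y x

lemma Good.to_sq {p : ℝ} {ρ : ℤ → ℝ × ℝ} (hρ : RowOK p ρ) (h : Good (rowInt p ρ)) :
    Good (rowInt p fun _ => sqRow p) :=
  h.transfer hρ (rowOK_sq hρ.hp) (cmp_to_sq hρ) (cmp_of_sq hρ)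

lemma Good.of_sq {p : ℝ} {ρ : ℤ → ℝ × ℝ} (hρ : RowOK p ρ) (h : Good (rowInt p fun _ => sqRow p)) :
    Good (rowInt p ρ) :=
  h.transfer (rowOK_sq hρ.hp) hρ (cmp_of_sq hρ) (cmp_to_sq hρ)

lemma tpF_rowInt (p s t : ℝ) : tpF (rowInt p fun _ => (s, t)) = rowInt t fun _ => (s, p) := by
  ext ⟨a, b, i⟩
  fin_cases i
  · change rowInt p _ (b, a, 2) = _; simp
  · change rowInt p _ (b, a, 1) = _; simp
  · change rowInt p _ (b, a, 0) = _; simp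

lemma good_sq_le {p : ℝ} (h0 : 0 < p) (h1 : p ≤ 1 / 2) : Good (rowInt p fun _ => sqRow p) := by
  set s : ℝ := (1 / 2 - p) / (1 - p / 2) with hs
  have hd : 0 < 1 - p / 2 := by linarith
  have hs0 : 0 ≤ s := div_nonneg (by linarith) hd.le
  have hs1 : s ≤ 1 := (div_le_one hd).2 (by linarith)
  have hs2 : s * (1 - p / 2) = 1 / 2 - p := div_mul_cancel₀ _ hd.ne'
  have r1 : RowOK (1 / 2) fun _ => (s, p) :=
    ⟨by constructor <;> norm_num, fun _ => ⟨hs0, hs1⟩, fun _ => ⟨h0.le, by linarith⟩,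
      fun _ => by simp only [kappaT]; linarith⟩
  have r2 : RowOK p fun _ => (s, 1 / 2) :=
    ⟨⟨h0, by linarith⟩, fun _ => ⟨hs0, hs1⟩, fun _ => by constructor <;> norm_num,
      fun _ => by simp only [kappaT]; linarith⟩
  have h := (Good.of_sq r1 good_sqH).tp
  rw [tpF_rowInt] at h
  exact h.to_sq r2

lemma good_rowInt {p : ℝ} {ρ : ℤ → ℝ × ℝ} (hρ : RowOK p ρ) : Good (rowInt p ρ) := by
  refine Good.of_sq hρ ?_
  obtain ⟨h0, h1⟩ := hρ.hp
  rcases le_total p (1 / 2) with h | h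
  · exact good_sq_le h0 h
  · have := (good_sq_le (p := 1 - p) (by linarith) (by linarith)).tp
    simp only [sqRow, tpF_rowInt, sub_sub_cancel] at this
    exact this

/-- Both long crossings of the rectangles centred at `z`. -/
def crossE (n : ℤ) (z : Vx) : Set (Config TriE) :=
  HC (z.1 - 3 * n) (z.1 + 3 * n) (z.2 - n) (z.2 + n) ∩ VC (z.1 - n) (z.1 + n) (z.2 - 3 * n) (z.2 + 3 * n)

/-- The box of side `6 * n` centred at `z`. -/
def ctrBox (n : ℤ) (z : Vx) : Set Vx := Box (z.1 - 3 * n) (z.1 + 3 * n) (z.2 - 3 * n) (z.2 + 3 * n)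

/-- The events `crossE` for the first points of a sequence. -/
def chainE (n : ℤ) (z : ℕ → Vx) (M : ℕ) : Set (Config TriE) := {ω | ∀ i ≤ M, ω ∈ crossE n (z i)}

lemma chainE_succ (n : ℤ) (z : ℕ → Vx) (M : ℕ) :
    chainE n z (M + 1) = chainE n z M ∩ crossE n (z (M + 1)) := by
  ext ω
  constructor
  · exact fun h => ⟨fun i hi => h i (by omega), h _ le_rfl⟩
  · rintro ⟨h1, h2⟩ i hi
    rcases Nat.lt_or_ge i (M + 1) with h | h
    · exact h1 i (by omega)
    · rwa [le_antisymm hi h]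

lemma crossE_upper (n : ℤ) (z : Vx) : IsUpperSet (crossE n z) := (HC_upper _ _ _ _).inter (VC_upper _ _ _ _)

lemma crossE_FD (n : ℤ) (z : Vx) : FD (crossE n z) := (HC_FD _ _ _ _).inter (VC_FD _ _ _ _)

lemma chainE_zero (n : ℤ) (z : ℕ → Vx) : chainE n z 0 = crossE n (z 0) := by
  ext ω
  exact ⟨fun h => h 0 le_rfl, fun h i hi => by rwa [Nat.le_zero.1 hi]⟩

lemma chainE_upper (n : ℤ) (z : ℕ → Vx) (M : ℕ) : IsUpperSet (chainE n z M) :=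
  fun _ _ h hω i hi => crossE_upper _ _ h (hω i hi)

lemma chainE_FD (n : ℤ) (z : ℕ → Vx) (M : ℕ) : FD (chainE n z M) := by
  induction M with
  | zero => rw [chainE_zero]; exact crossE_FD _ _
  | succ M ih => rw [chainE_succ]; exact ih.inter (crossE_FD _ _)

lemma chainE_prob {f : TriE → ℝ} {δ : ℝ} (hδ : 0 ≤ δ) {n : ℤ} (z : ℕ → Vx)
    (h : ∀ x, δ ≤ (bern f).real (crossE n x)) (M : ℕ) :
    δ ^ (M + 1) ≤ (bern f).real (chainE n z M) := by
  induction M with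
  | zero => rw [chainE_zero]; simpa using h _
  | succ M ih =>
    rw [chainE_succ, pow_succ]
    exact (mul_le_mul ih (h _) hδ measureReal_nonneg).trans
      (bern_fkg f (chainE_upper n z M) (crossE_upper n _) (chainE_FD n z M) (crossE_FD n _))

lemma crossE_meet {n : ℤ} (hn : 0 ≤ n) {z z' : Vx} {ω : Config TriE}
    (h1 : |z.1 - z'.1| ≤ n) (h2 : |z.2 - z'.2| ≤ n)
    {s r u v : Vx} (hs : s ∈ Box (z.1 - 3 * n) (z.1 + 3 * n) (z.2 - n) (z.2 + n)) (hs1 : s.1 = z.1 - 3 * n)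
    (hr : r.1 = z.1 + 3 * n) (hc : Conn ω (Box (z.1 - 3 * n) (z.1 + 3 * n) (z.2 - n) (z.2 + n)) s r)
    (hu : u ∈ Box (z'.1 - n) (z'.1 + n) (z'.2 - 3 * n) (z'.2 + 3 * n)) (hu1 : u.2 = z'.2 - 3 * n)
    (hv : v.2 = z'.2 + 3 * n) (hc' : Conn ω (Box (z'.1 - n) (z'.1 + n) (z'.2 - 3 * n) (z'.2 + 3 * n)) u v) :
    Conn ω (ctrBox n z ∪ ctrBox n z') s u := by
  rw [abs_le] at h1 h2
  obtain ⟨x, -, e1, e2⟩ := cross_meet hc' hu (y0 := z.2 - n) (y1 := z.2 + n) (by omega) (by omega)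
    (fun w hw => ⟨hw.1, hw.2.1⟩) hc hs (by omega) (by omega) fun w hw => ⟨hw.2.2.1, hw.2.2.2⟩
  refine (e2.monoR ?_).trans (e1.symm.monoR ?_)
  · rintro ⟨a, b⟩ h
    left
    rw [ctrBox, mem_Box] at *
    omega
  · rintro ⟨a, b⟩ h
    right
    rw [ctrBox, mem_Box] at *
    omega

lemma chainE_conn {n : ℤ} (hn : 0 ≤ n) {z : ℕ → Vx} {M : ℕ} {ω : Config TriE}
    (hz : ∀ i < M, |(z i).1 - (z (i + 1)).1| ≤ n ∧ |(z i).2 - (z (i + 1)).2| ≤ n)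
    (h : ω ∈ chainE n z M) : ∃ u s r : Vx, u ∈ ctrBox n (z 0) ∧
      s ∈ Box ((z M).1 - 3 * n) ((z M).1 + 3 * n) ((z M).2 - n) ((z M).2 + n) ∧
      s.1 = (z M).1 - 3 * n ∧ r.1 = (z M).1 + 3 * n ∧
      Conn ω (Box ((z M).1 - 3 * n) ((z M).1 + 3 * n) ((z M).2 - n) ((z M).2 + n)) s r ∧
      Conn ω {w | ∃ i ≤ M, w ∈ ctrBox n (z i)} u s := by
  induction M with
  | zero =>
    obtain ⟨⟨s, r, ⟨hs, -, hs1, hr1⟩, hc⟩, -⟩ := h 0 le_rfl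
    refine ⟨s, s, r, ?_, hs, hs1, hr1, hc, Conn.refl _⟩
    obtain ⟨a, b⟩ := s
    rw [mem_Box] at hs
    exact mem_Box.2 (by omega)
  | succ M ih =>
    obtain ⟨u, s, r, hu, hs, hs1, hr, hc, hus⟩ := ih (fun i hi => hz i (by omega)) fun i hi => h i (by omega)
    obtain ⟨⟨s', r', ⟨hs', -, hs1', hr1'⟩, hc'⟩, ⟨u', v', ⟨hu', -, hu1', hv1'⟩, hd'⟩⟩ := h (M + 1) le_rfl
    have c1 := crossE_meet hn (hz M (by omega)).1 (hz M (by omega)).2 hs hs1 hr hc hu' hu1' hv1' hd'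
    have c2 := crossE_meet hn (by simpa using hn) (by simpa using hn) hs' hs1' hr1' hc' hu' hu1' hv1' hd'
    refine ⟨u, s', r', hu, hs', hs1', hr1', hc', (hus.monoR ?_).trans ((c1.monoR ?_).trans (c2.symm.monoR ?_))⟩
    · rintro w ⟨i, hi, hw⟩
      exact ⟨i, by omega, hw⟩
    · rintro w (hw | hw)
      · exact ⟨M, by omega, hw⟩
      · exact ⟨M + 1, le_rfl, hw⟩
    · rintro w (hw | hw) <;> exact ⟨M + 1, le_rfl, hw⟩

/-- The `ℓ¹` distance in the plane. -/
def d1 (z w : Pt) : ℝ := |z.1 - w.1| + |z.2 - w.2|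

/-- A vertex of the triangular lattice close to a point of the plane. -/
noncomputable def nearV (z : Pt) : Vx := (⌊z.1 / √3 - z.2 / 3⌋, ⌊2 / 3 * z.2⌋)

lemma sqrt_three_bounds : 1 ≤ √3 ∧ √3 ≤ 9 / 5 := by
  constructor
  · exact Real.le_sqrt_of_sq_le (by norm_num)
  · exact Real.sqrt_le_iff.2 (by norm_num)

lemma abs_floor_sub {x y : ℝ} {n : ℤ} (h : |x - y| ≤ n - 1) : |⌊x⌋ - ⌊y⌋| ≤ n := by
  have h1 := Int.floor_le x
  have h2 := Int.floor_le y
  have h3 := Int.lt_floor_add_one x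
  have h4 := Int.lt_floor_add_one y
  rw [abs_le] at *
  constructor
  · have : (-(n:ℝ)) < (⌊x⌋ - ⌊y⌋ : ℝ) := by linarith
    have : -n < ⌊x⌋ - ⌊y⌋ := by exact_mod_cast this
    omega
  · have : (⌊x⌋ - ⌊y⌋ : ℝ) < n := by linarith
    have : ⌊x⌋ - ⌊y⌋ < n := by exact_mod_cast this
    omega

lemma nearV_sub {z w : Pt} {n : ℤ} (h : d1 z w ≤ n - 1) :
    |(nearV z).1 - (nearV w).1| ≤ n ∧ |(nearV z).2 - (nearV w).2| ≤ n := by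
  have h3 := sqrt_three_bounds
  unfold d1 at h
  constructor
  · refine abs_floor_sub (le_trans ?_ h)
    rw [show z.1 / √3 - z.2 / 3 - (w.1 / √3 - w.2 / 3) = (z.1 - w.1) / √3 - (z.2 - w.2) / 3 by ring]
    refine (abs_sub _ _).trans (add_le_add ?_ ?_)
    · rw [abs_div, abs_of_nonneg (Real.sqrt_nonneg 3)]
      exact div_le_self (abs_nonneg _) h3.1
    · rw [abs_div]
      exact div_le_self (abs_nonneg _) (by norm_num)
  · refine abs_floor_sub (le_trans ?_ h)
    rw [show 2 / 3 * z.2 - 2 / 3 * w.2 = 2 / 3 * (z.2 - w.2) by ring, abs_mul]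
    have := abs_nonneg (z.1 - w.1)
    have := abs_nonneg (z.2 - w.2)
    rw [abs_of_nonneg (by norm_num : (0:ℝ) ≤ 2 / 3)]
    linarith

lemma d1_near {z : Pt} {n : ℤ} (hn : 1 ≤ n) {w : Vx} (hw : w ∈ ctrBox n (nearV z)) :
    d1 (tv w.1 w.2) z ≤ 18 * n := by
  have h3 := sqrt_three_bounds
  have hs : √3 ≠ 0 := by linarith
  obtain ⟨a, b⟩ := w
  rw [ctrBox, mem_Box] at hw
  simp only [nearV] at hw
  set x := z.1 / √3 - z.2 / 3 with hx
  set y := 2 / 3 * z.2 with hy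
  have e1 : z.1 = √3 * (x + y / 2) := by rw [hx, hy]; field_simp; ring
  have e2 : z.2 = 3 / 2 * y := by rw [hy]; ring
  have g1 := Int.floor_le x
  have g2 := Int.floor_le y
  have g3 := Int.lt_floor_add_one x
  have g4 := Int.lt_floor_add_one y
  have hn' : (1:ℝ) ≤ n := by exact_mod_cast hn
  obtain ⟨w1, w2, w3, w4⟩ := hw
  have w1' : (⌊x⌋ : ℝ) - 3 * n ≤ a := by exact_mod_cast w1
  have w2' : (a : ℝ) ≤ ⌊x⌋ + 3 * n := by exact_mod_cast w2
  have w3' : (⌊y⌋ : ℝ) - 3 * n ≤ b := by exact_mod_cast w3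
  have w4' : (b : ℝ) ≤ ⌊y⌋ + 3 * n := by exact_mod_cast w4
  have k1 : |(a : ℝ) - x| ≤ 3 * n + 1 := abs_le.2 ⟨by linarith, by linarith⟩
  have k2 : |(b : ℝ) - y| ≤ 3 * n + 1 := abs_le.2 ⟨by linarith, by linarith⟩
  have k3 : |((a : ℝ) - x) + (b - y) / 2| ≤ 3 / 2 * (3 * n + 1) := by
    rw [abs_le] at *
    constructor <;> linarith
  unfold d1 tv
  rw [e1, e2]
  simp only
  rw [← mul_sub, ← mul_sub, abs_mul, abs_mul, abs_of_nonneg (Real.sqrt_nonneg 3),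
    abs_of_nonneg (by norm_num : (0:ℝ) ≤ 3 / 2),
    show (a : ℝ) + b / 2 - (x + y / 2) = (a - x) + (b - y) / 2 by ring]
  have k4 : √3 * |((a : ℝ) - x) + (b - y) / 2| ≤ 9 / 5 * (3 / 2 * (3 * n + 1)) :=
    mul_le_mul h3.2 k3 (abs_nonneg _) (by norm_num)
  linarith

/-- The point dividing a segment in the given ratio. -/
def seg (A B : Pt) (s : ℝ) : Pt := (A.1 + s * (B.1 - A.1), A.2 + s * (B.2 - A.2))

lemma d1_seg (A B : Pt) (s t : ℝ) : d1 (seg A B s) (seg A B t) = |s - t| * d1 A B := by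
  unfold d1 seg
  simp only
  rw [show A.1 + s * (B.1 - A.1) - (A.1 + t * (B.1 - A.1)) = (s - t) * (-(A.1 - B.1)) by ring,
    show A.2 + s * (B.2 - A.2) - (A.2 + t * (B.2 - A.2)) = (s - t) * (-(A.2 - B.2)) by ring,
    abs_mul, abs_mul, abs_neg, abs_neg]
  ring

lemma Good.tube {f : TriE → ℝ} (hf : Good f) : ∃ δ : ℝ, 0 < δ ∧ ∃ n0 : ℕ, ∀ n : ℕ, n0 ≤ n → 1 ≤ n →
    ∀ M : ℕ, 1 ≤ M → ∀ A B : Pt, d1 A B ≤ M * (n - 1) →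
    ∃ T : Set (Config TriE), IsUpperSet T ∧ FD T ∧ δ ^ (M + 1) ≤ (bern f).real T ∧ ∀ ω ∈ T,
      ∃ (W : Set Vx) (u v : Vx), Conn ω W u v ∧ d1 (tv u.1 u.2) A ≤ 18 * n ∧
        d1 (tv v.1 v.2) B ≤ 18 * n ∧ ∀ w ∈ W, ∃ s ∈ Icc (0:ℝ) 1, d1 (tv w.1 w.2) (seg A B s) ≤ 18 * n := by
  obtain ⟨δ, hδ, n0, h⟩ := hf
  refine ⟨δ * δ, mul_pos hδ hδ, n0, fun n hn hn1 M hM A B hAB => ?_⟩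
  have hM0 : (0:ℝ) < M := by exact_mod_cast hM
  set z : ℕ → Vx := fun i => nearV (seg A B (i / M)) with hz
  have hn1' : (1:ℤ) ≤ n := by exact_mod_cast hn1
  refine ⟨chainE n z M, chainE_upper _ _ _, chainE_FD _ _ _,
    chainE_prob (mul_nonneg hδ.le hδ.le) z (fun x => ?_) M, fun ω hω => ?_⟩
  · exact (mul_le_mul (h n hn x.1 x.2).1 (h n hn x.1 x.2).2 hδ.le measureReal_nonneg).trans
      (bern_fkg f (HC_upper _ _ _ _) (VC_upper _ _ _ _) (HC_FD _ _ _ _) (VC_FD _ _ _ _))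
  · have hst : ∀ i < M, |(z i).1 - (z (i + 1)).1| ≤ (n:ℤ) ∧ |(z i).2 - (z (i + 1)).2| ≤ (n:ℤ) := by
      intro i _
      refine nearV_sub ?_
      rw [d1_seg, show (i:ℝ) / M - ((i + 1 : ℕ) : ℝ) / M = -(1 / M) by push_cast; ring, abs_neg,
        abs_of_pos (by positivity), one_div, inv_mul_le_iff₀ hM0]
      exact_mod_cast hAB
    obtain ⟨u, s, r, hu, hs, -, -, -, hc⟩ := chainE_conn (by omega) hst hω
    have hs' : s ∈ ctrBox n (z M) := by
      obtain ⟨a, b⟩ := s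
      rw [mem_Box] at hs
      exact mem_Box.2 (by omega)
    refine ⟨{w | ∃ i ≤ M, w ∈ ctrBox n (z i)}, u, s, hc, ?_, ?_, ?_⟩
    · have := d1_near hn1' hu
      simpa [seg] using this
    · have := d1_near hn1' hs'
      simpa [seg, hM0.ne'] using this
    · rintro w ⟨i, hi, hw⟩
      exact ⟨i / M, ⟨by positivity, (div_le_one hM0).2 (by exact_mod_cast hi)⟩, d1_near hn1' hw⟩

/-- A path from `{c ≤ 0}` to `{l ≤ c}` contains a path from `{c = 0}` to `{c = l}` inside
the strip `{0 ≤ c ≤ l}`. -/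
lemma exists_path_between_levels {K : Set Pt} {P Q : Pt} (h : JoinedIn K P Q) {c : Pt → ℝ} (hc : Continuous c)
    {l : ℝ} (hl : 0 < l) (h0 : c P ≤ 0) (h1 : l ≤ c Q) :
    ∃ γ : ℝ → Pt, ContinuousOn γ (Icc 0 1) ∧ c (γ 0) = 0 ∧ c (γ 1) = l ∧
      ∀ t ∈ Icc (0:ℝ) 1, 0 ≤ c (γ t) ∧ c (γ t) ≤ l ∧ γ t ∈ K := by
  obtain ⟨g, hg⟩ := h
  set G : ℝ → Pt := ⇑g.extend with hG
  have cG : Continuous G := g.continuous_extend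
  have cc : Continuous (c ∘ G) := hc.comp cG
  have G0 : G 0 = P := g.extend_zero
  have G1 : G 1 = Q := g.extend_one
  have GK : ∀ t ∈ Icc (0:ℝ) 1, G t ∈ K := fun t ht => by
    rw [hG, g.extend_apply ht]
    exact hg _
  obtain ⟨b, ⟨⟨hb0, hb1⟩, hb⟩, hbl⟩ : ∃ b, IsLeast (Icc (0:ℝ) 1 ∩ (c ∘ G) ⁻¹' {l}) b := by
    refine (isCompact_Icc.inter_right (isClosed_singleton.preimage cc)).exists_isLeast ?_
    obtain ⟨t, ht, e⟩ := intermediate_value_Icc zero_le_one cc.continuousOn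
      (show l ∈ Icc ((c ∘ G) 0) ((c ∘ G) 1) by
        simp only [Function.comp, G0, G1]
        exact ⟨by linarith, h1⟩)
    exact ⟨t, ht, e⟩
  simp only [mem_preimage, mem_singleton_iff, Function.comp] at hb
  obtain ⟨a, ⟨⟨ha0, hab⟩, ha⟩, hal⟩ : ∃ a, IsGreatest (Icc 0 b ∩ (c ∘ G) ⁻¹' {0}) a := by
    refine (isCompact_Icc.inter_right (isClosed_singleton.preimage cc)).exists_isGreatest ?_
    obtain ⟨t, ht, e⟩ := intermediate_value_Icc hb0 cc.continuousOn
      (show (0:ℝ) ∈ Icc ((c ∘ G) 0) ((c ∘ G) b) by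
        simp only [Function.comp, G0, hb]
        exact ⟨h0, hl.le⟩)
    exact ⟨t, ht, e⟩
  simp only [mem_preimage, mem_singleton_iff, Function.comp] at ha
  have key : ∀ s ∈ Icc a b, 0 ≤ c (G s) ∧ c (G s) ≤ l ∧ G s ∈ K := by
    rintro s ⟨s1, s2⟩
    refine ⟨?_, ?_, GK s ⟨by linarith, by linarith⟩⟩
    · by_contra! hlt
      obtain ⟨t, ht, e⟩ := intermediate_value_Icc s2 cc.continuousOn
        (show (0:ℝ) ∈ Icc ((c ∘ G) s) ((c ∘ G) b) from ⟨hlt.le, by simp only [Function.comp, hb]; exact hl.le⟩)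
      have : s = a := le_antisymm (ht.1.trans (hal ⟨⟨by linarith [ht.1], ht.2⟩, e⟩)) s1
      rw [this, ha] at hlt
      exact lt_irrefl _ hlt
    · by_contra! hlt
      obtain ⟨t, ht, e⟩ := intermediate_value_Icc (by linarith : (0:ℝ) ≤ s) cc.continuousOn
        (show l ∈ Icc ((c ∘ G) 0) ((c ∘ G) s) from
          ⟨by simp only [Function.comp, G0]; linarith, hlt.le⟩)
      have : s = b := le_antisymm s2 ((hbl ⟨⟨ht.1, by linarith [ht.2]⟩, e⟩).trans ht.2)
      rw [this, hb] at hlt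
      exact lt_irrefl _ hlt
  refine ⟨fun t => G (a + t * (b - a)), (cG.comp (by fun_prop)).continuousOn, by simpa using ha,
    by simpa using hb, fun t ht => key _ ⟨?_, ?_⟩⟩
  · nlinarith [ht.1]
  · nlinarith [ht.2]

/-- `g` and `gi` are inverse plane isometries. -/
structure RotPair (g gi : Pt → Pt) : Prop where
  cont : Continuous gi
  right_inv : ∀ z, g (gi z) = z
  left_inv : ∀ z, gi (g z) = z
  fst_le : ∀ z w, |(gi z).1 - (gi w).1| ≤ d1 z w
  snd_le : ∀ z w, |(gi z).2 - (gi w).2| ≤ d1 z w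
  d1_le : ∀ z w, d1 (g z) (g w) ≤ 2 * d1 z w
  seg : ∀ A B s, gi (seg A B s) = seg (gi A) (gi B) s

lemma abs_rot_le (θ x y : ℝ) : |Real.cos θ * x| + |Real.sin θ * y| ≤ |x| + |y| := by
  rw [abs_mul, abs_mul]
  exact add_le_add (mul_le_of_le_one_left (abs_nonneg _) (Real.abs_cos_le_one θ))
    (mul_le_of_le_one_left (abs_nonneg _) (Real.abs_sin_le_one θ))

lemma rot_sub_fst (θ : ℝ) (z w : Pt) : |(rot θ z).1 - (rot θ w).1| ≤ d1 z w := by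
  rw [show (rot θ z).1 - (rot θ w).1 = Real.cos θ * (z.1 - w.1) - Real.sin θ * (z.2 - w.2) by
    simp only [rot]; ring]
  exact (abs_sub _ _).trans (abs_rot_le _ _ _)

lemma rot_sub_snd (θ : ℝ) (z w : Pt) : |(rot θ z).2 - (rot θ w).2| ≤ d1 z w := by
  rw [show (rot θ z).2 - (rot θ w).2 = Real.cos θ * (z.2 - w.2) + Real.sin θ * (z.1 - w.1) by
    simp only [rot]; ring]
  refine (abs_add_le _ _).trans ((abs_rot_le _ _ _).trans (le_of_eq ?_))
  rw [d1, add_comm]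

lemma IsRotTrans.exists_pair {g : Pt → Pt} (h : IsRotTrans g) : ∃ gi, RotPair g gi := by
  obtain ⟨θ, t, rfl⟩ := h
  have hs := Real.sin_sq_add_cos_sq θ
  refine ⟨fun z => rot (-θ) (z - t), ⟨?_, ?_, ?_, ?_, ?_, ?_, ?_⟩⟩
  · unfold rot
    fun_prop
  · intro z
    ext <;> simp [rot]
    · linear_combination (z.1 - t.1) * hs
    · linear_combination (z.2 - t.2) * hs
  · intro z
    ext <;> simp [rot]
    · linear_combination z.1 * hs
    · linear_combination z.2 * hs
  · intro z w
    refine (rot_sub_fst _ _ _).trans (le_of_eq ?_)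
    simp [d1]
  · intro z w
    refine (rot_sub_snd _ _ _).trans (le_of_eq ?_)
    simp [d1]
  · intro z w
    have h1 := rot_sub_fst θ z w
    have h2 := rot_sub_snd θ z w
    rw [d1]
    simp only [Prod.fst_add, Prod.snd_add, add_sub_add_right_eq_sub]
    linarith
  · intro A B s
    ext <;> simp [rot, Perc.seg] <;> ring

/-- A set of configurations with an open path along a given segment. -/
lemma Good.exists_tube {f : TriE → ℝ} (hf : Good f) {c K : ℝ} (hc : 0 < c) (hK : 0 < K) :
    ∃ δ : ℝ, 0 < δ ∧ ∃ N0 : ℕ, ∀ N : ℕ, N0 ≤ N → ∀ g gi : Pt → Pt, RotPair g gi →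
    ∀ A B : Pt, d1 A B ≤ K * N → ∃ T : Set (Config TriE), IsUpperSet T ∧ FD T ∧
      δ ≤ (bern f).real T ∧ ∀ ω ∈ T, ∃ (W : Set Vx) (u v : Vx), Conn ω W u v ∧
        (∀ z, d1 z (tv u.1 u.2) ≤ 10 → |(gi z).1 - A.1| ≤ c * N ∧ |(gi z).2 - A.2| ≤ c * N) ∧
        (∀ z, d1 z (tv v.1 v.2) ≤ 10 → |(gi z).1 - B.1| ≤ c * N ∧ |(gi z).2 - B.2| ≤ c * N) ∧
        ∀ w ∈ W, ∃ s ∈ Icc (0:ℝ) 1, ∀ z, d1 z (tv w.1 w.2) ≤ 10 →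
          |(gi z).1 - (seg A B s).1| ≤ c * N ∧ |(gi z).2 - (seg A B s).2| ≤ c * N := by
  obtain ⟨δ, hδ, n0, h⟩ := hf.tube
  obtain ⟨M, hM⟩ := exists_nat_ge (80 * K / c + 1)
  obtain ⟨N0, hN0⟩ := exists_nat_ge ((20 * n0 + 100) / c)
  refine ⟨δ ^ (M + 1), by positivity, N0, fun N hN g gi hg A B hAB => ?_⟩
  have hcN : 20 * (n0:ℝ) + 100 ≤ c * N := by
    have : (N0:ℝ) ≤ N := by exact_mod_cast hN
    rw [div_le_iff₀ hc] at hN0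
    nlinarith
  have hn0 : (0:ℝ) ≤ n0 := Nat.cast_nonneg _
  have hK' : 0 ≤ 80 * K / c := by positivity
  have hMK : 80 * K ≤ M * c := by
    have : 80 * K / c ≤ M := by linarith
    rwa [div_le_iff₀ hc] at this
  set n := ⌊c * N / 20⌋₊ with hn
  have f1 : (n:ℝ) ≤ c * N / 20 := Nat.floor_le (by linarith)
  have f2 : c * N / 20 < n + 1 := Nat.lt_floor_add_one _
  have hn1 : n0 ≤ n := by
    have : (n0:ℝ) < n + 1 := by linarith
    exact Nat.lt_succ_iff.1 (by exact_mod_cast this)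
  have hn2 : 1 ≤ n := by
    have : (1:ℝ) < n + 1 := by linarith
    exact Nat.lt_succ_iff.1 (by exact_mod_cast this)
  have hM1 : 1 ≤ M := by
    have : (1:ℝ) ≤ M := by linarith
    exact_mod_cast this
  obtain ⟨T, hT1, hT2, hT3, hT4⟩ := h n hn1 hn2 M hM1 (g A) (g B) (by
    have e1 := hg.d1_le A B
    have e2 : c * N / 40 ≤ (n:ℝ) - 1 := by linarith
    have e3 : (M:ℝ) * (c * N / 40) ≤ M * (n - 1) := mul_le_mul_of_nonneg_left e2 (Nat.cast_nonneg _)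
    have e4 : 80 * K * N ≤ M * c * N := mul_le_mul_of_nonneg_right hMK (Nat.cast_nonneg _)
    linarith)
  have tri : ∀ (z w y : Pt), d1 z w ≤ 10 → d1 w y ≤ 18 * n →
      |(gi z).1 - (gi y).1| ≤ c * N ∧ |(gi z).2 - (gi y).2| ≤ c * N := by
    intro z w y h1 h2
    have := abs_sub_le (gi z).1 (gi w).1 (gi y).1
    have := abs_sub_le (gi z).2 (gi w).2 (gi y).2
    have := hg.fst_le z w
    have := hg.fst_le w y
    have := hg.snd_le z w
    have := hg.snd_le w y
    constructor <;> linarith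
  refine ⟨T, hT1, hT2, hT3, fun ω hω => ?_⟩
  obtain ⟨W, u, v, huv, h1, h2, h3⟩ := hT4 ω hω
  refine ⟨W, u, v, huv, fun z hz => ?_, fun z hz => ?_, fun w hw => ?_⟩
  · simpa [hg.left_inv] using tri z _ _ hz h1
  · simpa [hg.left_inv] using tri z _ _ hz h2
  · obtain ⟨s, hs, h4⟩ := h3 w hw
    refine ⟨s, hs, fun z hz => ?_⟩
    simpa [hg.left_inv, hg.seg] using tri z _ _ hz h4

/-- Open paths of the triangular lattice give paths in the set of open edges of `L`. -/
def Follows {E : Type} (L : LatticeOn E) (ω : Config E) (ω' : Config TriE) : Prop :=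
  ∃ pos : Vx → Pt, (∀ w, d1 (pos w) (tv w.1 w.2) ≤ 10) ∧ ∀ x y, Adj ω' x y →
    JoinedIn (openEdgeSet L ω ∩ {z | d1 z (tv x.1 x.2) ≤ 10}) (pos x) (pos y)

lemma Follows.crossing {E : Type} {L : LatticeOn E} {ω : Config E} {ω' : Config TriE}
    (h : Follows L ω ω') {W : Set Vx} {u v : Vx} (huv : Conn ω' W u v) {c : Pt → ℝ} (hc : Continuous c)
    {l : ℝ} (hl : 0 < l) (h0 : ∀ z, d1 z (tv u.1 u.2) ≤ 10 → c z ≤ 0)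
    (h1 : ∀ z, d1 z (tv v.1 v.2) ≤ 10 → l ≤ c z) :
    ∃ γ : ℝ → Pt, ContinuousOn γ (Icc 0 1) ∧ c (γ 0) = 0 ∧ c (γ 1) = l ∧
      ∀ t ∈ Icc (0:ℝ) 1, 0 ≤ c (γ t) ∧ c (γ t) ≤ l ∧ γ t ∈ openEdgeSet L ω ∧
        ∃ w ∈ W, d1 (γ t) (tv w.1 w.2) ≤ 10 := by
  obtain ⟨pos, hp, hs⟩ := h
  have key : u = v ∨ JoinedIn (openEdgeSet L ω ∩ {z | ∃ w ∈ W, d1 z (tv w.1 w.2) ≤ 10}) (pos u) (pos v) := by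
    clear h0 h1
    induction huv with
    | refl => exact Or.inl rfl
    | @tail x y _ hxy ih =>
      right
      have hj := (hs x y hxy.1).mono (show _ ⊆ openEdgeSet L ω ∩ {z | ∃ w ∈ W, d1 z (tv w.1 w.2) ≤ 10} from
        fun z hz => ⟨hz.1, x, hxy.2.1, hz.2⟩)
      rcases ih with rfl | ih
      · exact hj
      · exact ih.trans hj
  rcases key with rfl | key
  · linarith [h0 _ (hp u), h1 _ (hp u)]
  · exact exists_path_between_levels key hc hl (h0 _ (hp u)) (h1 _ (hp v))

lemma mem_segment_d1 {P Q C z : Pt} {r : ℝ} (hz : z ∈ segment ℝ P Q) (h1 : d1 P C ≤ r) (h2 : d1 Q C ≤ r) :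
    d1 z C ≤ r := by
  obtain ⟨a, b, ha, hb, hab, rfl⟩ := hz
  have key : ∀ x y c : ℝ, |a * x + b * y - c| ≤ a * |x - c| + b * |y - c| := by
    intro x y c
    rw [show a * x + b * y - c = a * (x - c) + b * (y - c) by linear_combination c * hab]
    refine (abs_add_le _ _).trans ?_
    rw [abs_mul, abs_mul, abs_of_nonneg ha, abs_of_nonneg hb]
  have k1 := key P.1 Q.1 C.1
  have k2 := key P.2 Q.2 C.2
  unfold d1 at *
  simp only [Prod.fst_add, Prod.snd_add, Prod.smul_fst, Prod.smul_snd, smul_eq_mul]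
  have e1 := mul_le_mul_of_nonneg_left h1 ha
  have e2 := mul_le_mul_of_nonneg_left h2 hb
  have e3 : a * r + b * r = r := by rw [← add_mul, hab, one_mul]
  linarith

lemma joinedIn_edge {E : Type} {L : LatticeOn E} {ω : Config E} {e : E} (he : ω e = true) {P Q C : Pt}
    (hPQ : L.ends e = (P, Q)) (h1 : d1 P C ≤ 10) (h2 : d1 Q C ≤ 10) :
    JoinedIn (openEdgeSet L ω ∩ {z | d1 z C ≤ 10}) P Q := by
  refine JoinedIn.of_segment_subset fun z hz => ⟨mem_iUnion₂.2 ⟨e, he, ?_⟩, mem_segment_d1 hz h1 h2⟩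
  rwa [hPQ]

lemma d1_le_ten {P Q : Pt} (h1 : P.1 - Q.1 ≤ 5) (h2 : -5 ≤ P.1 - Q.1) (h3 : P.2 - Q.2 ≤ 5)
    (h4 : -5 ≤ P.2 - Q.2) : d1 P Q ≤ 10 := by
  have := abs_le.2 ⟨h2, h1⟩
  have := abs_le.2 ⟨h4, h3⟩
  unfold d1
  linarith

lemma follows_tri (ω : Config TriE) : Follows triLattice ω ω := by
  have h3 := sqrt_three_bounds
  refine ⟨fun w => tv w.1 w.2, fun w => by simp [d1], ?_⟩
  rintro ⟨a, b⟩ y hxy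
  rcases adj_iff.1 hxy with ⟨h, rfl⟩ | ⟨h, rfl⟩ | ⟨h, rfl⟩ | ⟨h, rfl⟩ | ⟨h, rfl⟩ | ⟨h, rfl⟩
  · refine joinedIn_edge h (by simp [triLattice]) ?_ ?_ <;>
      (apply d1_le_ten <;> simp only [tv] <;> push_cast <;> linarith)
  · refine (joinedIn_edge h (P := tv (a - 1) b) (by simp [triLattice]) ?_ ?_).symm <;>
      (apply d1_le_ten <;> simp only [tv] <;> push_cast <;> linarith)
  · refine joinedIn_edge h (by simp [triLattice]) ?_ ?_ <;>
      (apply d1_le_ten <;> simp only [tv] <;> push_cast <;> linarith)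
  · refine (joinedIn_edge h (P := tv (a + 1) (b - 1)) (by simp [triLattice]) ?_ ?_).symm <;>
      (apply d1_le_ten <;> simp only [tv] <;> push_cast <;> linarith)
  · refine joinedIn_edge h (by simp [triLattice]) ?_ ?_ <;>
      (apply d1_le_ten <;> simp only [tv] <;> push_cast <;> linarith)
  · refine (joinedIn_edge h (P := tv a (b - 1)) (by simp [triLattice]) ?_ ?_).symm <;>
      (apply d1_le_ten <;> simp only [tv] <;> push_cast <;> linarith)

lemma Follows.hasBoxCrossings {E : Type} {L : LatticeOn E} {ω : Config E} {ω' : Config TriE}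
    (h : Follows L ω ω') {g gi : Pt → Pt} (hg : RotPair g gi) {X Y c : ℝ} (hX : 0 < X) (hY : 0 < Y)
    (hc : 0 < c) (hcX : 2 * c ≤ X) (hcY : 2 * c ≤ Y) {W W' : Set Vx} {u v u' v' : Vx}
    (huv : Conn ω' W u v) (huv' : Conn ω' W' u' v')
    (hu : ∀ z, d1 z (tv u.1 u.2) ≤ 10 → |(gi z).1 - -c| ≤ c ∧ |(gi z).2 - Y / 2| ≤ c)
    (hv : ∀ z, d1 z (tv v.1 v.2) ≤ 10 → |(gi z).1 - (X + c)| ≤ c ∧ |(gi z).2 - Y / 2| ≤ c)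
    (hw : ∀ w ∈ W, ∃ s ∈ Icc (0:ℝ) 1, ∀ z, d1 z (tv w.1 w.2) ≤ 10 →
      |(gi z).1 - (seg (-c, Y / 2) (X + c, Y / 2) s).1| ≤ c ∧
      |(gi z).2 - (seg (-c, Y / 2) (X + c, Y / 2) s).2| ≤ c)
    (hu' : ∀ z, d1 z (tv u'.1 u'.2) ≤ 10 → |(gi z).1 - X / 2| ≤ c ∧ |(gi z).2 - -c| ≤ c)
    (hv' : ∀ z, d1 z (tv v'.1 v'.2) ≤ 10 → |(gi z).1 - X / 2| ≤ c ∧ |(gi z).2 - (Y + c)| ≤ c)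
    (hw' : ∀ w ∈ W', ∃ s ∈ Icc (0:ℝ) 1, ∀ z, d1 z (tv w.1 w.2) ≤ 10 →
      |(gi z).1 - (seg (X / 2, -c) (X / 2, Y + c) s).1| ≤ c ∧
      |(gi z).2 - (seg (X / 2, -c) (X / 2, Y + c) s).2| ≤ c) :
    HasBoxCrossings L ω X Y g := by
  have im : ∀ {S : Set Pt} {z : Pt}, gi z ∈ S → z ∈ g '' S := fun {S z} hz => ⟨gi z, hz, hg.right_inv z⟩
  constructor
  · obtain ⟨γ, c1, c2, c3, c4⟩ := h.crossing huv (c := fun z => (gi z).1) (continuous_fst.comp hg.cont) hX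
      (fun z hz => by linarith [(abs_le.1 (hu z hz).1).2]) (fun z hz => by linarith [(abs_le.1 (hv z hz).1).1])
    have k : ∀ t ∈ Icc (0:ℝ) 1, 0 ≤ (gi (γ t)).2 ∧ (gi (γ t)).2 ≤ Y := by
      intro t ht
      obtain ⟨-, -, -, w, hwW, hd⟩ := c4 t ht
      obtain ⟨s, -, h1⟩ := hw w hwW
      have := abs_le.1 (h1 _ hd).2
      simp only [seg, sub_self, mul_zero, add_zero] at this
      constructor <;> linarith
    exact ⟨γ, c1, im ⟨c2, k 0 (by simp)⟩, im ⟨c3, k 1 (by simp)⟩,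
      fun t ht => ⟨im ⟨(c4 t ht).1, (c4 t ht).2.1, k t ht⟩, (c4 t ht).2.2.1⟩⟩
  · obtain ⟨γ, c1, c2, c3, c4⟩ := h.crossing huv' (c := fun z => (gi z).2) (continuous_snd.comp hg.cont) hY
      (fun z hz => by linarith [(abs_le.1 (hu' z hz).2).2]) (fun z hz => by linarith [(abs_le.1 (hv' z hz).2).1])
    have k : ∀ t ∈ Icc (0:ℝ) 1, 0 ≤ (gi (γ t)).1 ∧ (gi (γ t)).1 ≤ X := by
      intro t ht
      obtain ⟨-, -, -, w, hwW, hd⟩ := c4 t ht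
      obtain ⟨s, -, h1⟩ := hw' w hwW
      have := abs_le.1 (h1 _ hd).1
      simp only [seg, sub_self, mul_zero, add_zero] at this
      constructor <;> linarith
    exact ⟨γ, c1, im ⟨c2, k 0 (by simp)⟩, im ⟨c3, k 1 (by simp)⟩,
      fun t ht => ⟨im ⟨(k t ht).1, (k t ht).2, (c4 t ht).1, (c4 t ht).2.1⟩, (c4 t ht).2.2.1⟩⟩

lemma Good.exists_boxCrossings {f : TriE → ℝ} (hf : Good f) {α : ℝ} (hα : 0 < α) :
    ∃ δ : ℝ, 0 < δ ∧ ∃ N0 : ℕ, ∀ N : ℕ, N0 ≤ N → ∀ g : Pt → Pt, IsRotTrans g →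
      ∃ T : Set (Config TriE), IsUpperSet T ∧ FD T ∧ δ ≤ (bern f).real T ∧
        ∀ ω' ∈ T, ∀ {E : Type} {L : LatticeOn E} {ω : Config E}, Follows L ω ω' →
          HasBoxCrossings L ω (α * N) N g := by
  set β := min α 1 / 2 with hβ
  have hβ0 : 0 < β := by positivity
  have hβα : 2 * β ≤ α := by linarith [min_le_left α 1]
  have hβ1 : 2 * β ≤ 1 := by linarith [min_le_right α 1]
  obtain ⟨δ, hδ, N0, h⟩ := hf.exists_tube hβ0 (K := α + 2) (by linarith)
  refine ⟨δ * δ, mul_pos hδ hδ, N0 + 1, fun N hN g hg => ?_⟩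
  obtain ⟨gi, hgi⟩ := hg.exists_pair
  have hN0 : (0:ℝ) < N := by exact_mod_cast (by omega : 0 < N)
  have hαN : 0 < α * N := by positivity
  have hβN : 0 < β * N := by positivity
  have k1 : 2 * (β * N) ≤ α * N := by nlinarith
  have k2 : 2 * (β * N) ≤ N := by nlinarith
  obtain ⟨T, t1, t2, t3, t4⟩ := h N (by omega) g gi hgi (-(β * N), N / 2) (α * N + β * N, N / 2) (by
    simp only [d1, sub_self, abs_zero, add_zero]
    rw [abs_le]
    constructor <;> linarith)
  obtain ⟨T', t1', t2', t3', t4'⟩ := h N (by omega) g gi hgi (α * N / 2, -(β * N)) (α * N / 2, N + β * N) (by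
    simp only [d1, sub_self, abs_zero, zero_add]
    rw [abs_le]
    constructor <;> linarith)
  refine ⟨T ∩ T', t1.inter t1', t2.inter t2', (mul_le_mul t3 t3' hδ.le measureReal_nonneg).trans
    (bern_fkg f t1 t1' t2 t2'), fun ω' hω' E L ω hF => ?_⟩
  obtain ⟨W, u, v, huv, hu, hv, hw⟩ := t4 ω' hω'.1
  obtain ⟨W', u', v', huv', hu', hv', hw'⟩ := t4' ω' hω'.2
  exact hF.hasBoxCrossings hgi hαN hN0 hβN k1 k2 huv huv' hu hv hw hu' hv' hw'

lemma follows_hex (ω : Config TriE) : Follows hexLattice ω (dualC fun e => !(ω e)) := by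
  have h3 := sqrt_three_bounds
  refine ⟨fun w => hdown w.1 w.2, fun w => ?_, ?_⟩
  · apply d1_le_ten <;> simp only [tv, hdown] <;> linarith
  rintro ⟨a, b⟩ y hxy
  have e0 : ∀ {x y : ℤ} {C : Pt}, ω (x, y, 0) = true → d1 (hdown x y) C ≤ 10 → d1 (hup x y) C ≤ 10 →
      JoinedIn (openEdgeSet hexLattice ω ∩ {z | d1 z C ≤ 10}) (hdown x y) (hup x y) :=
    fun h => joinedIn_edge h (by simp [hexLattice])
  have e1 : ∀ {x y : ℤ} {C : Pt}, ω (x, y, 1) = true → d1 (hup x y) C ≤ 10 → d1 (hdown x (y + 1)) C ≤ 10 →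
      JoinedIn (openEdgeSet hexLattice ω ∩ {z | d1 z C ≤ 10}) (hup x y) (hdown x (y + 1)) :=
    fun h => joinedIn_edge h (by simp [hexLattice])
  have e2 : ∀ {x y : ℤ} {C : Pt}, ω (x, y, 2) = true → d1 (hup x y) C ≤ 10 →
      d1 (hdown (x - 1) (y + 1)) C ≤ 10 →
      JoinedIn (openEdgeSet hexLattice ω ∩ {z | d1 z C ≤ 10}) (hup x y) (hdown (x - 1) (y + 1)) :=
    fun h => joinedIn_edge h (by simp [hexLattice])
  rcases adj_iff.1 hxy with ⟨h, rfl⟩ | ⟨h, rfl⟩ | ⟨h, rfl⟩ | ⟨h, rfl⟩ | ⟨h, rfl⟩ | ⟨h, rfl⟩ <;>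
    simp [dualC] at h <;> obtain ⟨h, h'⟩ := h
  · have r1 := e2 (C := tv a b) h' ?_ ?_
    have r2 := e1 (C := tv a b) h ?_ ?_
    · simpa using r1.symm.trans r2
    all_goals apply d1_le_ten <;> simp only [tv, hdown, hup] <;> push_cast <;> linarith
  · have r1 := e2 (C := tv a b) h' ?_ ?_
    have r2 := e1 (C := tv a b) h ?_ ?_
    · simpa using r2.symm.trans r1
    all_goals apply d1_le_ten <;> simp only [tv, hdown, hup] <;> push_cast <;> linarith
  · have r1 := e0 (C := tv a b) h ?_ ?_
    have r2 := e2 (C := tv a b) h' ?_ ?_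
    · simpa using r1.trans r2
    all_goals apply d1_le_ten <;> simp only [tv, hdown, hup] <;> push_cast <;> linarith
  · have r1 := e0 (C := tv a b) h ?_ ?_
    have r2 := e2 (C := tv a b) h' ?_ ?_
    · simpa using (r1.trans r2).symm
    all_goals apply d1_le_ten <;> simp only [tv, hdown, hup] <;> push_cast <;> linarith
  · have r1 := e0 (C := tv a b) h ?_ ?_
    have r2 := e1 (C := tv a b) h' ?_ ?_
    · simpa using r1.trans r2
    all_goals apply d1_le_ten <;> simp only [tv, hdown, hup] <;> push_cast <;> linarith
  · have r1 := e0 (C := tv a b) h ?_ ?_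
    have r2 := e1 (C := tv a b) h' ?_ ?_
    · simpa using (r1.trans r2).symm
    all_goals apply d1_le_ten <;> simp only [tv, hdown, hup] <;> push_cast <;> linarith

/-- If `p ∈ (0,1)` and `q, q' ∈ [0,1]^ℤ` satisfy
`κ_△(p, q_n, q'_n) = 0` for every `n`, then both the highly inhomogeneous measure
`P^△_{p,q,q'}` on the triangular lattice and its dual `P^⬡_{1-p,1-q,1-q'}` on the
hexagonal lattice have the box-crossing property. -/
theorem highly_inhomogeneous_tri_hex_box_crossing (p : ℝ) (q q' : ℤ → ℝ)
    (hp : p ∈ Set.Ioo (0 : ℝ) 1)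
    (hq : ∀ n, q n ∈ Set.Icc (0 : ℝ) 1) (hq' : ∀ n, q' n ∈ Set.Icc (0 : ℝ) 1)
    (hκ : ∀ n : ℤ, kappaT p (q n) (q' n) = 0) :
    (∀ P : Measure (Config TriE),
      IsBernoulliProduct (triHI p q q') P → BoxCrossingProperty triLattice P) ∧
    (∀ P : Measure (Config TriE),
      IsBernoulliProduct (triHI (1 - p) (fun n => 1 - q n) (fun n => 1 - q' n)) P →
        BoxCrossingProperty hexLattice P) := by
  have hHI : IsHI p q q' := ⟨hp, hq, hq', hκ⟩
  have hG : Good (triHI p q q') := good_rowInt (ρ := fun n => (q n, q' n)) hHI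
  refine ⟨fun P hP α hα => ?_, fun P hP α hα => ?_⟩
  · obtain ⟨δ, hδ, N0, h⟩ := hG.exists_boxCrossings hα
    refine ⟨δ, hδ, N0, fun N hN g hg => ?_⟩
    obtain ⟨T, -, -, hT, hT'⟩ := h N hN g hg
    rw [isBernoulliProduct_eq hHI.mem hP]
    exact (ENNReal.ofReal_le_of_le_toReal hT).trans
      (measure_mono fun ω hω => hT' ω hω (follows_tri ω))
  · obtain ⟨δ, hδ, N0, h⟩ := hG.exists_boxCrossings hα
    refine ⟨δ, hδ, N0, fun N hN g hg => ?_⟩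
    obtain ⟨T, hup, hFD, hT, hT'⟩ := h N hN g hg
    have hmem := hHI.mem
    have hdual : triHI (1 - p) (fun n => 1 - q n) (fun n => 1 - q' n) = fun e => 1 - triHI p q q' e := by
      ext e
      simp only [triHI]
      split_ifs <;> rfl
    rw [hdual] at hP
    rw [isBernoulliProduct_eq
      (fun e => ⟨by linarith [(hmem e).2], by linarith [(hmem e).1]⟩) hP]
    refine (ENNReal.ofReal_le_of_le_toReal (hT.trans ?_)).trans
      (measure_mono (s := (fun ω e => !(ω e)) ⁻¹' (dualC ⁻¹' T)) fun ω hω => hT' _ hω (follows_hex ω))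
    have hlaw := bern_real_not (fun e => 1 - triHI p q q' e)
      (fun e => ⟨by linarith [(hmem e).2], by linarith [(hmem e).1]⟩) (hFD.preimage dualC dualC_FD)
    simp only [sub_sub_cancel] at hlaw
    rw [← measureReal_def, hlaw, dual_law hHI hFD]
    exact measureReal_mono fun ω hω => hup (le_triMap _ _ _) hω

end Perc
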